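/- arXiv:2304.08689 — 2 statements merged into one kernel-verified Lean document; each statement's English description precedes it below -/
import Mathlib

section
/- Fix a positive integer s and a real ε > 0. There exist δ > 0 and C > 0, depending only on s and ε, with the following property. Let p be a prime and let H = M be integers with M > p^{17/35 + ε}. Let 𝓜_1, …, 𝓜_6 ⊆ 𝔽_p^* be sets each of cardinality M, and let L_1, …, L_6 be integers such that {L_i+1, …, L_i+H} ⊆ {1, …, p−1} for each i. For any integer λ, let T_6(λ) denote the number of solutions of m_1·x_1^{−s} + ⋯ + m_6·x_6^{−s} ≡ λ (mod p) with m_i ∈ 𝓜_i and x_i ∈ {L_i+1, …, L_i+H} for i = 1, …, 6. Then |T_6(λ) − H^6·M^6/p| ≤ C · (H^6·M^6/p) · p^{−δ}. -/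
open Finset
open Finset
namespace W17

lemma prime_pow_bound (η : ℝ) (hη : 0 < η) : ∃ K : ℝ, 1 ≤ K ∧ ∀ e : ℕ, ∀ q : ℕ, 2 ≤ q →
    ((e : ℝ) + 1) ≤ K * ((q : ℝ) ^ e) ^ η := by
  refine ⟨1 + 1 / (η * Real.log 2), ?_, ?_⟩
  · have : 0 < Real.log 2 := Real.log_pos (by norm_num)
    have : 0 ≤ 1 / (η * Real.log 2) := by positivity
    linarith
  · intro e q hq
    have hl : 0 < Real.log 2 := Real.log_pos (by norm_num)
    have hq' : (2 : ℝ) ≤ q := by exact_mod_cast hq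
    have h1 : ((2 : ℝ) ^ e) ^ η ≤ ((q : ℝ) ^ e) ^ η := by gcongr
    have h2 : 1 + e * (η * Real.log 2) ≤ ((2 : ℝ) ^ e) ^ η := by
      rw [← Real.rpow_natCast, ← Real.rpow_mul (by norm_num), Real.rpow_def_of_pos (by norm_num)]
      have := Real.add_one_le_exp (Real.log 2 * (e * η))
      nlinarith
    have hk : 0 < η * Real.log 2 := by positivity
    calc (e : ℝ) + 1 ≤ (1 + 1 / (η * Real.log 2)) * (1 + e * (η * Real.log 2)) := by
          have : (1 + 1 / (η * Real.log 2)) * (1 + e * (η * Real.log 2)) =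
            1 + e + e * (η * Real.log 2) + 1 / (η * Real.log 2) := by field_simp; ring
          rw [this]
          have : 0 ≤ 1 / (η * Real.log 2) := by positivity
          have : 0 ≤ e * (η * Real.log 2) := by positivity
          linarith
      _ ≤ _ := by gcongr; linarith

lemma divisor_bound (η : ℝ) (hη : 0 < η) : ∃ C : ℝ, 1 ≤ C ∧ ∀ n : ℕ, n ≠ 0 →
    (n.divisors.card : ℝ) ≤ C * (n : ℝ) ^ η := by
  obtain ⟨K, hK1, hK⟩ := prime_pow_bound η hη
  obtain ⟨B, hB⟩ := exists_nat_ge ((2 : ℝ) ^ (1 / η))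
  refine ⟨K ^ B, one_le_pow₀ hK1, ?_⟩
  intro n hn
  rw [Nat.card_divisors hn]
  push_cast
  have hbig : ∀ q ∈ n.primeFactors, ((n.factorization q : ℝ) + 1) ≤
      (if q < B then K else 1) * ((q : ℝ) ^ (n.factorization q)) ^ η := by
    intro q hq
    have hq2 := (Nat.prime_of_mem_primeFactors hq).two_le
    split_ifs with h
    · exact hK _ _ hq2
    · have hqB : (2 : ℝ) ^ (1 / η) ≤ q := hB.trans (by exact_mod_cast not_lt.mp h)
      have h2 : (2 : ℝ) ≤ (q : ℝ) ^ η := by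
        calc (2 : ℝ) = ((2 : ℝ) ^ (1 / η)) ^ η := by
              rw [← Real.rpow_mul (by norm_num)]; field_simp; simp
          _ ≤ _ := by gcongr
      rw [one_mul, ← Real.rpow_natCast, ← Real.rpow_mul (by positivity), mul_comm,
        Real.rpow_mul (by positivity), Real.rpow_natCast]
      calc ((n.factorization q : ℝ) + 1) ≤ (2 : ℝ) ^ (n.factorization q) := by
            exact_mod_cast Nat.lt_two_pow_self
        _ ≤ _ := by gcongr
  calc ∏ q ∈ n.primeFactors, ((n.factorization q : ℝ) + 1)
      ≤ ∏ q ∈ n.primeFactors, ((if q < B then K else 1) * ((q : ℝ) ^ (n.factorization q)) ^ η) :=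
        Finset.prod_le_prod (fun _ _ => by positivity) hbig
    _ = (∏ q ∈ n.primeFactors, (if q < B then K else 1)) *
        (∏ q ∈ n.primeFactors, ((q : ℝ) ^ (n.factorization q))) ^ η := by
        rw [Finset.prod_mul_distrib, Real.finsetProd_rpow]
        intro i _; positivity
    _ ≤ K ^ B * (n : ℝ) ^ η := by
        have e1 : (∏ q ∈ n.primeFactors, ((q : ℝ) ^ (n.factorization q))) = n := by
          have := Nat.prod_factorization_pow_eq_self hn
          conv_rhs => rw [← this]
          rw [Finsupp.prod]; push_cast; rfl
        rw [e1]
        gcongr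
        rw [← Finset.prod_filter, Finset.prod_const]
        apply pow_le_pow_right₀ hK1
        calc _ ≤ (Finset.range B).card := by
              apply Finset.card_le_card; intro x; simp
          _ = B := by simp

end W17
open Finset
namespace W17

lemma class_count (T : Finset ℤ) (L : ℤ) (N : ℕ) (hT : T ⊆ Icc (L+1) (L+N)) (u : ℤ) (hu : u ≠ 0)
    (h : ∀ x ∈ T, ∀ y ∈ T, u ∣ x - y) : (T.card : ℝ) ≤ 1 + N / |(u : ℝ)| := by
  have hupos : 0 < |u| := abs_pos.mpr hu
  have hur : (0 : ℝ) < |(u:ℝ)| := by exact_mod_cast hupos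
  rcases T.eq_empty_or_nonempty with rfl | ⟨x0, hx0⟩
  · simp; positivity
  have hsub : T ⊆ (Ioc L (L+N)).filter (fun x => x ≡ x0 [ZMOD |u|]) := by
    intro x hx
    have := mem_Icc.mp (hT hx)
    simp only [mem_filter, mem_Ioc]
    refine ⟨⟨by omega, by omega⟩, ?_⟩
    apply Int.ModEq.symm
    rw [Int.modEq_iff_dvd]
    exact (abs_dvd _ _).mpr (h x hx x0 hx0)
  have h1 := card_le_card hsub
  have h2 := Int.Ioc_filter_modEq_card L (L+N) hupos x0
  have h3 : ((T.card : ℤ) : ℚ) ≤ 1 + N / (|u| : ℤ) := by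
    have : (T.card : ℤ) ≤ max (⌊((L+N : ℤ) - x0) / ((|u| : ℤ) : ℚ)⌋ - ⌊(L - x0) / ((|u| : ℤ) : ℚ)⌋) 0 := by
      rw [← h2]; exact_mod_cast h1
    have hq : (0:ℚ) < ((|u| : ℤ) : ℚ) := by exact_mod_cast hupos
    rcases le_max_iff.mp this with h | h
    · have a1 := Int.floor_le (((L+N : ℤ) - x0) / ((|u| : ℤ) : ℚ))
      have a2 := Int.sub_one_lt_floor ((L - x0) / ((|u| : ℤ) : ℚ))
      have e : (((L+N : ℤ) : ℚ) - x0) / ((|u| : ℤ) : ℚ) = (L - x0) / ((|u| : ℤ) : ℚ) + N / ((|u| : ℤ) : ℚ) := by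
        push_cast; ring
      have h' : ((T.card : ℤ) : ℚ) ≤ (⌊((L+N : ℤ) - x0) / ((|u| : ℤ) : ℚ)⌋ : ℚ) - ⌊(L - x0) / ((|u| : ℤ) : ℚ)⌋ := by
        exact_mod_cast h
      linarith
    · have : ((T.card : ℤ) : ℚ) ≤ 0 := by exact_mod_cast h
      have : (0 : ℚ) ≤ N / ((|u| : ℤ) : ℚ) := by positivity
      linarith
  have h4 : (((T.card : ℚ)) : ℝ) ≤ ((1 + N / ((|u| : ℤ) : ℚ) : ℚ) : ℝ) := by exact_mod_cast h3
  push_cast at h4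
  exact h4

/-- number of representations of `d` as a ratio of two elements of `X`. -/
def rr (p : ℕ) (X : Finset ℤ) (d : ZMod p) : ℕ :=
  ((X ×ˢ X).filter (fun q => (q.1 : ZMod p) = d * (q.2 : ZMod p))).card

lemma int_eq_zero_of_cast {p : ℕ} {z : ℤ} (h : (z : ZMod p) = 0) (hz : |z| < p) : z = 0 := by
  rw [ZMod.intCast_zmod_eq_zero_iff_dvd] at h
  exact Int.eq_zero_of_abs_lt_dvd h hz

lemma box_abs {L : ℤ} {N : ℕ} {x y : ℤ} (hx : x ∈ Icc (L+1) (L+N)) (hy : y ∈ Icc (L+1) (L+N)) :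
    |x - y| + 1 ≤ N := by
  rw [mem_Icc] at hx hy
  have : |x - y| ≤ (N:ℤ) - 1 := abs_le.mpr ⟨by omega, by omega⟩
  omega

lemma rr_le {p : ℕ} [Fact p.Prime] (X : Finset ℤ) (L : ℤ) (N : ℕ) (hX : X ⊆ Icc (L+1) (L+N))
    (hN : 2 * N ^ 2 ≤ p) (d : ZMod p) (hd : d ≠ 0) (u v : ℤ) (huv : IsCoprime u v)
    (hu0 : u ≠ 0) (hv0 : v ≠ 0) (hu : |u| ≤ N) (hv : |v| ≤ N) (h : (u : ZMod p) = d * v) :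
    (rr p X d : ℝ) ≤ 1 + N / |(u : ℝ)| ∧ (rr p X d : ℝ) ≤ 1 + N / |(v : ℝ)| := by
  classical
  set S := (X ×ˢ X).filter (fun q => (q.1 : ZMod p) = d * (q.2 : ZMod p)) with hS
  have key : ∀ q ∈ S, ∀ w ∈ S, v * (q.1 - w.1) = u * (q.2 - w.2) := by
    intro q hq w hw
    simp only [hS, mem_filter, mem_product] at hq hw
    have b1 := box_abs (hX hq.1.1) (hX hw.1.1)
    have b2 := box_abs (hX hq.1.2) (hX hw.1.2)
    have hz : ((v * (q.1 - w.1) - u * (q.2 - w.2) : ℤ) : ZMod p) = 0 := by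
      push_cast
      rw [hq.2, hw.2, h]; ring
    have := int_eq_zero_of_cast hz (by
      have : |v * (q.1 - w.1) - u * (q.2 - w.2)| ≤ |v| * |q.1 - w.1| + |u| * |q.2 - w.2| := by
        rw [← abs_mul, ← abs_mul]; exact abs_sub _ _
      have hp : (2 * N ^ 2 : ℤ) ≤ p := by exact_mod_cast hN
      have c1 : |v| * |q.1 - w.1| ≤ N * (N - 1) := by
        apply mul_le_mul hv (by omega) (abs_nonneg _) (by positivity)
      have c2 : |u| * |q.2 - w.2| ≤ N * (N - 1) := by
        apply mul_le_mul hu (by omega) (abs_nonneg _) (by positivity)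
      have : 0 < |u| := abs_pos.mpr hu0
      nlinarith)
    linarith
  have i1 : Set.InjOn Prod.fst (S : Set (ℤ × ℤ)) := by
    intro q hq w hw e
    have := key q hq w hw
    replace e : q.1 = w.1 := e
    rw [e, sub_self, mul_zero] at this
    have : q.2 - w.2 = 0 := by
      rcases mul_eq_zero.mp this.symm with h | h
      · exact absurd h hu0
      · exact h
    exact Prod.ext e (by linarith)
  have i2 : Set.InjOn Prod.snd (S : Set (ℤ × ℤ)) := by
    intro q hq w hw e
    have := key q hq w hw
    replace e : q.2 = w.2 := e
    rw [e, sub_self, mul_zero] at this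
    have : q.1 - w.1 = 0 := by
      rcases mul_eq_zero.mp this with h | h
      · exact absurd h hv0
      · exact h
    exact Prod.ext (by linarith) e
  have hr : rr p X d = S.card := rfl
  constructor
  · rw [hr, ← card_image_of_injOn i1]
    apply class_count _ L N _ u hu0
    · intro x hx y hy
      obtain ⟨q, hq, rfl⟩ := mem_image.mp hx
      obtain ⟨w, hw, rfl⟩ := mem_image.mp hy
      have := key q hq w hw
      exact huv.dvd_of_dvd_mul_left (Dvd.intro _ this.symm)
    · intro x hx
      obtain ⟨q, hq, rfl⟩ := mem_image.mp hx
      simp only [hS, mem_filter, mem_product] at hq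
      exact hX hq.1.1
  · rw [hr, ← card_image_of_injOn i2]
    apply class_count _ L N _ v hv0
    · intro x hx y hy
      obtain ⟨q, hq, rfl⟩ := mem_image.mp hx
      obtain ⟨w, hw, rfl⟩ := mem_image.mp hy
      have := key q hq w hw
      exact huv.symm.dvd_of_dvd_mul_left (Dvd.intro _ this)
    · intro x hx
      obtain ⟨q, hq, rfl⟩ := mem_image.mp hx
      simp only [hS, mem_filter, mem_product] at hq
      exact hX hq.1.2

/-- nonzero integers of absolute value at most `U`. -/
noncomputable def BB (U : ℕ) : Finset ℤ := (Icc (-(U:ℤ)) U).erase 0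

lemma mem_BB {U : ℕ} {u : ℤ} : u ∈ BB U ↔ u ≠ 0 ∧ |u| ≤ U := by
  simp [BB, abs_le]

lemma card_BB (U : ℕ) : (BB U).card = 2 * U := by
  unfold BB
  rw [card_erase_of_mem (by simp)]
  simp; omega

lemma exists_uv {p : ℕ} [Fact p.Prime] (X : Finset ℤ) (L : ℤ) (N : ℕ) (hX : X ⊆ Icc (L+1) (L+N))
    (hN : 2 * N ^ 2 ≤ p) (d : ZMod p) (hd : d ≠ 0) (h : 2 ≤ rr p X d) :
    ∃ u v : ℤ, IsCoprime u v ∧ u ≠ 0 ∧ v ≠ 0 ∧ |u| ≤ N ∧ |v| ≤ N ∧ (u : ZMod p) = d * v := by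
  have h' : 1 < rr p X d := h
  unfold rr at h'
  rw [one_lt_card] at h'
  obtain ⟨q, hq, w, hw, hne⟩ := h'
  simp only [mem_filter, mem_product] at hq hw
  have b1 := box_abs (hX hq.1.1) (hX hw.1.1)
  have b2 := box_abs (hX hq.1.2) (hX hw.1.2)
  have hNp : (N : ℤ) ≤ p := by
    have : N ≤ 2 * N ^ 2 := by nlinarith
    exact_mod_cast this.trans hN
  set x := q.1 - w.1 with hx
  set y := q.2 - w.2 with hy
  have hxy : (x : ZMod p) = d * y := by
    rw [hx, hy]; push_cast; rw [hq.2, hw.2]; ring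
  have hx0 : x ≠ 0 := by
    intro h0
    rw [h0] at hxy
    have : (y : ZMod p) = 0 := by
      rcases mul_eq_zero.mp (hxy.symm.trans (by simp)) with h | h
      · exact absurd h hd
      · exact h
    have := int_eq_zero_of_cast this (by omega)
    exact hne (Prod.ext (by linarith) (by linarith))
  have hy0 : y ≠ 0 := by
    intro h0
    rw [h0] at hxy
    have : (x : ZMod p) = 0 := by simpa using hxy
    exact hx0 (int_eq_zero_of_cast this (by omega))
  obtain ⟨g, u, v, hg, hcop, hu, hv⟩ := Int.exists_gcd_one' (m := x) (n := y) (Int.gcd_pos_of_ne_zero_left _ hx0)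
  have hu0 : u ≠ 0 := by rintro rfl; simp at hu; exact hx0 hu
  have hv0 : v ≠ 0 := by rintro rfl; simp at hv; exact hy0 hv
  have hg1 : (1 : ℤ) ≤ g := by exact_mod_cast hg
  have ab : ∀ a b : ℤ, a = b * g → a ≠ 0 → |b| ≤ |a| ∧ (g:ℤ) ≤ |a| := by
    intro a b e ha
    have hb : b ≠ 0 := by rintro rfl; simp at e; exact ha e
    have : 1 ≤ |b| := Int.one_le_abs hb
    rw [e, abs_mul, abs_of_pos (by omega : (0:ℤ) < g)]
    constructor <;> nlinarith
  refine ⟨u, v, Int.isCoprime_iff_gcd_eq_one.mpr hcop, hu0, hv0, ?_, ?_, ?_⟩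
  · have := (ab x u hu hx0).1; omega
  · have := (ab y v hv hy0).1; omega
  · have hgp : ((g : ℤ) : ZMod p) ≠ 0 := by
      intro h0
      have := int_eq_zero_of_cast h0 (by
        have := (ab x u hu hx0).2
        rw [abs_of_pos (by omega)]; omega)
      omega
    rw [hu, hv] at hxy
    push_cast at hxy hgp
    apply mul_right_cancel₀ hgp
    rw [hxy]; ring

/-- residues that are ratios of small integers. -/
noncomputable def CC (p U : ℕ) [NeZero p] : Finset (ZMod p) :=
  by
  classical
  exact Finset.univ.filter (fun d => ∃ u ∈ BB U, ∃ v ∈ BB U, (u : ZMod p) = d * v)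

lemma mem_CC {p U : ℕ} [NeZero p] (d : ZMod p) :
    d ∈ CC p U ↔ ∃ u ∈ BB U, ∃ v ∈ BB U, (u : ZMod p) = d * v := by
  classical
  simp [CC]

lemma telescope (m N : ℕ) (hm : 1 ≤ m) (hmN : m ≤ N) :
    ∑ U ∈ Icc m N, (1 : ℝ) / (U * (U + 1)) = 1 / m - 1 / (N + 1) := by
  induction N, hmN using Nat.le_induction with
  | base =>
    have : (m : ℝ) ≠ 0 := by positivity
    have : (m : ℝ) + 1 ≠ 0 := by positivity
    simp; field_simp; ring
  | succ n hn ih =>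
    rw [← Finset.insert_Icc_right_eq_Icc_add_one (by omega), sum_insert (by simp), ih]
    have : (m : ℝ) ≠ 0 := by positivity
    have : (n : ℝ) + 1 ≠ 0 := by positivity
    have : (n : ℝ) + 1 + 1 ≠ 0 := by positivity
    push_cast
    field_simp; ring

lemma rr_bound {p : ℕ} [Fact p.Prime] (X : Finset ℤ) (L : ℤ) (N : ℕ) (hX : X ⊆ Icc (L+1) (L+N))
    (hN : 2 * N ^ 2 ≤ p) (d : ZMod p) (hd : d ≠ 0) :
    (rr p X d : ℝ) ≤ 2 + ∑ U ∈ Icc 1 N, (N : ℝ) / (U * (U + 1)) * (if d ∈ CC p U then 1 else 0) := by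
  have hnn : ∀ U ∈ Icc 1 N, 0 ≤ (N : ℝ) / (U * (U + 1)) * (if d ∈ CC p U then 1 else 0) := by
    intro U _; split_ifs <;> positivity
  by_cases h : 2 ≤ rr p X d
  · obtain ⟨u, v, huv, hu0, hv0, hu, hv, e⟩ := exists_uv X L N hX hN d hd h
    obtain ⟨r1, r2⟩ := rr_le X L N hX hN d hd u v huv hu0 hv0 hu hv e
    have au := Int.abs_eq_natAbs u
    have av := Int.abs_eq_natAbs v
    set m := max u.natAbs v.natAbs with hm
    have hm1 : 1 ≤ m := by
      have := Int.natAbs_pos.mpr hu0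
      omega
    have hmN : m ≤ N := by omega
    have hr : (rr p X d : ℝ) ≤ 1 + N / m := by
      rcases le_total u.natAbs v.natAbs with h | h
      · have : m = v.natAbs := by omega
        rw [this, Nat.cast_natAbs]; push_cast; exact r2
      · have : m = u.natAbs := by omega
        rw [this, Nat.cast_natAbs]; push_cast; exact r1
    have hsum : ∑ U ∈ Icc m N, (N:ℝ) * ((1 : ℝ) / (U * (U + 1))) ≤
        ∑ U ∈ Icc 1 N, (N : ℝ) / (U * (U + 1)) * (if d ∈ CC p U then 1 else 0) := by
      calc _ = ∑ U ∈ Icc m N, (N : ℝ) / (U * (U + 1)) * (if d ∈ CC p U then 1 else 0) := by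
            apply sum_congr rfl
            intro U hU
            rw [mem_Icc] at hU
            rw [if_pos]
            · ring
            · rw [mem_CC]
              refine ⟨u, mem_BB.mpr ⟨hu0, by omega⟩, v, mem_BB.mpr ⟨hv0, by omega⟩, e⟩
        _ ≤ _ := sum_le_sum_of_subset_of_nonneg (Icc_subset_Icc hm1 le_rfl) (fun U hU _ => hnn U hU)
    rw [← mul_sum, telescope m N hm1 hmN] at hsum
    have : (N : ℝ) * (1 / m - 1 / (N + 1)) ≥ N / m - 1 := by
      have : (N : ℝ) * (1 / (N + 1)) ≤ 1 := by
        rw [mul_one_div, div_le_one (by positivity)]; linarith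
      rw [mul_sub, mul_one_div]; linarith
    linarith
  · have : (rr p X d : ℝ) ≤ 1 := by exact_mod_cast (by omega : rr p X d ≤ 1)
    have := sum_nonneg hnn
    linarith

end W17
open Finset
namespace W17

lemma card_filter_prod {α β : Type*} (s : Finset α) (t : Finset β) (R : α → β → Prop)
    [∀ a b, Decidable (R a b)] :
    ((s ×ˢ t).filter (fun q => R q.1 q.2)).card = ∑ a ∈ s, (t.filter (R a)).card := by
  simp only [card_filter]
  rw [sum_product]

lemma sum_card_sq {α β : Type*} (s : Finset α) (t : Finset β) (R : α → β → Prop)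
    [∀ a b, Decidable (R a b)] :
    ∑ a ∈ s, (t.filter (R a)).card ^ 2 =
      ((s ×ˢ (t ×ˢ t)).filter (fun q => R q.1 q.2.1 ∧ R q.1 q.2.2)).card := by
  rw [card_filter_prod s (t ×ˢ t) (fun a q => R a q.1 ∧ R a q.2)]
  apply sum_congr rfl
  intro a _
  rw [sq, ← card_product, filter_product]

lemma energy {F ι : Type*} [Field F] [DecidableEq F] (A : Finset F) (hA : (0:F) ∉ A)
    (I : Finset ι) (φ : ι → F) (hφ : ∀ i ∈ I, φ i ≠ 0) :
    ((A ×ˢ (A ×ˢ I)).filter (fun q => q.1 = φ q.2.2 * q.2.1)).card ^ 4 ≤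
      A.card ^ 5 * (((I ×ˢ I) ×ˢ (I ×ˢ I)).filter
        (fun q => φ q.1.1 * φ q.2.2 = φ q.1.2 * φ q.2.1)).card := by
  classical
  set G := ((A ×ˢ (A ×ˢ I)).filter (fun q => q.1 = φ q.2.2 * q.2.1)).card
  set Q := (((I ×ˢ I) ×ˢ (I ×ˢ I)).filter
        (fun q => φ q.1.1 * φ q.2.2 = φ q.1.2 * φ q.2.1)).card
  set G2 := (((A ×ˢ A) ×ˢ (I ×ˢ I)).filter
        (fun q => φ q.2.1 * q.1.1 = φ q.2.2 * q.1.2)).card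
  have h1 : G ^ 2 ≤ A.card * G2 := by
    have e : G = ∑ a ∈ A, ((A ×ˢ I).filter (fun q => a = φ q.2 * q.1)).card :=
      card_filter_prod A (A ×ˢ I) (fun a q => a = φ q.2 * q.1)
    rw [e]
    refine (sq_sum_le_card_mul_sum_sq).trans ?_
    simp only [Nat.cast_id]
    gcongr
    rw [sum_card_sq A (A ×ˢ I) (fun a q => a = φ q.2 * q.1)]
    apply card_le_card_of_injOn (fun q => ((q.2.1.1, q.2.2.1), (q.2.1.2, q.2.2.2)))
    · rintro ⟨a, ⟨b, i⟩, ⟨c, j⟩⟩ h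
      simp only [coe_filter, mem_product, Set.mem_ofPred_eq] at h ⊢
      refine ⟨⟨⟨h.1.2.1.1, h.1.2.2.1⟩, h.1.2.1.2, h.1.2.2.2⟩, ?_⟩
      rw [← h.2.1, ← h.2.2]
    · rintro ⟨a, ⟨b, i⟩, ⟨c, j⟩⟩ h ⟨a', ⟨b', i'⟩, ⟨c', j'⟩⟩ h' e
      simp only [coe_filter, mem_product, Set.mem_ofPred_eq, Prod.mk.injEq] at h h' e ⊢
      obtain ⟨⟨rfl, rfl⟩, rfl, rfl⟩ := e
      exact ⟨h.2.1.trans h'.2.1.symm, by simp⟩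
  have h2 : G2 ^ 2 ≤ A.card ^ 3 * Q := by
    have e : G2 = ∑ a ∈ A ×ˢ A, ((I ×ˢ I).filter (fun q => φ q.1 * a.1 = φ q.2 * a.2)).card :=
      card_filter_prod (A ×ˢ A) (I ×ˢ I) (fun a q => φ q.1 * a.1 = φ q.2 * a.2)
    rw [e]
    refine (sq_sum_le_card_mul_sum_sq).trans ?_
    simp only [Nat.cast_id]
    rw [sum_card_sq (A ×ˢ A) (I ×ˢ I) (fun a q => φ q.1 * a.1 = φ q.2 * a.2), card_product]
    rw [show A.card ^ 3 * Q = A.card * A.card * (A.card * Q) by ring]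
    gcongr
    rw [← card_product]
    apply card_le_card_of_injOn (fun q => (q.1.1, q.2))
    · rintro ⟨⟨a, b⟩, ⟨i, j⟩, ⟨k, l⟩⟩ h
      simp only [coe_filter, mem_product, Set.mem_ofPred_eq, coe_product, Set.mem_prod, mem_coe] at h ⊢
      obtain ⟨⟨⟨ha, hb⟩, ⟨hi, hj⟩, hk, hl⟩, h1, h2⟩ := h
      refine ⟨ha, ⟨⟨hi, hj⟩, hk, hl⟩, ?_⟩
      have ha0 : a ≠ 0 := fun h => hA (h ▸ ha)
      have hb0 : b ≠ 0 := fun h => hA (h ▸ hb)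
      apply mul_right_cancel₀ (mul_ne_zero ha0 hb0)
      linear_combination (φ l * b) * h1 - (φ j * b) * h2
    · rintro ⟨⟨a, b⟩, ⟨i, j⟩, ⟨k, l⟩⟩ h ⟨⟨a', b'⟩, ⟨i', j'⟩, ⟨k', l'⟩⟩ h' e
      simp only [coe_filter, mem_product, Set.mem_ofPred_eq, Prod.mk.injEq] at h h' e ⊢
      obtain ⟨rfl, ⟨rfl, rfl⟩, rfl, rfl⟩ := e
      have : b = b' := mul_left_cancel₀ (hφ j h.1.2.1.2) (h.2.1.symm.trans h'.2.1)
      simp [this]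
  calc G ^ 4 = (G ^ 2) ^ 2 := by ring
    _ ≤ (A.card * G2) ^ 2 := by gcongr
    _ = A.card ^ 2 * G2 ^ 2 := by ring
    _ ≤ A.card ^ 2 * (A.card ^ 3 * Q) := by gcongr
    _ = _ := by ring

/-- 4-tuples -/
noncomputable def B4 (U : ℕ) : Finset ((ℤ × ℤ) × (ℤ × ℤ)) := (BB U ×ˢ BB U) ×ˢ (BB U ×ˢ BB U)

def prod4 (q : (ℤ × ℤ) × (ℤ × ℤ)) : ℤ := (q.1.1 * q.1.2) * (q.2.1 * q.2.2)

lemma card_B4 (U : ℕ) : (B4 U).card = (2 * U) ^ 4 := by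
  simp only [B4, card_product, card_BB]; ring

lemma fiber4 (U : ℕ) (n : ℤ) (hn : n ≠ 0) :
    ((B4 U).filter (fun q => prod4 q = n)).card ≤ (2 * n.natAbs.divisors.card) ^ 4 := by
  classical
  set D : Finset ℤ := n.natAbs.divisors.image (fun k : ℕ => (k:ℤ)) ∪ n.natAbs.divisors.image (fun k : ℕ => -(k:ℤ)) with hD
  have hDc : D.card ≤ 2 * n.natAbs.divisors.card := by
    refine (card_union_le _ _).trans ?_
    have h1 : (n.natAbs.divisors.image (fun k : ℕ => (k:ℤ))).card ≤ _ := card_image_le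
    have h2 : (n.natAbs.divisors.image (fun k : ℕ => -(k:ℤ))).card ≤ _ := card_image_le
    omega
  have hmem : ∀ z : ℤ, z ∣ n → z ∈ D := by
    intro z hz
    simp only [hD, mem_union, mem_image, Nat.mem_divisors]
    have h1 : z.natAbs ∣ n.natAbs := Int.natAbs_dvd_natAbs.mpr hz
    have h2 : n.natAbs ≠ 0 := by omega
    rcases le_total 0 z with h | h
    · left; exact ⟨z.natAbs, ⟨h1, h2⟩, by omega⟩
    · right; exact ⟨z.natAbs, ⟨h1, h2⟩, by omega⟩
  calc _ ≤ ((D ×ˢ D) ×ˢ (D ×ˢ D)).card := by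
        apply card_le_card
        intro q h
        obtain ⟨⟨a, b⟩, ⟨c, d⟩⟩ := q
        have h := mem_filter.mp h
        simp only [prod4] at h
        simp only [mem_product]
        refine ⟨⟨hmem _ ?_, hmem _ ?_⟩, hmem _ ?_, hmem _ ?_⟩ <;> rw [← h.2]
        · exact (Dvd.intro _ rfl).mul_right _
        · exact (Dvd.intro_left _ rfl).mul_right _
        · exact (Dvd.intro _ rfl).mul_left _
        · exact (Dvd.intro_left _ rfl).mul_left _
    _ = D.card ^ 4 := by simp only [card_product]; ring
    _ ≤ _ := by gcongr

lemma card_pow_eq {F : Type*} [Field F] [Fintype F] [DecidableEq F] (s : ℕ) (hs : 0 < s) (c : F) :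
    ((univ : Finset F).filter (fun d => d ^ s = c)).card ≤ s := by
  calc _ ≤ (Polynomial.nthRoots s c).toFinset.card := by
        apply card_le_card
        intro d
        simp [Polynomial.mem_nthRoots hs]
    _ ≤ _ := (Multiset.toFinset_card_le _).trans (Polynomial.card_nthRoots s c)

lemma rep_count {p : ℕ} [Fact p.Prime] (s : ℕ) (hs : 0 < s) (U D : ℕ) 
    (hD : ∀ n : ℕ, n ≠ 0 → n ≤ U ^ 4 → (2 * n.divisors.card) ^ 4 ≤ D) (c : ZMod p) :
    (((B4 U).filter (fun q => ((prod4 q : ℤ) : ZMod p) ^ s = c)).card : ℝ) ≤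
      D * (s * (2 + 2 * U ^ 4 / p)) := by
  classical
  have hp0 : (0:ℝ) < p := by exact_mod_cast (Fact.out : p.Prime).pos
  set V := (B4 U).filter (fun q => ((prod4 q : ℤ) : ZMod p) ^ s = c) with hV
  set W := (BB (U^4)).filter (fun n : ℤ => ((n : ℤ) : ZMod p) ^ s = c) with hW
  have hmaps : ∀ q ∈ V, prod4 q ∈ W := by
    intro q h
    obtain ⟨⟨a, b⟩, ⟨c, d⟩⟩ := q
    rw [hV, mem_filter] at h
    rw [hW, mem_filter]
    simp only [B4, mem_product, mem_BB, prod4] at h ⊢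
    obtain ⟨⟨⟨⟨a0, a1⟩, b0, b1⟩, ⟨c0, c1⟩, d0, d1⟩, h⟩ := h
    refine ⟨⟨by simp [a0, b0, c0, d0], ?_⟩, h⟩
    rw [abs_mul, abs_mul, abs_mul]
    push_cast
    calc |a| * |b| * (|c| * |d|) ≤ (U * U * (U * U) : ℤ) := by gcongr
      _ = _ := by ring
  have hV1 : V.card ≤ D * W.card := by
    apply card_le_mul_card_image_of_maps_to hmaps
    intro n hn
    simp only [hW, mem_filter, mem_BB] at hn
    calc _ ≤ ((B4 U).filter (fun q => prod4 q = n)).card := by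
          apply card_le_card
          intro q hq
          simp only [hV, mem_filter] at hq ⊢
          exact ⟨hq.1.1, hq.2⟩
      _ ≤ _ := fiber4 U n hn.1.1
      _ ≤ D := hD _ (by omega) (by have := hn.1.2; rw [Int.abs_eq_natAbs] at this; exact_mod_cast this)
  have hW1 : (W.card : ℝ) ≤ s * (2 + 2 * U ^ 4 / p) := by
    have hm : ∀ n ∈ W, (n : ZMod p) ∈ ((univ : Finset (ZMod p)).filter (fun d => d ^ s = c)) := by
      intro n hn
      simp only [hW, mem_filter] at hn
      simp [hn.2]
    rw [card_eq_sum_card_fiberwise hm]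
    push_cast
    have hf : ∀ d ∈ ((univ : Finset (ZMod p)).filter (fun d => d ^ s = c)),
        ((W.filter (fun n : ℤ => (n : ZMod p) = d)).card : ℝ) ≤ 2 + 2 * U ^ 4 / p := by
      intro d _
      have := class_count (W.filter (fun n : ℤ => (n : ZMod p) = d)) (-(U^4:ℕ) - 1) (2 * U^4 + 1)
        (by
          intro n hn
          simp only [hW, mem_filter, mem_BB, abs_le] at hn
          rw [mem_Icc]
          obtain ⟨⟨⟨_, h1, h2⟩, _⟩, _⟩ := hn
          push_cast at *
          constructor <;> linarith) (p : ℤ) (by exact_mod_cast (Fact.out : p.Prime).ne_zero)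
        (by
          intro x hx y hy
          simp only [mem_filter] at hx hy
          rw [← ZMod.intCast_zmod_eq_zero_iff_dvd]
          push_cast
          rw [hx.2, hy.2, sub_self])
      refine this.trans ?_
      push_cast
      rw [abs_of_pos hp0, add_div]
      have : 1 / (p:ℝ) ≤ 1 := by
        rw [div_le_one hp0]; exact_mod_cast (Fact.out : p.Prime).one_le
      linarith
    calc _ ≤ ∑ d ∈ ((univ : Finset (ZMod p)).filter (fun d => d ^ s = c)), (2 + 2 * (U:ℝ) ^ 4 / p) :=
          sum_le_sum hf
      _ = ((univ : Finset (ZMod p)).filter (fun d => d ^ s = c)).card * (2 + 2 * (U:ℝ) ^ 4 / p) := by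
          rw [sum_const, nsmul_eq_mul]
      _ ≤ _ := by
          gcongr
          exact card_pow_eq s hs c
  calc (V.card : ℝ) ≤ D * W.card := by exact_mod_cast hV1
    _ ≤ _ := by gcongr

/-- the count `D_U`. -/
noncomputable def DU (p : ℕ) [NeZero p] (s U : ℕ) (A : Finset (ZMod p)) : ℕ :=
  ((A ×ˢ (A ×ˢ CC p U)).filter (fun q => q.1 = q.2.2 ^ s * q.2.1)).card

lemma DU_trivial {p : ℕ} [Fact p.Prime] (s : ℕ) (hs : 0 < s) (U : ℕ) (A : Finset (ZMod p))
    (hA : (0 : ZMod p) ∉ A) : DU p s U A ≤ s * A.card ^ 2 := by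
  classical
  unfold DU
  calc _ = ∑ a ∈ A, ∑ b ∈ A, ((CC p U).filter (fun d => a = d ^ s * b)).card := by
        rw [card_filter_prod A (A ×ˢ CC p U) (fun a q => a = q.2 ^ s * q.1)]
        apply sum_congr rfl
        intro a _
        rw [card_filter_prod A (CC p U) (fun b d => a = d ^ s * b)]
    _ ≤ ∑ a ∈ A, ∑ b ∈ A, s := by
        apply sum_le_sum; intro a _
        apply sum_le_sum; intro b hb
        have hb0 : b ≠ 0 := fun h => hA (h ▸ hb)
        refine le_trans (card_le_card ?_) (card_pow_eq s hs (a / b))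
        intro d hd
        simp only [mem_filter, mem_univ, true_and] at hd ⊢
        rw [hd.2]; field_simp
    _ = _ := by simp; ring

lemma DU_energy {p : ℕ} [Fact p.Prime] (s : ℕ) (hs : 0 < s) (U D : ℕ) (hU : U < p)
    (hD : ∀ n : ℕ, n ≠ 0 → n ≤ U ^ 4 → (2 * n.divisors.card) ^ 4 ≤ D) (A : Finset (ZMod p))
    (hA : (0 : ZMod p) ∉ A) :
    (DU p s U A : ℝ) ^ 4 ≤ A.card ^ 5 * ((2 * U) ^ 4 * (D * (s * (2 + 2 * U ^ 4 / p)))) := by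
  classical
  have hB0 : ∀ u ∈ BB U, (u : ZMod p) ≠ 0 := by
    intro u hu h
    rw [mem_BB] at hu
    exact hu.1 (int_eq_zero_of_cast h (by omega))
  set I := BB U ×ˢ BB U with hI
  set φ : ℤ × ℤ → ZMod p := fun q => ((q.1 : ZMod p) / q.2) ^ s with hφ
  have hφ0 : ∀ i ∈ I, φ i ≠ 0 := by
    intro i hi
    simp only [hI, mem_product] at hi
    exact pow_ne_zero _ (div_ne_zero (hB0 _ hi.1) (hB0 _ hi.2))
  have hen := energy A hA I φ hφ0
  set G := ((A ×ˢ (A ×ˢ I)).filter (fun q => q.1 = φ q.2.2 * q.2.1)).card with hG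
  set Q := (((I ×ˢ I) ×ˢ (I ×ˢ I)).filter
        (fun q => φ q.1.1 * φ q.2.2 = φ q.1.2 * φ q.2.1)).card with hQ
  have h1 : DU p s U A ≤ G := by
    unfold DU
    calc _ ≤ (((A ×ˢ (A ×ˢ I)).filter (fun q => q.1 = φ q.2.2 * q.2.1)).image
          (fun q => (q.1, (q.2.1, (q.2.2.1 : ZMod p) / q.2.2.2)))).card := by
          apply card_le_card
          intro q h
          obtain ⟨a, b, d⟩ := q
          simp only [mem_filter, mem_product, mem_CC] at h
          obtain ⟨⟨ha, hb, u, hu, v, hv, e⟩, h⟩ := h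
          have hd : d = (u : ZMod p) / v := by
            rw [e]; field_simp [hB0 v hv]
          rw [mem_image]
          refine ⟨(a, b, (u, v)), ?_, by simp [hd]⟩
          simp only [mem_filter, mem_product, hI, hφ]
          exact ⟨⟨ha, hb, hu, hv⟩, by rw [← hd]; exact h⟩
      _ ≤ G := card_image_le
  have h2 : (Q : ℝ) ≤ (2 * U) ^ 4 * (D * (s * (2 + 2 * U ^ 4 / p))) := by
    have : Q ≤ ((B4 U ×ˢ B4 U).filter (fun q => ((prod4 q.2 : ℤ) : ZMod p) ^ s = ((prod4 q.1 : ℤ) : ZMod p) ^ s)).card := by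
      apply card_le_card_of_injOn (fun q => (((q.1.1.1, q.2.2.1), (q.1.2.2, q.2.1.2)), ((q.1.2.1, q.2.1.1), (q.1.1.2, q.2.2.2))))
      · rintro ⟨⟨⟨u1, v1⟩, ⟨u2, v2⟩⟩, ⟨⟨u3, v3⟩, ⟨u4, v4⟩⟩⟩ h
        rw [mem_coe, mem_filter] at h ⊢
        simp only [mem_product, hI, hφ, B4, prod4] at h ⊢
        obtain ⟨⟨⟨⟨a1, b1⟩, a2, b2⟩, ⟨a3, b3⟩, a4, b4⟩, h⟩ := h
        refine ⟨⟨⟨⟨a1, a4⟩, b2, b3⟩, ⟨a2, a3⟩, b1, b4⟩, ?_⟩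
        have c1 := hB0 _ b1
        have c2 := hB0 _ b2
        have c3 := hB0 _ b3
        have c4 := hB0 _ b4
        push_cast
        rw [← mul_pow, ← mul_pow] at h
        have e1 : ((u1:ZMod p) * u4 * (v2 * v3)) = (u1 / v1 * (u4 / v4)) * (v1 * v2 * v3 * v4) := by
          field_simp
        have e2 : ((u2:ZMod p) * u3 * (v1 * v4)) = (u2 / v2 * (u3 / v3)) * (v1 * v2 * v3 * v4) := by
          field_simp
        rw [e1, e2, mul_pow _ (_ * _ * _ * _), mul_pow _ (_ * _ * _ * _), h]
      · rintro ⟨⟨⟨u1, v1⟩, ⟨u2, v2⟩⟩, ⟨⟨u3, v3⟩, ⟨u4, v4⟩⟩⟩ h ⟨⟨⟨u1', v1'⟩, ⟨u2', v2'⟩⟩, ⟨⟨u3', v3'⟩, ⟨u4', v4'⟩⟩⟩ h' e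
        simp only [Prod.mk.injEq] at e ⊢
        tauto
    calc (Q : ℝ) ≤ (((B4 U ×ˢ B4 U).filter (fun q => ((prod4 q.2 : ℤ) : ZMod p) ^ s = ((prod4 q.1 : ℤ) : ZMod p) ^ s)).card : ℝ) := Nat.cast_le.mpr this
      _ = ∑ x ∈ B4 U, (((B4 U).filter (fun q => ((prod4 q : ℤ) : ZMod p) ^ s = ((prod4 x : ℤ) : ZMod p) ^ s)).card : ℝ) := by
        rw [card_filter_prod (B4 U) (B4 U) (fun x q => ((prod4 q : ℤ) : ZMod p) ^ s = ((prod4 x : ℤ) : ZMod p) ^ s)]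
        push_cast; rfl
      _ ≤ ∑ x ∈ B4 U, ((D:ℝ) * (s * (2 + 2 * U ^ 4 / p))) := by
        apply sum_le_sum
        intro x _
        exact rep_count s hs U D hD _
      _ = _ := by rw [sum_const, nsmul_eq_mul, card_B4]; push_cast; ring
  calc (DU p s U A : ℝ) ^ 4 ≤ (G : ℝ) ^ 4 := by gcongr
    _ ≤ (A.card:ℝ) ^ 5 * Q := by exact_mod_cast hen
    _ ≤ _ := by gcongr

end W17
open Finset
namespace W17

noncomputable def JA (p : ℕ) (s : ℕ) (A : Finset (ZMod p)) (X : Finset ℤ) : ℕ :=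
  (((A ×ˢ X) ×ˢ (A ×ˢ X)).filter (fun q => q.1.1 * ((q.1.2 : ZMod p) ^ s)⁻¹ =
    q.2.1 * ((q.2.2 : ZMod p) ^ s)⁻¹)).card

lemma JA_le {p : ℕ} [Fact p.Prime] (s : ℕ) (hs : 0 < s) (A : Finset (ZMod p)) (hA : (0 : ZMod p) ∉ A)
    (X : Finset ℤ) (L : ℤ) (N : ℕ) (hX : X ⊆ Icc (L + 1) (L + N)) (hN : 2 * N ^ 2 ≤ p)
    (hX0 : ∀ x ∈ X, (x : ZMod p) ≠ 0) :
    (JA p s A X : ℝ) ≤ 2 * s * A.card ^ 2 +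
      ∑ U ∈ Icc 1 N, (N : ℝ) / (U * (U + 1)) * DU p s U A := by
  classical
  set E : Finset (ZMod p × ZMod p × ZMod p) :=
    (A ×ˢ (A ×ˢ ((univ : Finset (ZMod p)).filter (fun d => d ≠ 0)))).filter
      (fun q => q.1 = q.2.2 ^ s * q.2.1) with hE
  have hEc : E.card ≤ s * A.card ^ 2 := by
    calc _ = ∑ a ∈ A, ∑ b ∈ A, (((univ : Finset (ZMod p)).filter (fun d => d ≠ 0)).filter (fun d => a = d ^ s * b)).card := by
          rw [hE, card_filter_prod A (A ×ˢ _) (fun a q => a = q.2 ^ s * q.1)]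
          apply sum_congr rfl
          intro a _
          rw [card_filter_prod A _ (fun b d => a = d ^ s * b)]
      _ ≤ ∑ a ∈ A, ∑ b ∈ A, s := by
          apply sum_le_sum; intro a _
          apply sum_le_sum; intro b hb
          have hb0 : b ≠ 0 := fun h => hA (h ▸ hb)
          refine le_trans (card_le_card ?_) (card_pow_eq s hs (a / b))
          intro d hd
          simp only [mem_filter, mem_univ, true_and] at hd ⊢
          rw [hd.2]; field_simp
      _ = _ := by simp; ring
  have h1 : JA p s A X ≤ ∑ q ∈ E, rr p X q.2.2 := by
    have : ∑ q ∈ E, rr p X q.2.2 = (E.sigma (fun q => (X ×ˢ X).filter (fun y => (y.1 : ZMod p) = q.2.2 * y.2))).card := by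
      rw [card_sigma]; rfl
    rw [this]
    unfold JA
    apply card_le_card_of_injOn (fun q => ⟨(q.1.1, q.2.1, (q.1.2 : ZMod p) / q.2.2), (q.1.2, q.2.2)⟩)
    · intro q hq
      obtain ⟨⟨a, x⟩, ⟨b, y⟩⟩ := q
      rw [mem_coe, mem_filter] at hq
      rw [mem_coe, mem_sigma, hE, mem_filter, mem_filter]
      simp only [mem_product, mem_filter, mem_univ, true_and] at hq ⊢
      obtain ⟨⟨⟨ha, hx⟩, hb, hy⟩, h⟩ := hq
      have hx0 := hX0 x hx
      have hy0 := hX0 y hy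
      refine ⟨⟨⟨ha, hb, div_ne_zero hx0 hy0⟩, ?_⟩, ⟨hx, hy⟩, ?_⟩
      · rw [div_pow]
        field_simp at h ⊢
        linear_combination h
      · field_simp
    · intro q hq q' hq' e
      simp only [Sigma.mk.injEq, Prod.mk.injEq, heq_eq_eq] at e
      ext <;> simp [e]
  calc (JA p s A X : ℝ) ≤ ∑ q ∈ E, (rr p X q.2.2 : ℝ) := by exact_mod_cast h1
    _ ≤ ∑ q ∈ E, (2 + ∑ U ∈ Icc 1 N, (N : ℝ) / (U * (U + 1)) * (if q.2.2 ∈ CC p U then 1 else 0)) := by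
        apply sum_le_sum
        intro q hq
        rw [hE, mem_filter] at hq
        simp only [mem_product, mem_filter] at hq
        exact rr_bound X L N hX hN _ hq.1.2.2.2
    _ = 2 * E.card + ∑ U ∈ Icc 1 N, (N : ℝ) / (U * (U + 1)) * (E.filter (fun q => q.2.2 ∈ CC p U)).card := by
        rw [sum_add_distrib, sum_const, nsmul_eq_mul, mul_comm, sum_comm]
        congr 1
        apply sum_congr rfl
        intro U _
        rw [← mul_sum, card_filter]
        push_cast; rfl
    _ ≤ _ := by
        have : (E.card : ℝ) ≤ s * A.card ^ 2 := by exact_mod_cast hEc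
        refine add_le_add (by linarith) ?_
        apply sum_le_sum
        intro U _
        gcongr
        unfold DU
        apply card_le_card
        intro q hq
        rw [mem_filter, hE, mem_filter] at hq
        rw [mem_filter]
        simp only [mem_product, mem_filter] at hq ⊢
        exact ⟨⟨hq.1.1.1, hq.1.1.2.1, hq.2⟩, hq.1.2⟩

lemma DU_bound {p : ℕ} [Fact p.Prime] (s : ℕ) (hs : 0 < s) (U D : ℕ) (hU : U < p) (hD1 : 1 ≤ D)
    (hD : ∀ n : ℕ, n ≠ 0 → n ≤ U ^ 4 → (2 * n.divisors.card) ^ 4 ≤ D) (A : Finset (ZMod p))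
    (hA : (0 : ZMod p) ∉ A) (α ϖ : ℝ) (hα : 0 ≤ α) (hαA : α ^ 8 = A.card) (hϖ : 0 < ϖ) (hϖp : ϖ ^ 8 = p) :
    (DU p s U A : ℝ) ≤ 64 * s * D * U * (α ^ 10 + α ^ 13 / ϖ) := by
  have hp0 : (0:ℝ) < p := by exact_mod_cast (Fact.out : p.Prime).pos
  have hs1 : (1:ℝ) ≤ s := by exact_mod_cast hs
  have hD1' : (1:ℝ) ≤ D := by exact_mod_cast hD1
  have e1 := DU_energy s hs U D hU hD A hA
  have e2 : (DU p s U A : ℝ) ≤ s * (A.card:ℝ) ^ 2 := by exact_mod_cast DU_trivial s hs U A hA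
  rw [← hαA] at e1 e2
  set x := (DU p s U A : ℝ) with hx
  have hx0 : 0 ≤ x := by positivity
  set k : ℝ := 64 * s * D with hk
  have hsD : (1:ℝ) ≤ s * D := by nlinarith
  have hk1 : 1 ≤ k := by rw [hk]; nlinarith
  by_cases hc : (U:ℝ) ^ 4 ≤ p
  · have : x ^ 4 ≤ (k * U * α ^ 10) ^ 4 := by
      calc x ^ 4 ≤ (α ^ 8) ^ 5 * ((2 * U) ^ 4 * (D * (s * (2 + 2 * U ^ 4 / p)))) := e1
        _ ≤ (α ^ 8) ^ 5 * ((2 * U) ^ 4 * (D * (s * (2 + 2 * 1)))) := by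
            gcongr
            rw [mul_div_assoc]
            gcongr
            rw [div_le_one hp0]; exact hc
        _ = k ^ 1 * U ^ 4 * α ^ 40 := by rw [hk]; ring
        _ ≤ k ^ 4 * U ^ 4 * α ^ 40 := by
            gcongr
            norm_num
        _ = _ := by ring
    have := le_of_pow_le_pow_left₀ (by norm_num) (by positivity) this
    have h3 : 0 ≤ k * U * (α ^ 13 / ϖ) := by positivity
    linarith
  · push Not at hc
    have : x ^ 8 ≤ (k * U * (α ^ 13 / ϖ)) ^ 8 := by
      calc x ^ 8 = x ^ 4 * x ^ 4 := by ring
        _ ≤ (s * (α ^ 8) ^ 2) ^ 4 * ((α ^ 8) ^ 5 * ((2 * U) ^ 4 * (D * (s * (2 + 2 * U ^ 4 / p))))) := by gcongr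
        _ ≤ (s * (α ^ 8) ^ 2) ^ 4 * ((α ^ 8) ^ 5 * ((2 * U) ^ 4 * (D * (s * (2 * U ^ 4 / p + 2 * U ^ 4 / p))))) := by
            gcongr
            rw [mul_div_assoc]
            have : 1 ≤ (U:ℝ) ^ 4 / p := by rw [one_le_div hp0]; exact hc.le
            linarith
        _ = (s ^ 4 * (64 * s * D)) * (U ^ 8 * α ^ 104 / ϖ ^ 8) := by rw [hϖp]; ring
        _ ≤ (k ^ 4 * k ^ 4) * (U ^ 8 * α ^ 104 / ϖ ^ 8) := by
            gcongr
            · rw [hk]; nlinarith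
            · exact le_self_pow₀ hk1 (by norm_num)
        _ = _ := by field_simp
    have := le_of_pow_le_pow_left₀ (by norm_num) (by positivity) this
    have h3 : 0 ≤ k * U * (α ^ 10) := by positivity
    linarith

lemma harm_le (N : ℕ) : ∑ U ∈ Icc 1 N, (1:ℝ) / U ≤ 1 + Real.log N := by
  have := harmonic_le_one_add_log N
  rw [harmonic_eq_sum_Icc] at this
  push_cast at this
  simpa using this

lemma JA_bound {p : ℕ} [Fact p.Prime] (s : ℕ) (hs : 0 < s) (A : Finset (ZMod p)) (hA : (0 : ZMod p) ∉ A)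
    (X : Finset ℤ) (L : ℤ) (N : ℕ) (hX : X ⊆ Icc (L + 1) (L + N)) (hN : 2 * N ^ 2 ≤ p) (hN1 : 1 ≤ N)
    (hX0 : ∀ x ∈ X, (x : ZMod p) ≠ 0) (D : ℕ) (hD1 : 1 ≤ D)
    (hD : ∀ n : ℕ, n ≠ 0 → n ≤ N ^ 4 → (2 * n.divisors.card) ^ 4 ≤ D)
    (α ϖ : ℝ) (hα : 0 ≤ α) (hαA : α ^ 8 = A.card) (hϖ : 0 < ϖ) (hϖp : ϖ ^ 8 = p) :
    (JA p s A X : ℝ) ≤ 2 * s * (α ^ 8) ^ 2 +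
      64 * s * D * (1 + Real.log p) * N * (α ^ 10 + α ^ 13 / ϖ) := by
  have hNp : N < p := by nlinarith
  refine (JA_le s hs A hA X L N hX hN hX0).trans ?_
  rw [hαA]
  gcongr
  calc ∑ U ∈ Icc 1 N, (N : ℝ) / (U * (U + 1)) * DU p s U A
      ≤ ∑ U ∈ Icc 1 N, (64 * s * D * N * (α ^ 10 + α ^ 13 / ϖ)) * (1 / U) := by
        apply sum_le_sum
        intro U hU
        rw [mem_Icc] at hU
        have hU0 : (0:ℝ) < U := by exact_mod_cast hU.1
        have := DU_bound s hs U D (by omega) hD1 (fun n hn h => hD n hn (h.trans (by gcongr; exact hU.2))) A hA α ϖ hα hαA hϖ hϖp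
        calc _ ≤ (N : ℝ) / (U * (U + 1)) * (64 * s * D * U * (α ^ 10 + α ^ 13 / ϖ)) := by gcongr
          _ = (64 * s * D * N * (α ^ 10 + α ^ 13 / ϖ)) * (1 / (U + 1)) := by field_simp
          _ ≤ _ := by
            gcongr
            linarith
    _ = (64 * s * D * N * (α ^ 10 + α ^ 13 / ϖ)) * ∑ U ∈ Icc 1 N, (1:ℝ) / U := by rw [mul_sum]
    _ ≤ (64 * s * D * N * (α ^ 10 + α ^ 13 / ϖ)) * (1 + Real.log p) := by
        gcongr
        refine (harm_le N).trans ?_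
        have : (0:ℝ) < N := by exact_mod_cast hN1
        gcongr
    _ = _ := by ring

end W17
open Finset
namespace W17

/-- the standard character -/
noncomputable def ee (p : ℕ) [NeZero p] (x : ZMod p) : ℂ := ZMod.stdAddChar x

lemma ee_add {p : ℕ} [NeZero p] (x y : ZMod p) : ee p (x + y) = ee p x * ee p y := by
  unfold ee; exact AddChar.map_add_eq_mul _ _ _

lemma ee_norm {p : ℕ} [NeZero p] (x : ZMod p) : ‖ee p x‖ = 1 := by
  unfold ee; exact AddChar.norm_apply _ _

lemma ee_conj {p : ℕ} [NeZero p] (x : ZMod p) : (starRingEnd ℂ) (ee p x) = ee p (-x) := by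
  unfold ee; exact (AddChar.map_neg_eq_conj _ _).symm

lemma ee_sum {p : ℕ} [NeZero p] {ι : Type*} (s : Finset ι) (f : ι → ZMod p) :
    ee p (∑ i ∈ s, f i) = ∏ i ∈ s, ee p (f i) := by
  classical
  induction s using Finset.induction_on with
  | empty => simp [ee]
  | insert a s ha ih => rw [sum_insert ha, prod_insert ha, ee_add, ih]

lemma ee_orth {p : ℕ} [NeZero p] (b : ZMod p) :
    ∑ u : ZMod p, ee p (u * b) = if b = 0 then (p : ℂ) else 0 := by
  have := AddChar.sum_mulShift b (ZMod.isPrimitive_stdAddChar p)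
  unfold ee
  rw [this, ZMod.card]
  split_ifs <;> simp

lemma large_sieve {p : ℕ} [NeZero p] {κ : Type*} (K : Finset κ) (φ : κ → ZMod p) (c : κ → ℂ)
    (hc : ∀ k ∈ K, ‖c k‖ ≤ 1) :
    ∑ u : ZMod p, ‖∑ k ∈ K, c k * ee p (u * φ k)‖ ^ 2 ≤
      p * ((K ×ˢ K).filter (fun q => φ q.1 = φ q.2)).card := by
  have h1 : ((∑ u : ZMod p, ‖∑ k ∈ K, c k * ee p (u * φ k)‖ ^ 2 : ℝ) : ℂ) =
      ∑ q ∈ K ×ˢ K, c q.1 * (starRingEnd ℂ) (c q.2) * (if φ q.1 = φ q.2 then (p : ℂ) else 0) := by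
    push_cast
    calc ∑ u : ZMod p, (‖∑ k ∈ K, c k * ee p (u * φ k)‖ : ℂ) ^ 2
        = ∑ u : ZMod p, ∑ q ∈ K ×ˢ K, c q.1 * (starRingEnd ℂ) (c q.2) * ee p (u * (φ q.1 - φ q.2)) := by
          apply sum_congr rfl
          intro u _
          rw [← Complex.mul_conj', map_sum, sum_mul_sum, sum_product]
          apply sum_congr rfl
          intro k _
          apply sum_congr rfl
          intro l _
          rw [map_mul, ee_conj, mul_sub, sub_eq_add_neg, ee_add]
          ring
      _ = _ := by
          rw [sum_comm]
          apply sum_congr rfl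
          intro q _
          rw [← mul_sum, ee_orth]
          simp only [sub_eq_zero]
  calc ∑ u : ZMod p, ‖∑ k ∈ K, c k * ee p (u * φ k)‖ ^ 2
      = ‖((∑ u : ZMod p, ‖∑ k ∈ K, c k * ee p (u * φ k)‖ ^ 2 : ℝ) : ℂ)‖ := by
        rw [Complex.norm_real, Real.norm_of_nonneg]
        positivity
    _ ≤ ∑ q ∈ K ×ˢ K, (if φ q.1 = φ q.2 then (p : ℝ) else 0) := by
        rw [h1]
        refine norm_sum_le_of_le _ ?_
        intro q hq
        rw [mem_product] at hq
        rw [norm_mul, norm_mul, RCLike.norm_conj]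
        have h2 : ‖c q.1‖ * ‖c q.2‖ ≤ 1 := mul_le_one₀ (hc _ hq.1) (norm_nonneg _) (hc _ hq.2)
        split_ifs
        · simp only [Complex.norm_natCast]
          nlinarith [(Nat.cast_nonneg p : (0:ℝ) ≤ p)]
        · simp
    _ = _ := by
        rw [← sum_filter, sum_const, nsmul_eq_mul, mul_comm]

noncomputable def SS (p : ℕ) [NeZero p] (s : ℕ) (B : Finset (ZMod p)) (X : Finset ℤ) (a : ZMod p) : ℂ :=
  ∑ m ∈ B, ∑ x ∈ X, ee p (a * (m * ((x : ZMod p) ^ s)⁻¹))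

lemma level_set {p : ℕ} [NeZero p] (s : ℕ) (B A : Finset (ZMod p)) (X : Finset ℤ) (N : ℕ) (T : ℝ)
    (hT : 0 ≤ T) (hB : B.card ≤ N) (h : ∀ a ∈ A, T ≤ ‖SS p s B X a‖) :
    ((A.card : ℝ) * T) ^ 2 ≤ N * (p * JA p s A X) := by
  have hc : ∀ a : ZMod p, ∃ c : ℂ, ‖c‖ = 1 ∧ (‖SS p s B X a‖ : ℂ) = c * SS p s B X a := by
    intro a
    exact RCLike.exists_norm_eq_mul_self _
  choose c hc1 hc2 using hc
  have h1 : (A.card : ℝ) * T ≤ ∑ m ∈ B, ‖∑ q ∈ A ×ˢ X, c q.1 * ee p (m * (q.1 * ((q.2 : ZMod p) ^ s)⁻¹))‖ := by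
    calc (A.card : ℝ) * T = ∑ a ∈ A, T := by simp
      _ ≤ ∑ a ∈ A, ‖SS p s B X a‖ := sum_le_sum h
      _ = ‖((∑ a ∈ A, ‖SS p s B X a‖ : ℝ) : ℂ)‖ := by
          rw [Complex.norm_real, Real.norm_of_nonneg]
          positivity
      _ = ‖∑ m ∈ B, ∑ q ∈ A ×ˢ X, c q.1 * ee p (m * (q.1 * ((q.2 : ZMod p) ^ s)⁻¹))‖ := by
          congr 1
          push_cast
          simp_rw [hc2, SS, sum_product, mul_sum]
          rw [sum_comm]
          apply sum_congr rfl; intro m _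
          apply sum_congr rfl; intro a _
          apply sum_congr rfl; intro x _
          congr 2; ring
      _ ≤ _ := norm_sum_le _ _
  calc ((A.card : ℝ) * T) ^ 2 ≤ (∑ m ∈ B, ‖∑ q ∈ A ×ˢ X, c q.1 * ee p (m * (q.1 * ((q.2 : ZMod p) ^ s)⁻¹))‖) ^ 2 := by
        gcongr
    _ ≤ B.card * ∑ m ∈ B, ‖∑ q ∈ A ×ˢ X, c q.1 * ee p (m * (q.1 * ((q.2 : ZMod p) ^ s)⁻¹))‖ ^ 2 :=
        sq_sum_le_card_mul_sum_sq
    _ ≤ N * ∑ m : ZMod p, ‖∑ q ∈ A ×ˢ X, c q.1 * ee p (m * (q.1 * ((q.2 : ZMod p) ^ s)⁻¹))‖ ^ 2 := by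
        gcongr
        exact subset_univ _
    _ ≤ _ := by
        gcongr
        exact large_sieve (A ×ˢ X) (fun q => q.1 * ((q.2 : ZMod p) ^ s)⁻¹) (fun q => c q.1)
          (fun q _ => (hc1 q.1).le)

end W17
open Finset
namespace W17

set_option maxHeartbeats 1000000 in
open Polynomial in
lemma root_count {p : ℕ} [Fact p.Prime] (hp : 3 < p) (s : ℕ) (hs : 0 < s)
    (k0 k1 k2 l0 l1 l2 z : ZMod p) (h0 : z ≠ k0) (h1 : z ≠ k1) (h2 : z ≠ k2)
    (hz : z = l0 ∨ z = l1 ∨ z = l2) :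
    ((univ : Finset (ZMod p)).filter (fun v => ((v + k0) ^ s)⁻¹ + ((v + k1) ^ s)⁻¹ + ((v + k2) ^ s)⁻¹ =
      ((v + l0) ^ s)⁻¹ + ((v + l1) ^ s)⁻¹ + ((v + l2) ^ s)⁻¹)).card ≤ 6 * s + 6 := by
  classical
  set R : Finset (ZMod p) := {k0, k1, k2, l0, l1, l2} with hR
  have hRc : R.card ≤ 6 := by rw [hR]; exact card_le_six
  set Q : ZMod p → (ZMod p)[X] := fun t => ∏ r ∈ R.erase t, (X + C r) ^ s with hQ
  set F := Q k0 + Q k1 + Q k2 - Q l0 - Q l1 - Q l2 with hF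
  have hzR : z ∈ R := by
    rw [hR]; rcases hz with h | h | h <;> rw [h] <;> simp
  have hQz : ∀ t, t ≠ z → (Q t).eval (-z) = 0 := by
    intro t ht
    rw [hQ, eval_prod]
    apply prod_eq_zero (mem_erase.mpr ⟨ht.symm, hzR⟩)
    simp [hs.ne']
  have hQzz : (Q z).eval (-z) ≠ 0 := by
    rw [hQ, eval_prod, prod_ne_zero_iff]
    intro r hr
    simp only [eval_pow, eval_add, eval_X, eval_C]
    apply pow_ne_zero
    intro h
    apply (mem_erase.mp hr).1
    linear_combination h
  have two : (2 : ZMod p) ≠ 0 := by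
    intro h
    have : ((2:ℕ) : ZMod p) = 0 := by exact_mod_cast h
    rw [ZMod.natCast_eq_zero_iff] at this
    have := Nat.le_of_dvd (by norm_num) this
    omega
  have three : (3 : ZMod p) ≠ 0 := by
    intro h
    have : ((3:ℕ) : ZMod p) = 0 := by exact_mod_cast h
    rw [ZMod.natCast_eq_zero_iff] at this
    have := Nat.le_of_dvd (by norm_num) this
    omega
  have hl : ∀ t, (Q t).eval (-z) = (if t = z then 1 else 0) * (Q z).eval (-z) := by
    intro t
    split_ifs with h
    · rw [h, one_mul]
    · rw [hQz t h, zero_mul]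
  have hFz : F.eval (-z) ≠ 0 := by
    rw [hF]
    simp only [eval_sub, eval_add]
    rw [hQz k0 h0.symm, hQz k1 h1.symm, hQz k2 h2.symm, hl l0, hl l1, hl l2]
    have : (0 : ZMod p) + 0 + 0 - (if l0 = z then 1 else 0) * (Q z).eval (-z) - (if l1 = z then 1 else 0) * (Q z).eval (-z) - (if l2 = z then 1 else 0) * (Q z).eval (-z)
      = - ((if l0 = z then 1 else 0) + (if l1 = z then 1 else 0) + (if l2 = z then 1 else 0)) * (Q z).eval (-z) := by ring
    rw [this]
    apply mul_ne_zero _ hQzz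
    rw [neg_ne_zero]
    have h11 : (1 : ZMod p) + 1 ≠ 0 := by rw [one_add_one_eq_two]; exact two
    have h111 : (1 : ZMod p) + 1 + 1 ≠ 0 := by
      rw [show (1 : ZMod p) + 1 + 1 = 3 by norm_num]; exact three
    by_cases a0 : l0 = z <;> by_cases a1 : l1 = z <;> by_cases a2 : l2 = z <;>
      simp only [a0, a1, a2, if_true, if_false, add_zero, zero_add] <;>
      first | exact h111 | exact h11 | exact one_ne_zero | (exfalso; rcases hz with h | h | h <;> [exact a0 h.symm; exact a1 h.symm; exact a2 h.symm])
  have hF0 : F ≠ 0 := by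
    intro h; rw [h] at hFz; simp at hFz
  have hQd : ∀ t, (Q t).natDegree ≤ 6 * s := by
    intro t
    refine (natDegree_prod_le _ _).trans ?_
    calc ∑ r ∈ R.erase t, ((X + C r) ^ s : (ZMod p)[X]).natDegree ≤ ∑ r ∈ R.erase t, s := by
          apply sum_le_sum
          intro r _
          refine natDegree_pow_le.trans ?_
          rw [natDegree_X_add_C, mul_one]
      _ = (R.erase t).card * s := by rw [sum_const, smul_eq_mul]
      _ ≤ 6 * s := by
          gcongr
          exact (card_le_card (erase_subset _ _)).trans hRc
  have hFd : F.natDegree ≤ 6 * s := by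
    rw [hF]
    refine (natDegree_sub_le_of_le (natDegree_sub_le_of_le (natDegree_sub_le_of_le (natDegree_add_le_of_le (natDegree_add_le_of_le (hQd _) (hQd _)) (hQd _)) (hQd _)) (hQd _)) (hQd _)).trans ?_
    simp
  have hsub : ((univ : Finset (ZMod p)).filter (fun v => ((v + k0) ^ s)⁻¹ + ((v + k1) ^ s)⁻¹ + ((v + k2) ^ s)⁻¹ =
      ((v + l0) ^ s)⁻¹ + ((v + l1) ^ s)⁻¹ + ((v + l2) ^ s)⁻¹)) ⊆ F.roots.toFinset ∪ R.image (fun r => -r) := by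
    intro v hv
    rw [mem_filter] at hv
    rw [mem_union]
    by_cases hb : ∃ r ∈ R, v + r = 0
    · right
      obtain ⟨r, hr, h⟩ := hb
      exact mem_image.mpr ⟨r, hr, by linear_combination -h⟩
    · left
      push Not at hb
      rw [Multiset.mem_toFinset, mem_roots hF0, IsRoot.def]
      have hQv : ∀ t ∈ R, (Q t).eval v = (∏ r ∈ R, (v + r) ^ s) * ((v + t) ^ s)⁻¹ := by
        intro t ht
        have := hb t ht
        rw [hQ, eval_prod, ← mul_prod_erase R _ ht]
        simp only [eval_pow, eval_add, eval_X, eval_C]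
        field_simp
      rw [hF]
      simp only [eval_sub, eval_add]
      rw [hQv k0 (by simp [hR]), hQv k1 (by simp [hR]), hQv k2 (by simp [hR]), hQv l0 (by simp [hR]), hQv l1 (by simp [hR]), hQv l2 (by simp [hR])]
      linear_combination (∏ r ∈ R, (v + r) ^ s) * hv.2
  calc _ ≤ _ := card_le_card hsub
    _ ≤ _ := card_union_le _ _
    _ ≤ 6 * s + 6 := by
      refine add_le_add ?_ (card_image_le.trans hRc)
      exact (Multiset.toFinset_card_le _).trans ((card_roots' _).trans hFd)

/-- inner sum -/
noncomputable def gg (p : ℕ) [NeZero p] (s : ℕ) (K : Finset (ZMod p)) (u v : ZMod p) : ℂ :=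
  ∑ z ∈ K, ee p (u * ((v + z) ^ s)⁻¹)

lemma gg_moment {p : ℕ} [Fact p.Prime] (hp : 3 < p) (s : ℕ) (hs : 0 < s) (K : Finset (ZMod p)) :
    ∑ v : ZMod p, ∑ u : ZMod p, ‖gg p s K u v‖ ^ 6 ≤
      p * (27 * (K.card : ℝ) ^ 3 * p + (K.card:ℝ) ^ 6 * (6 * s + 6)) := by
  classical
  set K3 := K ×ˢ (K ×ˢ K) with hK3
  set φ : ZMod p → ZMod p × ZMod p × ZMod p → ZMod p :=
    fun v k => ((v + k.1) ^ s)⁻¹ + ((v + k.2.1) ^ s)⁻¹ + ((v + k.2.2) ^ s)⁻¹ with hφ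
  have h1 : ∀ v, ∑ u : ZMod p, ‖gg p s K u v‖ ^ 6 ≤ p * ((K3 ×ˢ K3).filter (fun q => φ v q.1 = φ v q.2)).card := by
    intro v
    refine le_trans (le_of_eq ?_) (large_sieve K3 (φ v) (fun _ => 1) (by simp))
    apply sum_congr rfl
    intro u _
    rw [show (6:ℕ) = 3 * 2 by norm_num, pow_mul, ← norm_pow]
    congr 2
    rw [hK3, sum_product, pow_succ, pow_two, gg, sum_mul_sum, sum_mul]
    apply sum_congr rfl; intro a _
    rw [sum_product, sum_mul]
    apply sum_congr rfl; intro b _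
    rw [mul_sum]
    apply sum_congr rfl; intro c _
    rw [hφ, mul_add, mul_add, ee_add, ee_add, one_mul]
  set bad : (ZMod p × ZMod p × ZMod p) × (ZMod p × ZMod p × ZMod p) → Prop := fun q =>
    (∀ z ∈ ({q.2.1, q.2.2.1, q.2.2.2} : Finset (ZMod p)), z ∈ ({q.1.1, q.1.2.1, q.1.2.2} : Finset (ZMod p))) with hbad
  have h2 : ∑ v : ZMod p, ((K3 ×ˢ K3).filter (fun q => φ v q.1 = φ v q.2)).card ≤
      27 * K.card ^ 3 * p + K.card ^ 6 * (6 * s + 6) := by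
    have hbc : ((K3 ×ˢ K3).filter bad).card ≤ 27 * K.card ^ 3 := by
      calc _ ≤ (K3.sigma (fun k => ({k.1, k.2.1, k.2.2} : Finset (ZMod p)) ×ˢ (({k.1, k.2.1, k.2.2} : Finset (ZMod p)) ×ˢ ({k.1, k.2.1, k.2.2} : Finset (ZMod p))))).card := by
            apply card_le_card_of_injOn (fun q => ⟨q.1, q.2⟩)
            · intro q hq
              rw [mem_coe, mem_filter] at hq
              rw [mem_coe, mem_sigma]
              refine ⟨(mem_product.mp hq.1).1, ?_⟩
              rw [mem_product, mem_product]
              exact ⟨hq.2 _ (by simp), hq.2 _ (by simp), hq.2 _ (by simp)⟩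
            · intro q _ q' _ e
              simp only [Sigma.mk.injEq, heq_eq_eq] at e
              exact Prod.ext e.1 e.2
        _ ≤ ∑ k ∈ K3, 27 := by
            rw [card_sigma]
            apply sum_le_sum
            intro k _
            rw [card_product, card_product]
            have : ({k.1, k.2.1, k.2.2} : Finset (ZMod p)).card ≤ 3 := card_le_three
            calc _ ≤ 3 * (3 * 3) := by gcongr
              _ = 27 := by norm_num
        _ = _ := by rw [sum_const, hK3, card_product, card_product, smul_eq_mul]; ring
    simp only [card_filter]
    rw [sum_comm]
    rw [← sum_filter_add_sum_filter_not (K3 ×ˢ K3) bad]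
    gcongr
    · calc _ ≤ ∑ q ∈ (K3 ×ˢ K3).filter bad, p := by
            apply sum_le_sum
            intro q _
            rw [← card_filter]
            exact (card_le_univ _).trans (by rw [ZMod.card])
        _ = _ := by rw [sum_const, smul_eq_mul]
        _ ≤ _ := by gcongr
    · calc _ ≤ ∑ q ∈ (K3 ×ˢ K3).filter (fun q => ¬ bad q), (6 * s + 6) := by
            apply sum_le_sum
            intro q hq
            rw [← card_filter]
            rw [mem_filter, hbad] at hq
            have := hq.2
            push Not at this
            obtain ⟨z, hz, hz'⟩ := this
            simp only [mem_insert, mem_singleton, not_or] at hz hz'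
            exact root_count hp s hs _ _ _ _ _ _ z hz'.1 hz'.2.1 hz'.2.2 hz
        _ = _ := by rw [sum_const, smul_eq_mul]
        _ ≤ _ := by
          gcongr
          refine (card_le_card (filter_subset _ _)).trans ?_
          simp only [hK3, card_product]
          apply le_of_eq; ring
  calc _ ≤ ∑ v : ZMod p, (p:ℝ) * ((K3 ×ˢ K3).filter (fun q => φ v q.1 = φ v q.2)).card :=
        sum_le_sum (fun v _ => h1 v)
    _ = p * ((∑ v : ZMod p, ((K3 ×ˢ K3).filter (fun q => φ v q.1 = φ v q.2)).card : ℕ) : ℝ) := by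
        rw [← mul_sum]; push_cast; rfl
    _ ≤ p * ((27 * K.card ^ 3 * p + K.card ^ 6 * (6 * s + 6) : ℕ) : ℝ) := by
        gcongr
    _ = _ := by push_cast; ring

end W17
open Finset
namespace W17

lemma gcd_sum (Y D : ℕ) (hD : ∀ n : ℕ, n ≠ 0 → n ≤ Y → n.divisors.card ≤ D) :
    ∑ y ∈ Icc 1 Y, ∑ y' ∈ Icc 1 Y, (Nat.gcd y y' : ℝ) / y ≤ Y * D * (1 + Real.log Y) := by
  have h1 : ∀ y ∈ Icc 1 Y, ∑ y' ∈ Icc 1 Y, Nat.gcd y y' ≤ D * Y := by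
    intro y hy
    rw [mem_Icc] at hy
    calc ∑ y' ∈ Icc 1 Y, Nat.gcd y y' ≤ ∑ y' ∈ Icc 1 Y, ∑ d ∈ y.divisors, if d ∣ y' then d else 0 := by
          apply sum_le_sum
          intro y' _
          have hm : Nat.gcd y y' ∈ y.divisors := by
            rw [Nat.mem_divisors]; exact ⟨Nat.gcd_dvd_left _ _, by omega⟩
          have := single_le_sum (f := fun d => if d ∣ y' then d else 0) (fun i _ => Nat.zero_le _) hm
          simpa [Nat.gcd_dvd_right] using this
      _ = ∑ d ∈ y.divisors, ∑ y' ∈ Icc 1 Y, if d ∣ y' then d else 0 := sum_comm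
      _ ≤ ∑ d ∈ y.divisors, Y := by
          apply sum_le_sum
          intro d _
          rw [← sum_filter, sum_const, smul_eq_mul]
          have : (Icc 1 Y).filter (fun x => d ∣ x) = (Ioc 0 Y).filter (fun x => d ∣ x) := by
            ext x; simp only [mem_filter, mem_Icc, mem_Ioc]; omega
          rw [this, Nat.Ioc_filter_dvd_card_eq_div]
          exact Nat.div_mul_le_self _ _
      _ = y.divisors.card * Y := by rw [sum_const, smul_eq_mul]
      _ ≤ D * Y := by gcongr; exact hD y (by omega) hy.2
  calc ∑ y ∈ Icc 1 Y, ∑ y' ∈ Icc 1 Y, (Nat.gcd y y' : ℝ) / y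
      ≤ ∑ y ∈ Icc 1 Y, (D * Y : ℝ) * (1 / y) := by
        apply sum_le_sum
        intro y hy
        have := h1 y hy
        have h' : ∑ y' ∈ Icc 1 Y, (Nat.gcd y y' : ℝ) ≤ D * Y := by exact_mod_cast this
        rw [← sum_div, mul_one_div]
        gcongr
    _ = (D * Y : ℝ) * ∑ y ∈ Icc 1 Y, (1:ℝ) / y := by rw [mul_sum]
    _ ≤ (D * Y : ℝ) * (1 + Real.log Y) := by gcongr; exact harm_le Y
    _ = _ := by ring

/-- the parametrisation -/
noncomputable def pip (p s : ℕ) (a : ZMod p) (i : ℕ × ZMod p × ℤ) : ZMod p × ZMod p :=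
  (a * (i.2.1 * ((i.1 : ZMod p) ^ s)⁻¹), (i.2.2 : ZMod p) * (i.1 : ZMod p)⁻¹)

lemma coll {p : ℕ} [Fact p.Prime] (s : ℕ) (a : ZMod p) (ha : a ≠ 0)
    (B : Finset (ZMod p)) (X : Finset ℤ) (L : ℤ) (N Y D : ℕ) (hY : 1 ≤ Y) (hYN : Y ≤ N)
    (hX : X ⊆ Icc (L + 1) (L + N)) (hN : 2 * N ^ 2 ≤ p) (hB : B.card ≤ N) (hD1 : 1 ≤ D)
    (hD : ∀ n : ℕ, n ≠ 0 → n ≤ Y → n.divisors.card ≤ D) :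
    ((((Icc 1 Y ×ˢ (B ×ˢ X)) ×ˢ (Icc 1 Y ×ˢ (B ×ˢ X))).filter
      (fun q => pip p s a q.1 = pip p s a q.2)).card : ℝ) ≤ 2 * N ^ 2 * Y * D * (1 + Real.log p) := by
  classical
  have hNp : N < p := by nlinarith
  have hYp : ∀ y ∈ Icc 1 Y, ((y:ℕ) : ZMod p) ≠ 0 := by
    intro y hy h
    rw [mem_Icc] at hy
    rw [ZMod.natCast_eq_zero_iff] at h
    have := Nat.le_of_dvd (by omega) h
    omega
  have h1 : (((Icc 1 Y ×ˢ (B ×ˢ X)) ×ˢ (Icc 1 Y ×ˢ (B ×ˢ X))).filter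
      (fun q => pip p s a q.1 = pip p s a q.2)).card ≤
      ∑ y ∈ Icc 1 Y ×ˢ Icc 1 Y, B.card * rr p X ((y.1 : ZMod p) / y.2) := by
    have : ∑ y ∈ Icc 1 Y ×ˢ Icc 1 Y, B.card * rr p X ((y.1 : ZMod p) / y.2) =
      ((Icc 1 Y ×ˢ Icc 1 Y).sigma (fun y => B ×ˢ ((X ×ˢ X).filter (fun q => (q.1 : ZMod p) = ((y.1 : ZMod p) / y.2) * (q.2 : ZMod p))))).card := by
      rw [card_sigma]
      apply sum_congr rfl
      intro y _
      rw [card_product]; rfl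
    rw [this]
    apply card_le_card_of_injOn (fun q => ⟨(q.1.1, q.2.1), (q.1.2.1, (q.1.2.2, q.2.2.2))⟩)
    · intro q hq
      obtain ⟨⟨y, m, x⟩, ⟨y', m', x'⟩⟩ := q
      rw [mem_coe, mem_filter] at hq
      rw [mem_coe, mem_sigma, mem_product]
      dsimp only
      rw [mem_product, mem_filter]
      simp only [mem_product, pip, Prod.mk.injEq] at hq ⊢
      obtain ⟨⟨⟨hy, hm, hx⟩, hy', hm', hx'⟩, h, h'⟩ := hq
      have c1 := hYp y hy
      have c2 := hYp y' hy'
      refine ⟨⟨hy, hy'⟩, hm, ⟨hx, hx'⟩, ?_⟩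
      field_simp at h' ⊢
      linear_combination h'
    · intro q hq q' hq' e
      obtain ⟨⟨y, m, x⟩, ⟨y', m', x'⟩⟩ := q
      obtain ⟨⟨z, n, w⟩, ⟨z', n', w'⟩⟩ := q'
      rw [mem_coe, mem_filter] at hq hq'
      simp only [Sigma.mk.injEq, Prod.mk.injEq, heq_eq_eq] at e
      obtain ⟨⟨rfl, rfl⟩, rfl, rfl, rfl⟩ := e
      have e1 := congrArg Prod.fst hq.2
      have e2 := congrArg Prod.fst hq'.2
      simp only [pip] at e1 e2
      have e3 := mul_left_cancel₀ ha (e1.symm.trans e2)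
      have c2 : (((y':ℕ) : ZMod p) ^ s)⁻¹ ≠ 0 := inv_ne_zero (pow_ne_zero _ (hYp y' (mem_product.mp (mem_product.mp hq.1).2).1))
      rw [mul_right_cancel₀ c2 e3]
  have h2 : ∀ y ∈ Icc 1 Y ×ˢ Icc 1 Y, (rr p X ((y.1 : ZMod p) / y.2) : ℝ) ≤ 1 + N * ((Nat.gcd y.1 y.2 : ℝ) / y.1) := by
    rintro ⟨y, y'⟩ hy
    simp only [mem_product] at hy ⊢
    obtain ⟨hy, hy'⟩ := hy
    have c1 := hYp y hy
    have c2 := hYp y' hy'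
    rw [mem_Icc] at hy hy'
    have hg : 0 < Nat.gcd y y' := Nat.gcd_pos_of_pos_left _ (by omega)
    obtain ⟨g, u, v, hg0, huv, rfl, rfl⟩ : ∃ g u v : ℕ, 0 < g ∧ Nat.Coprime u v ∧ y = u * g ∧ y' = v * g := by
      obtain ⟨u, v, h1, h2, h3⟩ := Nat.exists_coprime y y'
      exact ⟨_, u, v, hg, h1, h2, h3⟩
    have hgc : Nat.gcd (u * g) (v * g) = g := by
      rw [Nat.gcd_mul_right, huv.gcd_eq_one, one_mul]
    rw [hgc]
    have hu0 : u ≠ 0 := by rintro rfl; omega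
    have hv0 : v ≠ 0 := by rintro rfl; omega
    have hu : u ≤ N := (Nat.le_mul_of_pos_right u hg0).trans (hy.2.trans hYN)
    have hv : v ≤ N := (Nat.le_mul_of_pos_right v hg0).trans (hy'.2.trans hYN)
    push_cast at c1 c2 ⊢
    have := (rr_le X L N hX hN (((u:ZMod p) * g) / (v * g)) (div_ne_zero c1 c2) u v (Nat.isCoprime_iff_coprime.mpr huv)
      (by exact_mod_cast hu0) (by exact_mod_cast hv0) (by simpa using (by exact_mod_cast hu)) (by simpa using (by exact_mod_cast hv)) (by
        have hg' := right_ne_zero_of_mul c1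
        have hv' := left_ne_zero_of_mul c2
        push_cast; field_simp)).1
    refine this.trans (le_of_eq ?_)
    have : (0:ℝ) < u := by exact_mod_cast Nat.pos_of_ne_zero hu0
    have : (0:ℝ) < g := by exact_mod_cast hg0
    rw [Int.cast_natCast, Nat.abs_cast]
    field_simp
  have hlY : Real.log Y ≤ Real.log p := by
    have : (0:ℝ) < Y := by exact_mod_cast hY
    have : (Y:ℝ) ≤ p := by exact_mod_cast (hYN.trans hNp.le)
    gcongr
  have hl0 : 0 ≤ Real.log p := Real.log_natCast_nonneg p
  have hYN' : (Y:ℝ) ≤ N := by exact_mod_cast hYN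
  have hD1' : (1:ℝ) ≤ D := by exact_mod_cast hD1
  have hY' : (1:ℝ) ≤ Y := by exact_mod_cast hY
  have h3 : ∑ y ∈ Icc 1 Y ×ˢ Icc 1 Y, (rr p X ((y.1 : ZMod p) / y.2) : ℝ) ≤ 2 * (N * Y * D * (1 + Real.log p)) := by
    calc _ ≤ ∑ y ∈ Icc 1 Y ×ˢ Icc 1 Y, (1 + N * ((Nat.gcd y.1 y.2 : ℝ) / y.1)) := sum_le_sum h2
      _ = Y * Y + N * ∑ y ∈ Icc 1 Y, ∑ y' ∈ Icc 1 Y, (Nat.gcd y y' : ℝ) / y := by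
          rw [sum_add_distrib, ← mul_sum, sum_product (f := fun y : ℕ × ℕ => (Nat.gcd y.1 y.2 : ℝ) / y.1), sum_const, card_product]
          simp
      _ ≤ N * Y * D * (1 + Real.log p) + N * (Y * D * (1 + Real.log p)) := by
          refine add_le_add ?_ (mul_le_mul_of_nonneg_left ?_ (by positivity))
          · calc (Y:ℝ) * Y ≤ N * Y := by gcongr
              _ = N * Y * 1 * (1 + 0) := by ring
              _ ≤ _ := by gcongr
          · refine (gcd_sum Y D hD).trans ?_
            gcongr
      _ = _ := by ring
  calc _ ≤ ((∑ y ∈ Icc 1 Y ×ˢ Icc 1 Y, B.card * rr p X ((y.1 : ZMod p) / y.2) : ℕ) : ℝ) := Nat.cast_le.mpr h1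
    _ = B.card * ∑ y ∈ Icc 1 Y ×ˢ Icc 1 Y, (rr p X ((y.1 : ZMod p) / y.2) : ℝ) := by
        push_cast; rw [mul_sum]
    _ ≤ N * (2 * (N * Y * D * (1 + Real.log p))) := by gcongr
    _ = _ := by ring

lemma holder6 {ι β : Type*} [Fintype β] [DecidableEq β] (I : Finset ι) (π : ι → β) (G : β → ℝ) (hG : ∀ b, 0 ≤ G b) :
    (∑ i ∈ I, G (π i)) ^ 6 ≤ (I.card : ℝ) ^ 4 * (((I ×ˢ I).filter (fun q => π q.1 = π q.2)).card * ∑ b, G b ^ 6) := by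
  classical
  have h1 : (∑ i ∈ I, G (π i)) ^ 3 ≤ (I.card : ℝ) ^ 2 * ∑ i ∈ I, G (π i) ^ 3 :=
    pow_sum_le_card_mul_sum_pow (fun i _ => hG _) 2
  have h2 : ∑ i ∈ I, G (π i) ^ 3 = ∑ b, ((I.filter (fun i => π i = b)).card : ℝ) * G b ^ 3 := by
    rw [← sum_fiberwise I π]
    apply sum_congr rfl
    intro b _
    rw [← nsmul_eq_mul, ← sum_const]
    apply sum_congr rfl
    intro i hi
    rw [(mem_filter.mp hi).2]
  have h3 : (∑ i ∈ I, G (π i) ^ 3) ^ 2 ≤ ((I ×ˢ I).filter (fun q => π q.1 = π q.2)).card * ∑ b, G b ^ 6 := by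
    rw [h2]
    refine (sum_mul_sq_le_sq_mul_sq _ _ _).trans ?_
    have e : ∀ b, (G b ^ 3) ^ 2 = G b ^ 6 := fun b => by ring
    simp only [e]
    have hs : 0 ≤ ∑ b, G b ^ 6 := sum_nonneg (fun b _ => pow_nonneg (hG b) 6)
    gcongr
    have := sum_card_sq (univ : Finset β) I (fun b i => π i = b)
    have h4 : ∑ b : β, ((I.filter (fun i => π i = b)).card : ℝ) ^ 2 = ((∑ b : β, (I.filter (fun i => π i = b)).card ^ 2 : ℕ) : ℝ) := by push_cast; rfl
    rw [h4, this]
    apply Nat.cast_le.mpr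
    apply card_le_card_of_injOn (fun q => q.2)
    · intro q hq
      rw [mem_coe, mem_filter] at hq ⊢
      exact ⟨(mem_product.mp hq.1).2, hq.2.1.trans hq.2.2.symm⟩
    · intro q hq q' hq' e
      rw [mem_coe, mem_filter] at hq hq'
      have e : q.2 = q'.2 := e
      refine Prod.ext ?_ e
      rw [← hq.2.1, ← hq'.2.1, e]
  have hn : 0 ≤ ∑ i ∈ I, G (π i) := sum_nonneg (fun i _ => hG _)
  calc (∑ i ∈ I, G (π i)) ^ 6 = ((∑ i ∈ I, G (π i)) ^ 3) ^ 2 := by ring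
    _ ≤ ((I.card : ℝ) ^ 2 * ∑ i ∈ I, G (π i) ^ 3) ^ 2 := by gcongr
    _ = (I.card : ℝ) ^ 4 * (∑ i ∈ I, G (π i) ^ 3) ^ 2 := by ring
    _ ≤ _ := by gcongr

lemma shift_err (L : ℤ) (H k : ℕ) (f : ℤ → ℂ) (hf : ∀ x, ‖f x‖ ≤ 1) :
    ‖∑ x ∈ Icc (L + 1) (L + H), f x - ∑ x ∈ Icc (L + 1) (L + H), f (x + k)‖ ≤ 2 * k := by
  induction k with
  | zero => simp
  | succ k ih =>
    have step : ‖∑ x ∈ Icc (L + 1) (L + H), f (x + k) - ∑ x ∈ Icc (L + 1) (L + H), f (x + (k+1:ℕ))‖ ≤ 2 := by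
      have : ∑ x ∈ Icc (L + 1) (L + H), f (x + k) - ∑ x ∈ Icc (L + 1) (L + H), f (x + (k+1:ℕ)) = f (L + 1 + k) - f (L + 1 + H + k) := by
        clear ih hf
        induction H with
        | zero => simp
        | succ H ih =>
          have : Icc (L + 1) (L + (H+1:ℕ)) = insert (L + (H+1:ℕ)) (Icc (L + 1) (L + H)) := by
            ext x; simp only [mem_Icc, mem_insert]; push_cast; omega
          rw [this, sum_insert (by simp), sum_insert (by simp)]
          have e1 : L + (H+1:ℕ) + (k:ℤ) = L + 1 + H + k := by push_cast; ring
          have e2 : L + (H+1:ℕ) + ((k+1:ℕ):ℤ) = L + 1 + (H+1:ℕ) + k := by push_cast; ring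
          rw [e1, e2]
          linear_combination ih
      rw [this]
      refine (norm_sub_le _ _).trans ?_
      have := hf (L + 1 + k)
      have := hf (L + 1 + H + k)
      linarith
    have := norm_sub_le_norm_sub_add_norm_sub (∑ x ∈ Icc (L + 1) (L + H), f x) (∑ x ∈ Icc (L + 1) (L + H), f (x + k)) (∑ x ∈ Icc (L + 1) (L + H), f (x + (k+1:ℕ)))
    refine this.trans ?_
    push_cast at *
    linarith

end W17
open Finset
namespace W17

lemma sup_bound {p : ℕ} [Fact p.Prime] (hp : 3 < p) (s : ℕ) (hs : 0 < s) (a : ZMod p) (ha : a ≠ 0)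
    (B : Finset (ZMod p)) (L : ℤ) (H N Y Z D : ℕ) (hY : 1 ≤ Y) (hYN : Y ≤ N) (hHN : H ≤ N)
    (hZ : Z < p) (hZp : p ≤ Z ^ 3) (hN : 2 * N ^ 2 ≤ p) (hB : B.card ≤ N) (hD1 : 1 ≤ D)
    (hD : ∀ n : ℕ, n ≠ 0 → n ≤ Y → n.divisors.card ≤ D) :
    ∃ W : ℝ, 0 ≤ W ∧ Y * Z * ‖SS p s B (Icc (L + 1) (L + H)) a‖ ≤ W + 2 * (Y * Z) ^ 2 * N ∧
      W ^ 6 ≤ (12 * s + 66) * D * (1 + Real.log p) * p * Y ^ 5 * N ^ 10 * Z ^ 6 := by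
  classical
  have hNp : N < p := by nlinarith
  have hYp : ∀ y ∈ Icc 1 Y, ((y:ℕ) : ZMod p) ≠ 0 := by
    intro y hy h
    rw [mem_Icc] at hy
    rw [ZMod.natCast_eq_zero_iff] at h
    have := Nat.le_of_dvd (by omega) h
    omega
  set X := Icc (L + 1) (L + H) with hX
  have hXN : X ⊆ Icc (L + 1) (L + N) := by
    rw [hX]; apply Icc_subset_Icc le_rfl; have : (H:ℤ) ≤ N := by exact_mod_cast hHN
    linarith
  have hXc : X.card = H := by rw [hX, Int.card_Icc]; omega
  set c : ℕ → ZMod p := fun z => (z : ZMod p) with hc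
  set K := (Icc 1 Z).image c with hK
  have hinj : Set.InjOn c (Icc 1 Z : Finset ℕ) := by
    intro x hx y hy h
    rw [mem_coe, mem_Icc] at hx hy
    have h : (x : ZMod p) = (y : ZMod p) := h
    rw [ZMod.natCast_eq_natCast_iff'] at h
    rwa [Nat.mod_eq_of_lt (by omega), Nat.mod_eq_of_lt (by omega)] at h
  have hKc : K.card = Z := by rw [hK, card_image_of_injOn hinj]; simp
  set I := Icc 1 Y ×ˢ (B ×ˢ X) with hI
  set G : ZMod p × ZMod p → ℝ := fun b => ‖gg p s K b.1 b.2‖ with hG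
  refine ⟨∑ i ∈ I, G (pip p s a i), sum_nonneg (fun i _ => norm_nonneg _), ?_, ?_⟩
  · set S := SS p s B X a with hS
    set f : ℕ → ℕ → ℂ := fun y z => ∑ m ∈ B, ∑ x ∈ X, ee p (a * (m * (((x + (y * z : ℕ) : ℤ) : ZMod p) ^ s)⁻¹)) with hf
    have h1 : ∀ y ∈ Icc 1 Y, ∀ z ∈ Icc 1 Z, ‖S - f y z‖ ≤ 2 * (Y * Z) * N := by
      intro y hy z hz
      rw [mem_Icc] at hy hz
      rw [hS, hf, SS]
      dsimp only
      rw [← sum_sub_distrib]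
      calc _ ≤ ∑ m ∈ B, (2 * ((y * z : ℕ) : ℝ)) := by
            refine norm_sum_le_of_le _ ?_
            intro m _
            exact shift_err L H (y * z) (fun x => ee p (a * (m * (((x : ℤ) : ZMod p) ^ s)⁻¹))) (fun x => (ee_norm _).le)
        _ = B.card * (2 * ((y * z : ℕ) : ℝ)) := by rw [sum_const, nsmul_eq_mul]
        _ ≤ N * (2 * ((Y * Z : ℕ) : ℝ)) := by
            gcongr
            · exact hy.2
            · exact hz.2
        _ = _ := by push_cast; ring
    have h2 : ∑ y ∈ Icc 1 Y, ∑ z ∈ Icc 1 Z, f y z = ∑ i ∈ I, gg p s K (pip p s a i).1 (pip p s a i).2 := by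
      rw [hI, sum_product]
      apply sum_congr rfl
      intro y hy
      have hy0 := hYp y hy
      rw [sum_product, hf]
      dsimp only
      rw [sum_comm]
      apply sum_congr rfl
      intro m _
      rw [sum_comm]
      apply sum_congr rfl
      intro x _
      rw [gg, hK, sum_image hinj]
      apply sum_congr rfl
      intro z _
      congr 1
      have : ((x + (y * z : ℕ) : ℤ) : ZMod p) = (y : ZMod p) * ((x : ZMod p) * (y : ZMod p)⁻¹ + z) := by
        push_cast; field_simp
      rw [this, mul_pow, mul_inv]
      simp only [pip, hc]
      ring
    have h3 : (Y : ℂ) * Z * S = ∑ y ∈ Icc 1 Y, ∑ z ∈ Icc 1 Z, (S - f y z) + ∑ i ∈ I, gg p s K (pip p s a i).1 (pip p s a i).2 := by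
      rw [← h2, ← sum_add_distrib]
      simp only [← sum_add_distrib, sub_add_cancel, sum_const, Nat.card_Icc, nsmul_eq_mul]
      simp; ring
    calc (Y:ℝ) * Z * ‖S‖ = ‖(Y : ℂ) * Z * S‖ := by simp
      _ ≤ ‖∑ y ∈ Icc 1 Y, ∑ z ∈ Icc 1 Z, (S - f y z)‖ + ‖∑ i ∈ I, gg p s K (pip p s a i).1 (pip p s a i).2‖ := by
          rw [h3]; exact norm_add_le _ _
      _ ≤ 2 * (Y * Z) ^ 2 * N + ∑ i ∈ I, G (pip p s a i) := by
          refine add_le_add ?_ (norm_sum_le _ _)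
          calc _ ≤ ∑ y ∈ Icc 1 Y, ∑ z ∈ Icc 1 Z, (2 * (Y * Z) * N : ℝ) := by
                refine norm_sum_le_of_le _ (fun y hy => norm_sum_le_of_le _ (fun z hz => h1 y hy z hz))
            _ = _ := by simp; ring
      _ = _ := by ring
  · have hl0 : 0 ≤ Real.log p := Real.log_natCast_nonneg p
    have e1 := holder6 I (pip p s a) G (fun b => norm_nonneg _)
    have e2 := coll s a ha B X L N Y D hY hYN hXN hN hB hD1 hD
    have e3 : ∑ b, G b ^ 6 ≤ p * ((Z:ℝ) ^ 6 * (6 * s + 33)) := by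
      rw [Fintype.sum_prod_type_right]
      refine (gg_moment hp s hs K).trans ?_
      rw [hKc]
      have : (p:ℝ) ≤ (Z:ℝ) ^ 3 := by exact_mod_cast hZp
      gcongr
      calc (27 : ℝ) * Z ^ 3 * p + Z ^ 6 * (6 * s + 6) ≤ 27 * Z ^ 3 * Z ^ 3 + Z ^ 6 * (6 * s + 6) := by gcongr
        _ = _ := by ring
    have e4 : (I.card : ℝ) ≤ Y * (N * N) := by
      rw [hI, card_product, card_product, hXc]
      simp only [Nat.card_Icc, add_tsub_cancel_right]
      push_cast
      gcongr
    calc _ ≤ _ := e1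
      _ ≤ (Y * (N * N) : ℝ) ^ 4 * ((2 * N ^ 2 * Y * D * (1 + Real.log p)) * (p * ((Z:ℝ) ^ 6 * (6 * s + 33)))) := by
          gcongr
      _ = _ := by ring

end W17
open Finset
namespace W17

lemma rank_sum {ι : Type*} [DecidableEq ι] (S : Finset ι) (f : ι → ℝ) :
    ∑ a ∈ S, (1:ℝ) / ((S.filter (fun b => f a ≤ f b)).card : ℝ) ≤ ∑ i ∈ Icc 1 S.card, (1:ℝ) / i := by
  induction S using Finset.induction_on_min_value f with
  | empty => simp
  | insert a S ha hmin ih =>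
    rw [sum_insert ha, card_insert_of_notMem ha]
    have e : Icc 1 (S.card + 1) = insert (S.card + 1) (Icc 1 S.card) := by
      ext x; simp only [mem_Icc, mem_insert]; omega
    rw [e, sum_insert (by simp)]
    refine add_le_add ?_ (le_trans ?_ ih)
    · have : (insert a S).filter (fun b => f a ≤ f b) = insert a S := by
        rw [filter_eq_self]
        intro b hb
        rcases mem_insert.mp hb with rfl | h
        · exact le_rfl
        · exact hmin b h
      rw [this, card_insert_of_notMem ha]
    · apply sum_le_sum
      intro b hb
      have h0 : 0 < (S.filter (fun c => f b ≤ f c)).card := card_pos.mpr ⟨b, mem_filter.mpr ⟨hb, le_rfl⟩⟩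
      have h0' : (0:ℝ) < ((S.filter (fun c => f b ≤ f c)).card : ℝ) := by exact_mod_cast h0
      apply one_div_le_one_div_of_le h0'
      apply Nat.cast_le.mpr
      apply card_le_card
      apply filter_subset_filter
      exact subset_insert _ _

lemma num_sup (s F P p N Y Z W t T : ℝ) (hs : 1 ≤ s) (hF : 1 ≤ F) (hP : 1 ≤ P) (hp : p = P ^ 35)
    (hN1 : N ≤ P ^ 17) (hN2 : P ^ 17 ≤ 2 * N) (hY1 : Y ≤ P ^ 4) (hY2 : P ^ 4 ≤ 2 * Y) (hZ0 : 0 < Z) (hZ : Z ≤ 2 * P ^ 12)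
    (hW : 0 ≤ W) (h1 : Y * Z * T ≤ W + 2 * (Y * Z) ^ 2 * N)
    (h2 : W ^ 6 ≤ (12 * s + 66) * F * p * Y ^ 5 * N ^ 10 * Z ^ 6) (ht : T = t * N ^ 2) (ht0 : 0 ≤ t) :
    t ^ 2 * P ≤ 3072 * s * F := by
  have hP0 : 0 < P := by linarith
  have hN0 : 0 < N := by have : 0 < P ^ 17 := by positivity
                         linarith
  have hY0 : 0 < Y := by have : 0 < P ^ 4 := by positivity
                         linarith
  set w := W / (Y * Z * N ^ 2) with hw
  have hw0 : 0 ≤ w := by positivity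
  set v := 2 * (Y * Z) / N with hv
  have hv0 : 0 ≤ v := by positivity
  have htw : t ≤ w + v := by
    rw [ht] at h1
    have : w + v = (W + 2 * (Y * Z) ^ 2 * N) / (Y * Z * N ^ 2) := by
      rw [hw, hv]; field_simp
    rw [this, le_div_iff₀ (by positivity)]
    linarith
  have hvP : v * P ≤ 8 := by
    rw [hv, div_mul_eq_mul_div, div_le_iff₀ hN0]
    calc 2 * (Y * Z) * P ≤ 2 * (P ^ 4 * (2 * P ^ 12)) * P := by gcongr
      _ = 4 * P ^ 17 := by ring
      _ ≤ 4 * (2 * N) := by gcongr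
      _ = _ := by ring
  have hsF : 1 ≤ s * F := by nlinarith
  have hwP : (w ^ 2 * P) ^ 3 ≤ (624 * s * F) ^ 3 := by
    calc (w ^ 2 * P) ^ 3 = W ^ 6 * P ^ 3 / (Y * Z * N ^ 2) ^ 6 := by rw [hw]; field_simp
      _ ≤ 624 * s * F := by
        rw [div_le_iff₀ (by positivity)]
        calc W ^ 6 * P ^ 3 ≤ (12 * s + 66) * F * p * Y ^ 5 * N ^ 10 * Z ^ 6 * P ^ 3 := by gcongr
          _ ≤ (78 * s) * F * p * Y ^ 5 * N ^ 10 * Z ^ 6 * P ^ 3 := by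
              have : 0 ≤ p := by rw [hp]; positivity
              gcongr; linarith
          _ = (78 * s) * F * Y ^ 5 * N ^ 10 * Z ^ 6 * (P ^ 4 * (P ^ 17) ^ 2) := by rw [hp]; ring
          _ ≤ (78 * s) * F * Y ^ 5 * N ^ 10 * Z ^ 6 * ((2 * Y) * (2 * N) ^ 2) := by gcongr
          _ = _ := by ring
      _ ≤ (624 * s * F) ^ 3 := le_self_pow₀ (by nlinarith) (by norm_num)
  have hwP' : w ^ 2 * P ≤ 624 * s * F := le_of_pow_le_pow_left₀ (by norm_num) (by positivity) hwP
  have hv2 : v ^ 2 * P ≤ 64 := by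
    calc v ^ 2 * P ≤ v ^ 2 * P * P := le_mul_of_one_le_right (by positivity) hP
      _ = (v * P) ^ 2 := by ring
      _ ≤ 8 ^ 2 := by gcongr
      _ = 64 := by norm_num
  calc t ^ 2 * P ≤ (w + v) ^ 2 * P := by gcongr
    _ ≤ (2 * w ^ 2 + 2 * v ^ 2) * P := by gcongr; nlinarith [sq_nonneg (w - v)]
    _ = 2 * (w ^ 2 * P) + 2 * (v ^ 2 * P) := by ring
    _ ≤ 2 * (624 * s * F) + 2 * 64 := by gcongr
    _ ≤ _ := by nlinarith

lemma num_level (s F P p N ϖ α R t T e : ℝ) (he : e = 3072 * s * F) (hs : 1 ≤ s) (hF : 1 ≤ F) (hP : 1 ≤ P) (hp : p = P ^ 35)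
    (hR : R ^ 3 = P) (hR0 : 0 < R) (hα : 0 < α) (hαp : α ^ 8 ≤ p) (hϖ : 0 < ϖ) (hϖp : ϖ ^ 8 = p)
    (hN1 : N ≤ P ^ 17) (hN2 : P ^ 17 ≤ 2 * N) (ht0 : 0 ≤ t) (ht1 : t ≤ 1) (ht : T = t * N ^ 2)
    (hsup : t ^ 2 * P ≤ e)
    (h : (α ^ 8 * T) ^ 2 ≤ N * (p * (2 * s * (α ^ 8) ^ 2 + 64 * s * F * N * (α ^ 10 + α ^ 13 / ϖ)))) :
    T ^ 6 * α ^ 8 ≤ N ^ 12 * e ^ 3 / R := by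
  have hP0 : 0 < P := by linarith
  have hN0 : 0 < N := by have : 0 < P ^ 17 := by positivity
                         linarith
  have hsF : 1 ≤ s * F := by nlinarith
  have he1 : 1 ≤ e := by rw [he]; nlinarith
  have hse : 96 * s ≤ e := by rw [he]; nlinarith
  have hp0 : 0 < p := by rw [hp]; positivity
  have h1 : t ^ 2 * α ^ 16 ≤ 32 * s * (α ^ 16 / P ^ 16) + (e / 3) * (P * α ^ 10) + (e / 3) * (P * (α ^ 13 / ϖ)) := by
    have hN4 : P ^ 68 ≤ 16 * N ^ 4 := by
      calc P ^ 68 = (P ^ 17) ^ 4 := by ring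
        _ ≤ (2 * N) ^ 4 := by gcongr
        _ = _ := by ring
    have : P ^ 68 * (t ^ 2 * α ^ 16) ≤ P ^ 68 * (32 * s * (α ^ 16 / P ^ 16) + (e / 3) * (P * α ^ 10) + (e / 3) * (P * (α ^ 13 / ϖ))) := by
      calc P ^ 68 * (t ^ 2 * α ^ 16) ≤ 16 * N ^ 4 * (t ^ 2 * α ^ 16) := by gcongr
        _ = 16 * (α ^ 8 * T) ^ 2 := by rw [ht]; ring
        _ ≤ 16 * (N * (p * (2 * s * (α ^ 8) ^ 2 + 64 * s * F * N * (α ^ 10 + α ^ 13 / ϖ)))) := by gcongr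
        _ ≤ 16 * (P ^ 17 * (p * (2 * s * (α ^ 8) ^ 2 + 64 * s * F * P ^ 17 * (α ^ 10 + α ^ 13 / ϖ)))) := by gcongr
        _ = _ := by rw [hp, he]; field_simp; ring
    exact le_of_mul_le_mul_left this (by positivity)
  have key : (t ^ 6 * α ^ 8) ^ 3 * P ≤ e ^ 9 := by
    have hϖ1 : P ^ 4 ≤ ϖ := by
      apply le_of_pow_le_pow_left₀ (n := 8) (by norm_num) hϖ.le
      rw [hϖp, hp]
      calc (P ^ 4) ^ 8 = P ^ 32 := by ring
        _ ≤ P ^ 35 := by gcongr; norm_num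
    rcases le_or_gt (t ^ 2 * α ^ 16) (96 * s * (α ^ 16 / P ^ 16)) with c1 | c1
    · have c1' : t ^ 2 ≤ e / P ^ 16 := by
        have : t ^ 2 * α ^ 16 ≤ (e / P ^ 16) * α ^ 16 := by
          calc _ ≤ _ := c1
            _ = (96 * s / P ^ 16) * α ^ 16 := by ring
            _ ≤ _ := by gcongr
        exact le_of_mul_le_mul_right this (by positivity)
      calc (t ^ 6 * α ^ 8) ^ 3 * P = (t ^ 2) ^ 9 * (α ^ 8) ^ 3 * P := by ring
        _ ≤ (e / P ^ 16) ^ 9 * (P ^ 35) ^ 3 * P := by gcongr; rw [← hp]; exact hαp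
        _ = e ^ 9 * (1 / P ^ 38) := by field_simp
        _ ≤ e ^ 9 * 1 := by
            gcongr
            rw [div_le_one (by positivity)]
            exact one_le_pow₀ hP
        _ = _ := by ring
    · rcases le_or_gt (t ^ 2 * α ^ 16) (e * (P * α ^ 10)) with c2 | c2
      · have c2' : t ^ 2 * α ^ 6 ≤ e * P := by
          have : (t ^ 2 * α ^ 6) * α ^ 10 ≤ (e * P) * α ^ 10 := by
            calc _ = t ^ 2 * α ^ 16 := by ring
              _ ≤ _ := c2
              _ = _ := by ring
          exact le_of_mul_le_mul_right this (by positivity)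
        have : (t ^ 6 * α ^ 8) ^ 3 * P * P ^ 4 ≤ e ^ 9 * P ^ 4 := by
          calc (t ^ 6 * α ^ 8) ^ 3 * P * P ^ 4 = (t ^ 2 * P) ^ 5 * (t ^ 2 * α ^ 6) ^ 4 := by ring
            _ ≤ e ^ 5 * (e * P) ^ 4 := by gcongr
            _ = _ := by ring
        exact le_of_mul_le_mul_right this (by positivity)
      · have c3 : t ^ 2 * α ^ 16 ≤ e * (P * (α ^ 13 / ϖ)) := by linarith
        have c3' : t ^ 2 * α ^ 3 ≤ e * (P / ϖ) := by
          have : (t ^ 2 * α ^ 3) * α ^ 13 ≤ (e * (P / ϖ)) * α ^ 13 := by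
            calc _ = t ^ 2 * α ^ 16 := by ring
              _ ≤ _ := c3
              _ = _ := by ring
          exact le_of_mul_le_mul_right this (by positivity)
        have c4 : P / ϖ ≤ 1 / P := by
          rw [div_le_div_iff₀ hϖ hP0]
          calc P * P = P ^ 2 := by ring
            _ ≤ P ^ 4 := by gcongr; norm_num
            _ ≤ _ := by linarith
        have ht2 : t ^ 2 ≤ 1 := pow_le_one₀ ht0 ht1
        calc (t ^ 6 * α ^ 8) ^ 3 * P = (t ^ 2) * (t ^ 2 * α ^ 3) ^ 8 * P := by ring
          _ ≤ 1 * (e * (1 / P)) ^ 8 * P := by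
              have c5 : t ^ 2 * α ^ 3 ≤ e * (1 / P) := c3'.trans (by gcongr)
              have c6 : (t ^ 2 * α ^ 3) ^ 8 ≤ (e * (1 / P)) ^ 8 := pow_le_pow_left₀ (by positivity) c5 8
              have c7 := mul_le_mul ht2 c6 (by positivity) zero_le_one
              exact mul_le_mul_of_nonneg_right c7 hP0.le
          _ = e ^ 8 * (1 / P ^ 7) := by field_simp
          _ ≤ e ^ 9 * 1 := by
            gcongr
            · norm_num
            rw [div_le_one (by positivity)]
            exact one_le_pow₀ hP
          _ = _ := by ring
  have key2 : (t ^ 6 * α ^ 8 * R) ^ 3 ≤ (e ^ 3) ^ 3 := by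
    calc _ = (t ^ 6 * α ^ 8) ^ 3 * R ^ 3 := by ring
      _ ≤ e ^ 9 := by rw [hR]; exact key
      _ = _ := by ring
  have key3 := le_of_pow_le_pow_left₀ (by norm_num) (by positivity) key2
  rw [le_div_iff₀ hR0, ht]
  calc (t * N ^ 2) ^ 6 * α ^ 8 * R = N ^ 12 * (t ^ 6 * α ^ 8 * R) := by ring
    _ ≤ _ := by gcongr

end W17
open Finset
namespace W17

/-- admissible parameters -/
structure Par (p N Y Z D : ℕ) (P R ϖ : ℝ) : Prop where
  hp : 3 < p
  hP : 1 ≤ P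
  hpP : (p:ℝ) = P ^ 35
  hR : R ^ 3 = P
  hR0 : 0 < R
  hϖ : 0 < ϖ
  hϖp : ϖ ^ 8 = p
  hN1 : (N:ℝ) ≤ P ^ 17
  hN2 : P ^ 17 ≤ 2 * N
  hY1 : (Y:ℝ) ≤ P ^ 4
  hY2 : P ^ 4 ≤ 2 * Y
  hZ1 : (Z:ℝ) ≤ 2 * P ^ 12
  hZp : p ≤ Z ^ 3
  hZ2 : Z < p
  hYN : Y ≤ N
  hY : 1 ≤ Y
  hNp : 2 * N ^ 2 ≤ p
  hD1 : 1 ≤ D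
  hD : ∀ n : ℕ, n ≠ 0 → n ≤ N ^ 4 → (2 * n.divisors.card) ^ 4 ≤ D

lemma root8 (x : ℝ) (hx : 0 ≤ x) : (x ^ ((1:ℝ) / 8)) ^ 8 = x := by
  rw [← Real.rpow_natCast, ← Real.rpow_mul hx]; norm_num

lemma SS_trivial {p : ℕ} [NeZero p] (s : ℕ) (B : Finset (ZMod p)) (X : Finset ℤ) (a : ZMod p) :
    ‖SS p s B X a‖ ≤ B.card * X.card := by
  unfold SS
  calc _ ≤ ∑ m ∈ B, ∑ x ∈ X, (1:ℝ) := norm_sum_le_of_le _ (fun m _ => norm_sum_le_of_le _ (fun x _ => (ee_norm _).le))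
    _ = _ := by simp

lemma pointwise {p : ℕ} [Fact p.Prime] {N Y Z D : ℕ} {P R ϖ : ℝ} (par : Par p N Y Z D P R ϖ)
    (s : ℕ) (hs : 0 < s) (B : Finset (ZMod p)) (hB : B.card ≤ N) (L : ℤ) (H : ℕ) (hH : H ≤ N)
    (hX : ∀ x ∈ Icc (L + 1) (L + H), 1 ≤ x ∧ x ≤ (p:ℤ) - 1) (a : ZMod p) (ha : a ≠ 0) :
    ‖SS p s B (Icc (L + 1) (L + H)) a‖ ^ 6 * ((univ.erase (0 : ZMod p)).filter
      (fun b => ‖SS p s B (Icc (L + 1) (L + H)) a‖ ≤ ‖SS p s B (Icc (L + 1) (L + H)) b‖)).card ≤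
      N ^ 12 * (3072 * s * (D * (1 + Real.log p))) ^ 3 / R := by
  classical
  obtain ⟨hp, hP, hpP, hR, hR0, hϖ, hϖp, hN1, hN2, hY1, hY2, hZ1, hZp, hZ2, hYN, hY, hNp, hD1, hD⟩ := par
  set X := Icc (L + 1) (L + H) with hXd
  set T := ‖SS p s B X a‖ with hT
  set A := (univ.erase (0 : ZMod p)).filter (fun b => T ≤ ‖SS p s B X b‖) with hA
  have haA : a ∈ A := by rw [hA, mem_filter, mem_erase]; exact ⟨⟨ha, mem_univ _⟩, le_rfl⟩
  have hk : 0 < A.card := card_pos.mpr ⟨a, haA⟩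
  have hA0 : (0 : ZMod p) ∉ A := by rw [hA, mem_filter, mem_erase]; tauto
  have hN1' : 1 ≤ N := hY.trans hYN
  have hN0 : (0:ℝ) < N := by exact_mod_cast hN1'
  have hl0 : 0 ≤ Real.log p := Real.log_natCast_nonneg p
  have hD1' : (1:ℝ) ≤ D := by exact_mod_cast hD1
  set F : ℝ := D * (1 + Real.log p) with hF
  have hF1 : 1 ≤ F := by rw [hF]; nlinarith
  have hs1 : (1:ℝ) ≤ s := by exact_mod_cast hs
  have hXc : X.card = H := by rw [hXd, Int.card_Icc]; omega
  have hXN : X ⊆ Icc (L + 1) (L + N) := by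
    rw [hXd]; apply Icc_subset_Icc le_rfl; have : (H:ℤ) ≤ N := by exact_mod_cast hH
    linarith
  have hX0 : ∀ x ∈ X, (x : ZMod p) ≠ 0 := by
    intro x hx h
    have := hX x hx
    have := int_eq_zero_of_cast h (by rw [abs_lt]; constructor <;> linarith)
    omega
  set t := T / N ^ 2 with ht
  have htT : T = t * N ^ 2 := by rw [ht]; field_simp
  have ht0 : 0 ≤ t := by positivity
  have ht1 : t ≤ 1 := by
    rw [ht, div_le_one (by positivity)]
    calc T ≤ B.card * X.card := SS_trivial s B X a
      _ ≤ N * N := by rw [hXc]; gcongr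
      _ = _ := by ring
  have hDY : ∀ n : ℕ, n ≠ 0 → n ≤ Y → n.divisors.card ≤ D := by
    intro n hn h
    refine le_trans ?_ (hD n hn (h.trans (hYN.trans (Nat.le_self_pow (by norm_num) N))))
    calc n.divisors.card ≤ 2 * n.divisors.card := by omega
      _ ≤ _ := Nat.le_self_pow (by norm_num) _
  have hZ0 : 0 < Z := by
    rcases Nat.eq_zero_or_pos Z with h | h
    · subst h; omega
    · exact h
  obtain ⟨W, hW0, hW1, hW2⟩ := sup_bound hp s hs a ha B L H N Y Z D hY hYN hH hZ2 hZp hNp hB hD1 hDY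
  have hsup : t ^ 2 * P ≤ 3072 * s * F := num_sup s F P p N Y Z W t T hs1 hF1 hP hpP hN1 hN2 hY1 hY2
    (by exact_mod_cast hZ0) hZ1 hW0 hW1 (by rw [hF]; convert hW2 using 1; ring) htT ht0
  set α : ℝ := (A.card : ℝ) ^ ((1:ℝ) / 8) with hα
  have hα0 : 0 < α := Real.rpow_pos_of_pos (Nat.cast_pos.mpr hk) _
  have hα8 : α ^ 8 = A.card := root8 _ (Nat.cast_nonneg _)
  have hlev := level_set s B A X N T (norm_nonneg _) hB (fun b hb => (mem_filter.mp hb).2)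
  have hJ := JA_bound s hs A hA0 X L N hXN hNp hN1' hX0 D hD1 hD α ϖ hα0.le hα8 hϖ hϖp
  have hfin := num_level s F P p N ϖ α R t T (3072 * s * F) rfl hs1 hF1 hP hpP hR hR0 hα0
    (by rw [hα8]; exact_mod_cast (card_le_univ A).trans (by rw [ZMod.card])) hϖ hϖp hN1 hN2 ht0 ht1 htT hsup
    (by
      rw [hα8]
      rw [hα8] at hJ
      refine hlev.trans ?_
      gcongr
      refine hJ.trans (le_of_eq ?_)
      rw [hF]; ring)
  rw [hα8] at hfin
  exact hfin

lemma piece {p : ℕ} [Fact p.Prime] {N Y Z D : ℕ} {P R ϖ : ℝ} (par : Par p N Y Z D P R ϖ)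
    (s : ℕ) (hs : 0 < s) (B : Finset (ZMod p)) (hB : B.card ≤ N) (L : ℤ) (H : ℕ) (hH : H ≤ N)
    (hX : ∀ x ∈ Icc (L + 1) (L + H), 1 ≤ x ∧ x ≤ (p:ℤ) - 1) :
    ∑ a ∈ univ.erase (0 : ZMod p), ‖SS p s B (Icc (L + 1) (L + H)) a‖ ^ 6 ≤
      N ^ 12 * (3072 * s * (D * (1 + Real.log p))) ^ 3 / R * (1 + Real.log p) := by
  classical
  have hR0 := par.hR0
  have hl0 : 0 ≤ Real.log p := Real.log_natCast_nonneg p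
  set f : ZMod p → ℝ := fun a => ‖SS p s B (Icc (L + 1) (L + H)) a‖ with hf
  set c : ℝ := N ^ 12 * (3072 * s * (D * (1 + Real.log p))) ^ 3 / R with hc
  have hc0 : 0 ≤ c := by positivity
  calc _ ≤ ∑ a ∈ univ.erase (0 : ZMod p), c * (1 / (((univ.erase (0 : ZMod p)).filter (fun b => f a ≤ f b)).card : ℝ)) := by
        apply sum_le_sum
        intro a ha
        have h0 : 0 < ((univ.erase (0 : ZMod p)).filter (fun b => f a ≤ f b)).card := card_pos.mpr ⟨a, mem_filter.mpr ⟨ha, le_rfl⟩⟩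
        rw [mul_one_div, le_div_iff₀ (by exact_mod_cast h0)]
        exact pointwise par s hs B hB L H hH hX a (mem_erase.mp ha).1
    _ = c * ∑ a ∈ univ.erase (0 : ZMod p), (1 / (((univ.erase (0 : ZMod p)).filter (fun b => f a ≤ f b)).card : ℝ)) := by
        rw [mul_sum]
    _ ≤ c * (1 + Real.log p) := by
        gcongr
        refine (rank_sum _ f).trans ((harm_le _).trans ?_)
        rw [card_erase_of_mem (mem_univ _), card_univ, ZMod.card]
        have := par.hp
        have : (0:ℝ) < (p - 1 : ℕ) := by exact_mod_cast (by omega : 0 < p - 1)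
        gcongr
        omega

end W17
open Finset
namespace W17

lemma split_set {ι : Type*} [DecidableEq ι] (B : Finset ι) (N : ℕ) (hN : 1 ≤ N) :
    ∃ g : ι → ℕ, (∀ b ∈ B, g b < B.card / N + 1) ∧ ∀ j, (B.filter (fun b => g b = j)).card ≤ N := by
  classical
  set idx : ι → ℕ := fun b => if h : b ∈ B then (B.equivFin ⟨b, h⟩ : ℕ) else 0 with hidx
  have hlt : ∀ b ∈ B, idx b < B.card := by
    intro b hb
    simp only [hidx, hb, dif_pos]
    exact (B.equivFin ⟨b, hb⟩).2
  have hinj : ∀ b ∈ B, ∀ c ∈ B, idx b = idx c → b = c := by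
    intro b hb c hc h
    simp only [hidx, hb, hc, dif_pos] at h
    have := B.equivFin.injective (Fin.ext h)
    simpa using this
  refine ⟨fun b => idx b / N, ?_, ?_⟩
  · intro b hb
    have := Nat.div_le_div_right (c := N) (hlt b hb).le
    show idx b / N < _
    omega
  · intro j
    calc _ ≤ (Ico (j * N) (j * N + N)).card := by
          apply card_le_card_of_injOn idx
          · intro b hb
            rw [mem_coe, mem_filter] at hb
            rw [mem_coe, mem_Ico]
            have h1 := Nat.div_add_mod (idx b) N
            have h2 := Nat.mod_lt (idx b) (by omega : 0 < N)
            have hb2 : idx b / N = j := hb.2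
            rw [hb2, mul_comm] at h1
            omega
          · intro b hb c hc h
            rw [mem_coe, mem_filter] at hb hc
            exact hinj b hb.1 c hc.1 h
      _ = N := by simp

lemma split_int (L : ℤ) (M N K : ℕ) (f : ℤ → ℂ) :
    ∑ x ∈ Icc (L + 1) (L + (min M (K * N) : ℕ)), f x =
      ∑ j ∈ range K, ∑ x ∈ Icc (L + (j * N : ℕ) + 1) (L + (j * N : ℕ) + (min N (M - j * N) : ℕ)), f x := by
  induction K with
  | zero => simp
  | succ K ih =>
    rw [sum_range_succ, ← ih]
    rw [show (K + 1) * N = K * N + N by ring]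
    generalize K * N = q
    rw [← sum_union]
    · apply sum_congr _ (fun _ _ => rfl)
      ext x
      simp only [mem_union, mem_Icc]
      omega
    · rw [disjoint_left]
      intro x h1 h2
      rw [mem_Icc] at h1 h2
      omega

lemma full {p : ℕ} [Fact p.Prime] {N Y Z D : ℕ} {P R ϖ : ℝ} (par : Par p N Y Z D P R ϖ)
    (s : ℕ) (hs : 0 < s) (B : Finset (ZMod p)) (L : ℤ) (M : ℕ) (hB : B.card = M) (hMN : N ≤ M)
    (hX : ∀ x ∈ Icc (L + 1) (L + M), 1 ≤ x ∧ x ≤ (p:ℤ) - 1) :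
    ∑ a ∈ univ.erase (0 : ZMod p), ‖SS p s B (Icc (L + 1) (L + M)) a‖ ^ 6 ≤
      4096 * M ^ 12 * ((3072 * s * (D * (1 + Real.log p))) ^ 3 / R * (1 + Real.log p)) := by
  classical
  have hN1 : 1 ≤ N := par.hY.trans par.hYN
  have hN0 : (0:ℝ) < N := by exact_mod_cast hN1
  have hR0 := par.hR0
  have hl0 : 0 ≤ Real.log p := Real.log_natCast_nonneg p
  obtain ⟨g, hg1, hg2⟩ := split_set B N hN1
  rw [hB] at hg1
  set K := M / N + 1 with hK
  have hKM : M ≤ K * N := by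
    have h1 := Nat.div_add_mod M N
    have h2 := Nat.mod_lt M (by omega : 0 < N)
    rw [hK]
    nlinarith
  have hK2 : (K:ℝ) * N ≤ 2 * M := by
    have h1 := Nat.div_mul_le_self M N
    have : K * N ≤ 2 * M := by rw [hK]; nlinarith
    exact_mod_cast this
  set c : ℝ := (3072 * s * (D * (1 + Real.log p))) ^ 3 / R * (1 + Real.log p) with hc
  have hc0 : 0 ≤ c := by positivity
  set Xj : ℕ → Finset ℤ := fun j => Icc (L + (j * N : ℕ) + 1) (L + (j * N : ℕ) + (min N (M - j * N) : ℕ)) with hXj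
  set Bi : ℕ → Finset (ZMod p) := fun i => B.filter (fun b => g b = i) with hBi
  have hsp : ∀ a, SS p s B (Icc (L + 1) (L + M)) a = ∑ q ∈ range K ×ˢ range K, SS p s (Bi q.1) (Xj q.2) a := by
    intro a
    rw [sum_product, SS, ← sum_fiberwise_of_maps_to (t := range K) (g := g) (fun b hb => mem_range.mpr (hg1 b hb))]
    apply sum_congr rfl
    intro i _
    simp only [SS]
    conv_rhs => rw [sum_comm]
    apply sum_congr rfl
    intro m _
    have := split_int L M N K (fun x => ee p (a * (m * ((x : ZMod p) ^ s)⁻¹)))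
    rw [min_eq_left hKM] at this
    exact this
  have hpc : ∀ i j, ∑ a ∈ univ.erase (0 : ZMod p), ‖SS p s (Bi i) (Xj j) a‖ ^ 6 ≤ N ^ 12 * c := by
    intro i j
    have := piece par s hs (Bi i) (hg2 i) (L + (j * N : ℕ)) (min N (M - j * N)) (min_le_left _ _) (by
      intro x hx
      apply hX
      rw [mem_Icc] at hx ⊢
      generalize j * N = q at hx
      omega)
    refine this.trans (le_of_eq ?_)
    rw [hc]; ring
  calc _ ≤ ∑ a ∈ univ.erase (0 : ZMod p), (K * K : ℝ) ^ 5 * ∑ q ∈ range K ×ˢ range K, ‖SS p s (Bi q.1) (Xj q.2) a‖ ^ 6 := by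
        apply sum_le_sum
        intro a _
        rw [hsp]
        calc _ ≤ (∑ q ∈ range K ×ˢ range K, ‖SS p s (Bi q.1) (Xj q.2) a‖) ^ 6 := by
              gcongr
              exact norm_sum_le _ _
          _ ≤ _ := by
              have := pow_sum_le_card_mul_sum_pow (s := range K ×ˢ range K) (f := fun q => ‖SS p s (Bi q.1) (Xj q.2) a‖) (fun _ _ => norm_nonneg _) 5
              simpa using this
    _ = (K * K : ℝ) ^ 5 * ∑ q ∈ range K ×ˢ range K, ∑ a ∈ univ.erase (0 : ZMod p), ‖SS p s (Bi q.1) (Xj q.2) a‖ ^ 6 := by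
        rw [← mul_sum, sum_comm]
    _ ≤ (K * K : ℝ) ^ 5 * ∑ q ∈ range K ×ˢ range K, (N ^ 12 * c) := by
        gcongr with q _
        exact hpc q.1 q.2
    _ = (K * N : ℝ) ^ 12 * c := by
        rw [sum_const, nsmul_eq_mul, card_product, card_range]; push_cast; ring
    _ ≤ (2 * M : ℝ) ^ 12 * c := by gcongr
    _ = _ := by ring

lemma circle {p : ℕ} [Fact p.Prime] (s : ℕ) (M : ℕ) (𝓜 : Fin 6 → Finset (ZMod p)) (h𝓜 : ∀ i, (𝓜 i).card = M)
    (L : Fin 6 → ℤ) (lam : ℤ) (V : ℝ)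
    (hV : ∀ i, ∑ a ∈ univ.erase (0 : ZMod p), ‖SS p s (𝓜 i) (Icc (L i + 1) (L i + (M:ℤ))) a‖ ^ 6 ≤ V) :
    |(((Fintype.piFinset (fun i : Fin 6 => (𝓜 i) ×ˢ Icc (L i + 1) (L i + (M:ℤ)))).filter
      (fun t => ∑ i, (t i).1 * ((((t i).2 : ZMod p)) ^ s)⁻¹ = (lam : ZMod p))).card : ℝ)
      - (M:ℝ) ^ 6 * (M:ℝ) ^ 6 / p| ≤ 6 * V / p := by
  classical
  have hp0 : (0:ℝ) < p := by exact_mod_cast (Fact.out : p.Prime).pos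
  set Pi := Fintype.piFinset (fun i : Fin 6 => (𝓜 i) ×ˢ Icc (L i + 1) (L i + (M:ℤ))) with hPi
  set T := (Pi.filter (fun t => ∑ i, (t i).1 * ((((t i).2 : ZMod p)) ^ s)⁻¹ = (lam : ZMod p))).card with hT
  set S : Fin 6 → ZMod p → ℂ := fun i a => SS p s (𝓜 i) (Icc (L i + 1) (L i + (M:ℤ))) a with hS
  have h1 : (p : ℂ) * T = ∑ a : ZMod p, ee p (a * (-lam)) * ∏ i, S i a := by
    have e1 : ∀ a, ee p (a * (-lam)) * ∏ i, S i a = ∑ t ∈ Pi, ee p (a * (∑ i, (t i).1 * ((((t i).2 : ZMod p)) ^ s)⁻¹ - lam)) := by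
      intro a
      have : ∀ i, S i a = ∑ y ∈ (𝓜 i) ×ˢ Icc (L i + 1) (L i + (M:ℤ)), ee p (a * (y.1 * ((y.2 : ZMod p) ^ s)⁻¹)) := by
        intro i
        rw [sum_product]; rfl
      simp only [this]
      rw [prod_univ_sum, mul_sum]
      apply sum_congr rfl
      intro t _
      rw [sub_eq_add_neg, add_comm, mul_add, ee_add, mul_sum, ee_sum]
    simp only [e1]
    rw [sum_comm]
    simp only [ee_orth, sub_eq_zero]
    rw [← sum_filter, sum_const, nsmul_eq_mul, mul_comm]
  have h0 : ee p ((0 : ZMod p) * (-lam)) * ∏ i, S i 0 = (M:ℂ) ^ 12 := by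
    have e0 : ee p 0 = 1 := by unfold ee; simp
    have : ∀ i, S i 0 = (M:ℂ) * M := by
      intro i
      simp only [hS, SS, zero_mul, e0]
      simp [h𝓜]
    simp only [this, zero_mul, e0, one_mul]
    simp; ring
  have h2 : (p : ℂ) * T - (M:ℂ) ^ 12 = ∑ a ∈ univ.erase (0 : ZMod p), ee p (a * (-lam)) * ∏ i, S i a := by
    rw [h1, ← h0, ← add_sum_erase univ _ (mem_univ (0 : ZMod p))]
    ring
  have amgm : ∀ x : Fin 6 → ℝ, (∀ i, 0 ≤ x i) → ∏ i, x i ≤ ∑ i, x i ^ 6 := by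
    intro x hx
    obtain ⟨j, _, hj⟩ := exists_max_image (univ : Finset (Fin 6)) x ⟨0, mem_univ _⟩
    calc ∏ i, x i ≤ ∏ i : Fin 6, x j := prod_le_prod (fun i _ => hx i) (fun i hi => hj i hi)
      _ = x j ^ 6 := by simp
      _ ≤ _ := single_le_sum (f := fun i => x i ^ 6) (fun i _ => pow_nonneg (hx i) 6) (mem_univ j)
  have h3 : |(p:ℝ) * T - (M:ℝ) ^ 12| ≤ 6 * V := by
    calc |(p:ℝ) * T - (M:ℝ) ^ 12| = ‖(p : ℂ) * T - (M:ℂ) ^ 12‖ := by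
          rw [← Real.norm_eq_abs, ← Complex.norm_real]; push_cast; rfl
      _ ≤ ∑ a ∈ univ.erase (0 : ZMod p), ∑ i, ‖S i a‖ ^ 6 := by
          rw [h2]
          refine norm_sum_le_of_le _ ?_
          intro a _
          rw [norm_mul, ee_norm, one_mul, norm_prod]
          exact amgm _ (fun i => norm_nonneg _)
      _ = ∑ i, ∑ a ∈ univ.erase (0 : ZMod p), ‖S i a‖ ^ 6 := sum_comm
      _ ≤ ∑ i : Fin 6, V := sum_le_sum (fun i _ => hV i)
      _ = 6 * V := by simp
  have : (T:ℝ) - (M:ℝ) ^ 6 * (M:ℝ) ^ 6 / p = ((p:ℝ) * T - (M:ℝ) ^ 12) / p := by field_simp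
  rw [this, abs_div, abs_of_pos hp0]
  gcongr

end W17
open Finset
namespace W17

lemma half_floor (x : ℝ) (hx : 1 ≤ x) : x ≤ 2 * (⌊x⌋₊ : ℝ) := by
  have h1 := Nat.lt_floor_add_one x
  have h2 : 1 ≤ ⌊x⌋₊ := Nat.one_le_floor_iff x |>.mpr hx
  have h3 : (1:ℝ) ≤ (⌊x⌋₊ : ℝ) := by exact_mod_cast h2
  linarith

lemma mkPar (C : ℝ) (hC : 1 ≤ C)
    (hdiv : ∀ n : ℕ, n ≠ 0 → (n.divisors.card : ℝ) ≤ C * (n : ℝ) ^ ((1:ℝ) / 5880))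
    (p : ℕ) (hp : 2 ^ 35 ≤ p) (E : ℝ) (hE : E = (p:ℝ) ^ ((1:ℝ) / 5880)) :
    Par p ⌊E ^ 2856⌋₊ ⌊E ^ 672⌋₊ ⌈E ^ 2016⌉₊ ⌈16 * C ^ 4 * E ^ 8⌉₊ (E ^ 168) (E ^ 56) (E ^ 735) := by
  have hp0 : (0:ℝ) ≤ p := Nat.cast_nonneg p
  have hpE : (p:ℝ) = E ^ 5880 := by
    rw [hE, ← Real.rpow_natCast, ← Real.rpow_mul hp0]; norm_num
  have hE0 : 0 ≤ E := by rw [hE]; positivity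
  have hpR : (2:ℝ) ^ 35 ≤ p := by exact_mod_cast hp
  have hP2 : 2 ≤ E ^ 168 := by
    by_contra! h
    have h1 : (E ^ 168) ^ 35 < 2 ^ 35 := pow_lt_pow_left₀ h (pow_nonneg hE0 _) (by norm_num)
    have h2 : (E ^ 168) ^ 35 = (p:ℝ) := by rw [hpE, ← pow_mul]
    linarith
  have hE1 : 1 ≤ E := by
    by_contra! h
    have := pow_le_one₀ (n := 168) hE0 h.le
    linarith
  have hEpos : 0 < E := by linarith
  have hpw : ∀ k : ℕ, 1 ≤ E ^ k := fun k => one_le_pow₀ hE1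
  have hN1 : ((⌊E ^ 2856⌋₊ : ℕ) : ℝ) ≤ E ^ 2856 := Nat.floor_le (by positivity)
  have hY1 : ((⌊E ^ 672⌋₊ : ℕ) : ℝ) ≤ E ^ 672 := Nat.floor_le (by positivity)
  have hNp : 2 * ⌊E ^ 2856⌋₊ ^ 2 ≤ p := by
    have : (2:ℝ) * (⌊E ^ 2856⌋₊ : ℝ) ^ 2 ≤ p := by
      calc (2:ℝ) * (⌊E ^ 2856⌋₊ : ℝ) ^ 2 ≤ E ^ 168 * (E ^ 2856) ^ 2 := by gcongr
        _ = (p:ℝ) := by rw [hpE]; ring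
    exact_mod_cast this
  have hZ := Nat.ceil_lt_add_one (a := E ^ 2016) (by positivity)
  have hZ1 : ((⌈E ^ 2016⌉₊ : ℕ) : ℝ) ≤ 2 * E ^ 2016 := by
    have := hpw 2016
    linarith
  refine ⟨?_, ?_, ?_, ?_, ?_, ?_, ?_, ?_, ?_, ?_, ?_, ?_, ?_, ?_, ?_, ?_, ?_, ?_, ?_⟩
  · have : 3 < 2 ^ 35 := by norm_num
    omega
  · exact hpw 168
  · rw [hpE]; ring
  · ring
  · positivity
  · positivity
  · rw [hpE]; ring
  · rw [← pow_mul]; exact hN1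
  · rw [← pow_mul]; exact half_floor _ (hpw _)
  · rw [← pow_mul]; exact hY1
  · rw [← pow_mul]; exact half_floor _ (hpw _)
  · rw [← pow_mul]; exact hZ1
  · have : (p:ℝ) ≤ (⌈E ^ 2016⌉₊ : ℝ) ^ 3 := by
      calc (p:ℝ) = E ^ 5880 := hpE
        _ ≤ E ^ 6048 := pow_le_pow_right₀ hE1 (by norm_num)
        _ = (E ^ 2016) ^ 3 := by ring
        _ ≤ _ := by gcongr; exact Nat.le_ceil _
    exact_mod_cast this
  · have : (⌈E ^ 2016⌉₊ : ℝ) < p := by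
      calc (⌈E ^ 2016⌉₊ : ℝ) ≤ 2 * E ^ 2016 := hZ1
        _ < (2 * 2) * E ^ 2016 := by
            have := hpw 2016
            linarith
        _ ≤ (E ^ 168 * E ^ 168) * E ^ 2016 := by gcongr
        _ = E ^ 2352 := by ring
        _ ≤ E ^ 5880 := pow_le_pow_right₀ hE1 (by norm_num)
        _ = p := hpE.symm
    exact_mod_cast this
  · exact Nat.floor_le_floor (pow_le_pow_right₀ hE1 (by norm_num))
  · exact (Nat.one_le_floor_iff _).mpr (hpw _)
  · exact hNp
  · rw [Nat.one_le_ceil_iff]; positivity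
  · intro n hn hnN
    have h1 : (n:ℝ) ≤ (p:ℝ) ^ 2 := by
      have : n ≤ p ^ 2 := by
        refine hnN.trans ?_
        generalize ⌊E ^ 2856⌋₊ = q at hNp
        calc _ = (q ^ 2) ^ 2 := by ring
          _ ≤ p ^ 2 := Nat.pow_le_pow_left (by omega) 2
      exact_mod_cast this
    have h2 : (n:ℝ) ^ ((1:ℝ) / 5880) ≤ E ^ 2 := by
      calc (n:ℝ) ^ ((1:ℝ) / 5880) ≤ ((p:ℝ) ^ 2) ^ ((1:ℝ) / 5880) :=
            Real.rpow_le_rpow (Nat.cast_nonneg n) h1 (by norm_num)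
        _ = E ^ 2 := by
            rw [hE, ← Real.rpow_natCast, ← Real.rpow_natCast, ← Real.rpow_mul hp0, ← Real.rpow_mul hp0, mul_comm]
    have h3 : ((2 * (n.divisors.card : ℝ)) ^ 4) ≤ (⌈16 * C ^ 4 * E ^ 8⌉₊ : ℝ) := by
      calc ((2 * (n.divisors.card : ℝ)) ^ 4) ≤ (2 * (C * E ^ 2)) ^ 4 := by
            have h4 : (n.divisors.card : ℝ) ≤ C * E ^ 2 :=
              (hdiv n hn).trans (mul_le_mul_of_nonneg_left h2 (by linarith))
            have h5 : (0:ℝ) ≤ (n.divisors.card : ℝ) := Nat.cast_nonneg _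
            exact pow_le_pow_left₀ (by linarith) (by linarith) 4
        _ = 16 * C ^ 4 * E ^ 8 := by ring
        _ ≤ _ := Nat.le_ceil _
    exact_mod_cast h3

lemma Vbound (C : ℝ) (hC : 1 ≤ C) (p : ℕ) (hp : 1 ≤ p) (E : ℝ) (hE : E = (p:ℝ) ^ ((1:ℝ) / 5880))
    (s M : ℕ) :
    4096 * (M:ℝ) ^ 12 * ((3072 * s * ((⌈16 * C ^ 4 * E ^ 8⌉₊ : ℕ) * (1 + Real.log p))) ^ 3 / E ^ 56 * (1 + Real.log p))
      ≤ (4096 * (3072 * s * (32 * C ^ 4 * 5881)) ^ 3 * 5881) * M ^ 12 * (p:ℝ) ^ (-((1:ℝ) / 210)) := by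
  have hp0 : (0:ℝ) ≤ p := Nat.cast_nonneg p
  have hpE : (p:ℝ) = E ^ 5880 := by
    rw [hE, ← Real.rpow_natCast, ← Real.rpow_mul hp0]; norm_num
  have hE1 : 1 ≤ E := by
    rw [hE]; exact Real.one_le_rpow (by exact_mod_cast hp) (by norm_num)
  have hEpos : 0 < E := by linarith
  have hl : 1 + Real.log p ≤ 5881 * E := by
    rw [hpE, Real.log_pow]
    have := Real.log_le_sub_one_of_pos hEpos
    push_cast
    linarith
  have hl0 : 0 ≤ Real.log p := Real.log_natCast_nonneg p
  have hD : ((⌈16 * C ^ 4 * E ^ 8⌉₊ : ℕ) : ℝ) ≤ 32 * C ^ 4 * E ^ 8 := by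
    have h1 := Nat.ceil_lt_add_one (a := 16 * C ^ 4 * E ^ 8) (by positivity)
    have h2 : 1 ≤ C ^ 4 * E ^ 8 := one_le_mul_of_one_le_of_one_le (one_le_pow₀ hC) (one_le_pow₀ hE1)
    linarith
  have hpd : (p:ℝ) ^ (-((1:ℝ) / 210)) = (E ^ 28)⁻¹ := by
    rw [Real.rpow_neg hp0, hE, ← Real.rpow_natCast, ← Real.rpow_mul hp0]; norm_num
  rw [hpd]
  calc _ ≤ 4096 * (M:ℝ) ^ 12 * ((3072 * s * (32 * C ^ 4 * E ^ 8 * (5881 * E))) ^ 3 / E ^ 56 * (5881 * E)) := by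
        gcongr
    _ = _ := by field_simp

lemma small_case {p : ℕ} [Fact p.Prime] (hp : p < 2 ^ 35) (s M : ℕ) (𝓜 : Fin 6 → Finset (ZMod p)) (h𝓜 : ∀ i, (𝓜 i).card = M)
    (L : Fin 6 → ℤ) (lam : ℤ) :
    |(((Fintype.piFinset (fun i : Fin 6 => (𝓜 i) ×ˢ Icc (L i + 1) (L i + (M:ℤ)))).filter
      (fun t => ∑ i, (t i).1 * ((((t i).2 : ZMod p)) ^ s)⁻¹ = (lam : ZMod p))).card : ℝ)
      - (M:ℝ) ^ 6 * (M:ℝ) ^ 6 / p| ≤ 2 ^ 70 * ((M:ℝ) ^ 6 * (M:ℝ) ^ 6 / p) * (p:ℝ) ^ (-((1:ℝ) / 210)) := by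
  have hp1 : 1 ≤ p := (Fact.out : p.Prime).one_lt.le
  have hpR : (1:ℝ) ≤ p := by exact_mod_cast hp1
  have hpu : (p:ℝ) ≤ 2 ^ 35 := by exact_mod_cast hp.le
  have hp0 : (0:ℝ) < p := by linarith
  have hT : (((Fintype.piFinset (fun i : Fin 6 => (𝓜 i) ×ˢ Icc (L i + 1) (L i + (M:ℤ)))).filter
      (fun t => ∑ i, (t i).1 * ((((t i).2 : ZMod p)) ^ s)⁻¹ = (lam : ZMod p))).card : ℝ) ≤ (M:ℝ) ^ 6 * (M:ℝ) ^ 6 := by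
    have : ((Fintype.piFinset (fun i : Fin 6 => (𝓜 i) ×ˢ Icc (L i + 1) (L i + (M:ℤ)))).filter
      (fun t => ∑ i, (t i).1 * ((((t i).2 : ZMod p)) ^ s)⁻¹ = (lam : ZMod p))).card ≤ M ^ 6 * M ^ 6 := by
      refine (card_filter_le _ _).trans (le_of_eq ?_)
      rw [Fintype.card_piFinset]
      simp [card_product, h𝓜, mul_pow]
    exact_mod_cast this
  have hT0 : (0:ℝ) ≤ (((Fintype.piFinset (fun i : Fin 6 => (𝓜 i) ×ˢ Icc (L i + 1) (L i + (M:ℤ)))).filter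
      (fun t => ∑ i, (t i).1 * ((((t i).2 : ZMod p)) ^ s)⁻¹ = (lam : ZMod p))).card : ℝ) := Nat.cast_nonneg _
  generalize (((Fintype.piFinset (fun i : Fin 6 => (𝓜 i) ×ˢ Icc (L i + 1) (L i + (M:ℤ)))).filter
      (fun t => ∑ i, (t i).1 * ((((t i).2 : ZMod p)) ^ s)⁻¹ = (lam : ZMod p))).card : ℝ) = T at hT hT0
  have hm0 : 0 ≤ (M:ℝ) ^ 6 * (M:ℝ) ^ 6 := by positivity
  generalize (M:ℝ) ^ 6 * (M:ℝ) ^ 6 = m at hT hm0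
  have h1 : |T - m / p| ≤ m := by
    have h2 : m / p ≤ m := div_le_self hm0 hpR
    have h3 : 0 ≤ m / p := by positivity
    rw [abs_le]; constructor <;> linarith
  refine h1.trans ?_
  have h4 : (p:ℝ)⁻¹ ≤ (p:ℝ) ^ (-((1:ℝ) / 210)) := by
    rw [← Real.rpow_neg_one]
    exact Real.rpow_le_rpow_of_exponent_le hpR (by norm_num)
  calc m = m * 1 := by ring
    _ ≤ m * (2 ^ 70 / (p:ℝ) ^ 2) := by
        gcongr
        rw [one_le_div (by positivity)]
        calc (p:ℝ) ^ 2 ≤ (2 ^ 35) ^ 2 := by gcongr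
          _ = 2 ^ 70 := by norm_num
    _ = 2 ^ 70 * (m / p) * (p:ℝ)⁻¹ := by field_simp
    _ ≤ _ := by gcongr

end W17

/-- Corollary of Theorem 1.3: the asymptotic formula for T₆(λ) holds when
H = M > p^{17/35+ε}. -/
theorem stmt_3 (s : ℕ) (hs : 0 < s) (ε : ℝ) (hε : 0 < ε) :
    ∃ δ C : ℝ, 0 < δ ∧ 0 < C ∧
      ∀ (p : ℕ), p.Prime → ∀ (M : ℕ),
      (p : ℝ) ^ ((17:ℝ)/35 + ε) < (M : ℝ) →
      ∀ (𝓜 : Fin 6 → Finset (ZMod p)), (∀ i, (𝓜 i).card = M) →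
      (∀ i, ∀ m ∈ 𝓜 i, m ≠ 0) →
      ∀ (L : Fin 6 → ℤ),
      (∀ i, ∀ x ∈ Finset.Icc (L i + 1) (L i + (M : ℤ)), 1 ≤ x ∧ x ≤ (p : ℤ) - 1) →
      ∀ lam : ℤ,
      |(((Fintype.piFinset
              (fun i : Fin 6 => (𝓜 i) ×ˢ Finset.Icc (L i + 1) (L i + (M : ℤ)))).filter
            (fun t => ∑ i, (t i).1 * ((((t i).2 : ZMod p)) ^ s)⁻¹ = (lam : ZMod p))).card : ℝ)
          - (M : ℝ) ^ 6 * (M : ℝ) ^ 6 / (p : ℝ)| ≤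
        C * ((M : ℝ) ^ 6 * (M : ℝ) ^ 6 / (p : ℝ)) * (p : ℝ) ^ (-δ) := by
  obtain ⟨C, hC, hdiv⟩ := W17.divisor_bound ((1:ℝ) / 5880) (by norm_num)
  refine ⟨(1:ℝ) / 210, 2 ^ 70 + 6 * (4096 * (3072 * s * (32 * C ^ 4 * 5881)) ^ 3 * 5881), by norm_num,
    by positivity, ?_⟩
  intro p hp M hM 𝓜 h𝓜 _ L hL lam
  haveI : Fact p.Prime := ⟨hp⟩
  have hp1 : (1:ℝ) ≤ p := by exact_mod_cast hp.one_lt.le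
  have hK0 : 0 ≤ 6 * (4096 * (3072 * (s:ℝ) * (32 * C ^ 4 * 5881)) ^ 3 * 5881) := by positivity
  rcases lt_or_ge p (2 ^ 35) with hlt | hge
  · refine (W17.small_case hlt s M 𝓜 h𝓜 L lam).trans ?_
    gcongr
    linarith
  · have par := W17.mkPar C hC hdiv p hge _ rfl
    have hMN : ⌊((p:ℝ) ^ ((1:ℝ) / 5880)) ^ 2856⌋₊ ≤ M := by
      have h1 : ((⌊((p:ℝ) ^ ((1:ℝ) / 5880)) ^ 2856⌋₊ : ℕ) : ℝ) ≤ M := by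
        calc _ ≤ ((p:ℝ) ^ ((1:ℝ) / 5880)) ^ 2856 := Nat.floor_le (by positivity)
          _ = (p:ℝ) ^ ((17:ℝ) / 35) := by
              rw [← Real.rpow_natCast, ← Real.rpow_mul (by positivity)]; norm_num
          _ ≤ (p:ℝ) ^ ((17:ℝ) / 35 + ε) := Real.rpow_le_rpow_of_exponent_le hp1 (by linarith)
          _ ≤ M := hM.le
      exact_mod_cast h1
    refine (W17.circle s M 𝓜 h𝓜 L lam _ (fun i =>
      (W17.full par s hs (𝓜 i) (L i) M (h𝓜 i) hMN (hL i)).trans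
        (W17.Vbound C hC p hp.one_lt.le _ rfl s M))).trans ?_
    set K : ℝ := 4096 * (3072 * (s:ℝ) * (32 * C ^ 4 * 5881)) ^ 3 * 5881
    calc 6 * (K * (M:ℝ) ^ 12 * (p:ℝ) ^ (-((1:ℝ) / 210))) / p
        = (6 * K) * ((M:ℝ) ^ 6 * (M:ℝ) ^ 6 / (p:ℝ)) * (p:ℝ) ^ (-((1:ℝ) / 210)) := by ring
      _ ≤ _ := by
          gcongr
          linarith
end

section
/- For every real ε > 0 there exists C > 0, depending only on ε, with the following property. Let p be a prime, let H be an integer with 1 ≤ H ≤ p, let 𝓜 ⊆ 𝔽_p^* be a set of cardinality M, and let J(𝓗, 𝓜) denote the number of quadruples (h_1, h_2, m_1, m_2) with h_1, h_2 ∈ {1, …, H} and m_1, m_2 ∈ 𝓜 satisfying h_1·m_1 ≡ h_2·m_2 (mod p). Then: (i) if H ≥ p^{2/3}, then J(𝓗, 𝓜) ≤ C·(H^2·M^2/p + H·M·p^{ε}); (ii) if H < p^{2/3} and M ≥ p^{1/3}, then J(𝓗, 𝓜) ≤ C·(H^2·M^2/p + H·M^{7/4}·p^{−1/4+ε} + M^2);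 (iii) if H < p^{2/3} and M < p^{1/3}, then J(𝓗, 𝓜) ≤ C·(H·M·p^{ε} + M^2). -/
open Finset

theorem divisor_bound (ε : ℝ) (hε : 0 < ε) : ∃ C : ℝ, 1 ≤ C ∧ ∀ n : ℕ, n ≠ 0 →
    ((n.divisors.card : ℕ) : ℝ) ≤ C * (n : ℝ) ^ ε := by
  obtain ⟨Q, hQ⟩ := exists_nat_ge ((2 : ℝ) ^ (1 / ε))
  have hl2 : 0 < Real.log 2 := Real.log_pos (by norm_num)
  set K : ℝ := 1 + 1 / (ε * Real.log 2) with hK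
  have hK1 : 1 ≤ K := by
    rw [hK]
    have : 0 < 1 / (ε * Real.log 2) := by positivity
    linarith
  refine ⟨K ^ Q, one_le_pow₀ hK1, fun n hn => ?_⟩
  have key : ∀ q ∈ n.primeFactors, ((n.factorization q + 1 : ℕ) : ℝ) ≤
      (if q < Q then K else 1) * ((q : ℝ) ^ (n.factorization q)) ^ ε := by
    intro q hq
    have hq2 : 2 ≤ q := (Nat.prime_of_mem_primeFactors hq).two_le
    have hq2' : (2 : ℝ) ≤ q := by exact_mod_cast hq2
    set a := n.factorization q
    have hcomm : ((q : ℝ) ^ a) ^ ε = ((q : ℝ) ^ ε) ^ a := by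
      rw [← Real.rpow_natCast, ← Real.rpow_natCast, ← Real.rpow_mul (by positivity),
        ← Real.rpow_mul (by positivity), mul_comm]
    rw [hcomm]
    split_ifs with h
    · have h1 : ((2 : ℝ) ^ ε) ^ a ≤ ((q : ℝ) ^ ε) ^ a := by gcongr
      have h2 : 1 + (a : ℝ) * (ε * Real.log 2) ≤ ((2 : ℝ) ^ ε) ^ a := by
        rw [← Real.rpow_natCast, ← Real.rpow_mul (by norm_num), Real.rpow_def_of_pos (by norm_num)]
        have := Real.add_one_le_exp (Real.log 2 * (ε * a))
        nlinarith
      calc ((a + 1 : ℕ) : ℝ) ≤ K * (1 + (a : ℝ) * (ε * Real.log 2)) := by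
            rw [hK]
            have hz : 0 < ε * Real.log 2 := by positivity
            have : (1 + 1 / (ε * Real.log 2)) * (1 + (a : ℝ) * (ε * Real.log 2)) =
              1 + (a : ℝ) * (ε * Real.log 2) + 1 / (ε * Real.log 2) + a := by
              field_simp
              ring
            rw [this]
            have h3 : 0 < 1 / (ε * Real.log 2) := by positivity
            have h4 : 0 ≤ (a : ℝ) * (ε * Real.log 2) := by positivity
            push_cast
            linarith
        _ ≤ _ := by gcongr; exact h2.trans h1
    · rw [one_mul]
      have h1 : (2 : ℝ) ≤ (q : ℝ) ^ ε := by
        have : (2 : ℝ) ^ (1 / ε) ≤ q := hQ.trans (by exact_mod_cast not_lt.mp h)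
        calc (2 : ℝ) = ((2 : ℝ) ^ (1 / ε)) ^ ε := by
              rw [← Real.rpow_mul (by norm_num)]
              field_simp
              norm_num
          _ ≤ _ := by gcongr
      have h2 : (2 : ℝ) ^ a ≤ ((q : ℝ) ^ ε) ^ a := by gcongr
      have h3 : a + 1 ≤ 2 ^ a := Nat.lt_two_pow_self
      have h4 : ((a + 1 : ℕ) : ℝ) ≤ (2 : ℝ) ^ a := by exact_mod_cast h3
      linarith
  rw [Nat.card_divisors hn]
  push_cast
  have hn' : (n : ℝ) = ∏ q ∈ n.primeFactors, (q : ℝ) ^ (n.factorization q) := by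
    conv_lhs => rw [← Nat.prod_factorization_pow_eq_self hn]
    rw [Nat.prod_factorization_eq_prod_primeFactors]
    push_cast
    rfl
  have h5 : (∏ q ∈ n.primeFactors, (if q < Q then K else 1)) ≤ K ^ Q := by
    rw [Finset.prod_ite, Finset.prod_const, Finset.prod_const_one, mul_one]
    apply pow_le_pow_right₀ hK1
    calc _ ≤ (Finset.range Q).card := Finset.card_le_card (by intro x; simp)
      _ = Q := Finset.card_range Q
  calc ∏ q ∈ n.primeFactors, ((n.factorization q : ℝ) + 1)
      ≤ ∏ q ∈ n.primeFactors, ((if q < Q then K else 1) * ((q : ℝ) ^ (n.factorization q)) ^ ε) := by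
        apply Finset.prod_le_prod
        · intros; positivity
        · intro q hq
          have := key q hq
          push_cast at this
          exact this
    _ = (∏ q ∈ n.primeFactors, (if q < Q then K else 1)) * (n : ℝ) ^ ε := by
        rw [Finset.prod_mul_distrib, Real.finsetProd_rpow _ _ (by intros; positivity), ← hn']
    _ ≤ _ := by gcongr

theorem lattice_core (p d E : ℕ) (hp : 0 < p) (u v : ℤ) (T : Finset (ℤ × ℤ))
    (hd : 0 < d) (hdE : d ≤ E) (hu : |u| = d) (hv : |v| ≤ d)
    (hT : ∀ a ∈ T, |a.1| ≤ E ∧ |a.2| ≤ E)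
    (hdiv : ∀ a ∈ T, (p : ℤ) ∣ a.1 * v - a.2 * u)
    (hsep : ∀ a ∈ T, ∀ b ∈ T, |a.1 - b.1| < d → |a.2 - b.2| < d → a = b) :
    (T.card : ℝ) ≤ 16 * (E : ℝ) ^ 2 / p + 4 * E / d := by
  classical
  set K : ℕ := 2 * E * d / p with hK
  have hd' : (0 : ℤ) < d := by exact_mod_cast hd
  have hp' : (0 : ℤ) < p := by exact_mod_cast hp
  have hcard : T.card ≤ ((Finset.Icc (-(K : ℤ)) K) ×ˢ
      (Finset.Icc (-((E / d : ℕ) : ℤ) - 1) ((E / d : ℕ) : ℤ))).card := by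
    apply Finset.card_le_card_of_injOn (fun a : ℤ × ℤ => ((a.1 * v - a.2 * u) / (p : ℤ), a.1 / (d : ℤ)))
    · intro a ha
      obtain ⟨h1, h2⟩ := hT a ha
      obtain ⟨k, hk⟩ := hdiv a ha
      have hbd : |a.1 * v - a.2 * u| ≤ 2 * E * d := by
        calc |a.1 * v - a.2 * u| ≤ |a.1 * v| + |a.2 * u| := abs_sub _ _
          _ = |a.1| * |v| + |a.2| * |u| := by rw [abs_mul, abs_mul]
          _ ≤ E * d + E * d := by rw [hu]; gcongr
          _ = _ := by ring
      simp only [Finset.coe_product, Set.mem_prod, Finset.coe_Icc, Set.mem_Icc]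
      have hKc : (K : ℤ) = (2 * E * d : ℤ) / p := by rw [hK]; push_cast; rfl
      have hEc : ((E / d : ℕ) : ℤ) = (E : ℤ) / d := by push_cast; rfl
      rw [abs_le] at h1
      rw [hk, Int.mul_ediv_cancel_left _ hp'.ne', hKc, hEc]
      rw [hk, abs_mul, abs_of_pos hp'] at hbd
      have : |k| ≤ (2 * E * d : ℤ) / p := by
        rw [Int.le_ediv_iff_mul_le hp']; linarith
      refine ⟨abs_le.mp this, ?_, Int.ediv_le_ediv hd' h1.2⟩
      rw [Int.le_ediv_iff_mul_le hd']
      have := Int.lt_ediv_add_one_mul_self (E : ℤ) hd'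
      nlinarith [h1.1]
    · intro a ha b hb hab
      simp only [Prod.mk.injEq] at hab
      obtain ⟨h1, h2⟩ := hab
      have e1 := Int.mul_ediv_cancel' (hdiv a ha)
      have e2 := Int.mul_ediv_cancel' (hdiv b hb)
      rw [h1] at e1
      have e3 : (a.1 - b.1) * v = (a.2 - b.2) * u := by linarith
      have hx : |a.1 - b.1| < d := by
        have q1 := Int.emod_add_mul_ediv a.1 d
        have q2 := Int.emod_add_mul_ediv b.1 d
        have q3 := Int.emod_lt_of_pos a.1 hd'
        have q4 := Int.emod_lt_of_pos b.1 hd'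
        have q5 := Int.emod_nonneg a.1 hd'.ne'
        have q6 := Int.emod_nonneg b.1 hd'.ne'
        rw [h2] at q1
        rw [abs_lt]
        constructor <;> linarith
      apply hsep a ha b hb hx
      have e4 : |a.1 - b.1| * |v| = |a.2 - b.2| * d := by
        rw [← hu, ← abs_mul, ← abs_mul, e3]
      have : |a.2 - b.2| * d ≤ |a.1 - b.1| * d := by
        rw [← e4]; gcongr
      have := le_of_mul_le_mul_right this hd'
      linarith
  rw [Finset.card_product, Int.card_Icc, Int.card_Icc] at hcard
  have hc2 : T.card ≤ (2 * K + 1) * (2 * (E / d) + 2) := by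
    refine hcard.trans (le_of_eq ?_)
    congr 1
    · omega
    · generalize E / d = w
      omega
  have hKr : (K : ℝ) ≤ 2 * E * d / p := by
    rw [hK]; exact (Nat.cast_div_le).trans (by push_cast; rfl)
  have hEr : ((E / d : ℕ) : ℝ) ≤ (E : ℝ) / d := Nat.cast_div_le
  have hdr : (0 : ℝ) < d := by exact_mod_cast hd
  have hpr : (0 : ℝ) < p := by exact_mod_cast hp
  have h1 : (1 : ℝ) ≤ E / d := by
    rw [le_div_iff₀ hdr]; simpa using (by exact_mod_cast hdE : (d : ℝ) ≤ E)
  calc (T.card : ℝ) ≤ (2 * K + 1) * (2 * ((E / d : ℕ) : ℝ) + 2) := by exact_mod_cast hc2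
    _ ≤ (2 * (2 * E * d / p) + 1) * (4 * (E / d)) := by
        gcongr
        linarith
    _ = _ := by field_simp; ring

theorem lattice_core' (p d E : ℕ) (hp : 0 < p) (u v : ℤ) (T : Finset (ℤ × ℤ))
    (hd : 0 < d) (hdE : d ≤ E) (huv : (|u| = d ∧ |v| ≤ d) ∨ (|v| = d ∧ |u| ≤ d))
    (hT : ∀ a ∈ T, |a.1| ≤ E ∧ |a.2| ≤ E)
    (hdiv : ∀ a ∈ T, (p : ℤ) ∣ a.1 * v - a.2 * u)
    (hsep : ∀ a ∈ T, ∀ b ∈ T, |a.1 - b.1| < d → |a.2 - b.2| < d → a = b) :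
    (T.card : ℝ) ≤ 16 * (E : ℝ) ^ 2 / p + 4 * E / d := by
  rcases huv with h | h
  · exact lattice_core p d E hp u v T hd hdE h.1 h.2 hT hdiv hsep
  · have := lattice_core p d E hp v u (T.map (Equiv.prodComm ℤ ℤ).toEmbedding) hd hdE h.1 h.2
      (by
        intro a ha
        simp only [Finset.mem_map_equiv] at ha
        exact (hT _ ha).symm)
      (by
        intro a ha
        simp only [Finset.mem_map_equiv] at ha
        have := hdiv _ ha
        rw [← dvd_neg]
        simpa using this)
      (by
        intro a ha b hb h1 h2
        simp only [Finset.mem_map_equiv] at ha hb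
        exact (Equiv.prodComm ℤ ℤ).symm.injective (hsep _ ha _ hb h2 h1))
    simpa using this

/-- height of a residue: sup norm of the shortest nonzero vector of its lattice -/
noncomputable def resHt (p : ℕ) (l : ZMod p) : ℕ :=
  sInf {d : ℕ | ∃ u v : ℤ, (u ≠ 0 ∨ v ≠ 0) ∧ |u| ≤ d ∧ |v| ≤ d ∧ (u : ZMod p) = l * v}

theorem resHt_le (p : ℕ) (l : ZMod p) (d : ℕ) (u v : ℤ) (h : u ≠ 0 ∨ v ≠ 0) (hu : |u| ≤ d)
    (hv : |v| ≤ d) (he : (u : ZMod p) = l * v) : resHt p l ≤ d :=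
  Nat.sInf_le ⟨u, v, h, hu, hv, he⟩

theorem resHt_mem_aux (p : ℕ) (hp : p.Prime) (l : ZMod p) : ∃ u v : ℤ, (u ≠ 0 ∨ v ≠ 0) ∧
    |u| ≤ (p - 1 : ℕ) ∧ |v| ≤ (p - 1 : ℕ) ∧ (u : ZMod p) = l * v := by
  have := Fact.mk hp
  refine ⟨(l.val : ℤ), 1, Or.inr one_ne_zero, ?_, ?_, ?_⟩
  · have := ZMod.val_lt l
    rw [abs_of_nonneg (by positivity)]
    exact_mod_cast Nat.le_sub_one_of_lt this
  · have := hp.two_le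
    simp only [abs_one]
    omega
  · simp

theorem resHt_lt (p : ℕ) (hp : p.Prime) (l : ZMod p) : resHt p l < p := by
  obtain ⟨u, v, h, hu, hv, he⟩ := resHt_mem_aux p hp l
  have := resHt_le p l (p - 1) u v h hu hv he
  have := hp.two_le
  omega

theorem resHt_spec (p : ℕ) (hp : p.Prime) (l : ZMod p) : ∃ u v : ℤ, (u ≠ 0 ∨ v ≠ 0) ∧
    |u| ≤ resHt p l ∧ |v| ≤ resHt p l ∧ (u : ZMod p) = l * v := by
  have : resHt p l ∈ {d : ℕ | ∃ u v : ℤ, (u ≠ 0 ∨ v ≠ 0) ∧ |u| ≤ d ∧ |v| ≤ d ∧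
      (u : ZMod p) = l * v} := Nat.sInf_mem ⟨p - 1, resHt_mem_aux p hp l⟩
  exact this

theorem resHt_pos (p : ℕ) (hp : p.Prime) (l : ZMod p) : 0 < resHt p l := by
  obtain ⟨u, v, h, hu, hv, he⟩ := resHt_spec p hp l
  by_contra hc
  have h0 : resHt p l = 0 := by omega
  rw [h0] at hu hv
  have h1 : u = 0 := abs_nonpos_iff.mp (by simpa using hu)
  have h2 : v = 0 := abs_nonpos_iff.mp (by simpa using hv)
  rcases h with h | h <;> contradiction

/-- for nonzero residues the shortest vector has nonzero coordinates mod p -/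
theorem resHt_spec_ne (p : ℕ) (hp : p.Prime) (l : ZMod p) (hl : l ≠ 0) : ∃ u v : ℤ,
    (u : ZMod p) ≠ 0 ∧ (v : ZMod p) ≠ 0 ∧
    |u| ≤ resHt p l ∧ |v| ≤ resHt p l ∧ (u : ZMod p) = l * v := by
  have := Fact.mk hp
  obtain ⟨u, v, h, hu, hv, he⟩ := resHt_spec p hp l
  have hlt := resHt_lt p hp l
  have small : ∀ w : ℤ, |w| ≤ resHt p l → (w : ZMod p) = 0 → w = 0 := by
    intro w hw h0
    rw [ZMod.intCast_zmod_eq_zero_iff_dvd] at h0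
    apply Int.eq_zero_of_abs_lt_dvd h0
    have : (resHt p l : ℤ) < p := by exact_mod_cast hlt
    linarith
  have hv0 : (v : ZMod p) ≠ 0 := by
    intro h0
    have hu0 : (u : ZMod p) = 0 := by rw [he, h0, mul_zero]
    rcases h with h | h
    · exact h (small u hu hu0)
    · exact h (small v hv h0)
  exact ⟨u, v, by rw [he]; exact mul_ne_zero hl hv0, hv0, hu, hv, he⟩

/-- lattice points in a box -/
noncomputable def latSet (p : ℕ) (l : ZMod p) (E : ℕ) : Finset (ℤ × ℤ) := by
  classical
  exact ((Finset.Icc (-(E : ℤ)) E) ×ˢ (Finset.Icc (-(E : ℤ)) E)).filter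
    (fun a => (a.1 ≠ 0 ∨ a.2 ≠ 0) ∧ (a.1 : ZMod p) = l * a.2)

theorem mem_latSet (p : ℕ) (l : ZMod p) (E : ℕ) (a : ℤ × ℤ) : a ∈ latSet p l E ↔
    (|a.1| ≤ E ∧ |a.2| ≤ E) ∧ (a.1 ≠ 0 ∨ a.2 ≠ 0) ∧ (a.1 : ZMod p) = l * a.2 := by
  unfold latSet
  simp [abs_le]

theorem latSet_card (p : ℕ) (hp : p.Prime) (l : ZMod p) (E : ℕ) :
    ((latSet p l E).card : ℝ) ≤ 16 * (E : ℝ) ^ 2 / p + 4 * E / resHt p l := by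
  rcases lt_or_ge E (resHt p l) with h | h
  · have : latSet p l E = ∅ := by
      apply Finset.eq_empty_of_forall_notMem
      intro a ha
      rw [mem_latSet] at ha
      have := resHt_le p l E a.1 a.2 ha.2.1 ha.1.1 ha.1.2 ha.2.2
      omega
    rw [this]
    simp only [Finset.card_empty, Nat.cast_zero]
    positivity
  obtain ⟨u, v, h0, hu, hv, he⟩ := resHt_spec p hp l
  refine lattice_core' p (resHt p l) E hp.pos u v (latSet p l E) (resHt_pos p hp l) h ?_ ?_ ?_ ?_
  · by_contra hc
    have h1 : |u| < resHt p l := lt_of_le_of_ne hu (by tauto)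
    have h2 : |v| < resHt p l := lt_of_le_of_ne hv (by tauto)
    have hpos := resHt_pos p hp l
    have := resHt_le p l (resHt p l - 1) u v h0 (by omega) (by omega) he
    omega
  · intro a ha
    exact ((mem_latSet p l E a).mp ha).1
  · intro a ha
    rw [mem_latSet] at ha
    rw [← ZMod.intCast_zmod_eq_zero_iff_dvd]
    push_cast
    rw [ha.2.2, he]
    ring
  · intro a ha b hb h1 h2
    rw [mem_latSet] at ha hb
    by_contra hne
    have hpos := resHt_pos p hp l
    have := resHt_le p l (resHt p l - 1) (a.1 - b.1) (a.2 - b.2)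
      (by
        by_contra hc
        push Not at hc
        exact hne (Prod.ext (by linarith [hc.1]) (by linarith [hc.2])))
      (by omega) (by omega) (by push_cast; rw [ha.2.2, hb.2.2]; ring)
    omega

/-- number of pairs with quotient of small height -/
noncomputable def pairCount (p : ℕ) (M : Finset (ZMod p)) (D : ℕ) : ℕ :=
  ∑ m2 ∈ M, (M.filter (fun m1 => resHt p (m1 * m2⁻¹) ≤ D)).card

noncomputable def htSum (p : ℕ) (M : Finset (ZMod p)) : ℝ :=
  ∑ m1 ∈ M, ∑ m2 ∈ M, (1 : ℝ) / resHt p (m1 * m2⁻¹)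

theorem pairCount_le (p : ℕ) (M : Finset (ZMod p)) (D : ℕ) :
    pairCount p M D ≤ M.card ^ 2 := by
  unfold pairCount
  calc _ ≤ ∑ m2 ∈ M, M.card := Finset.sum_le_sum fun _ _ => Finset.card_filter_le _ _
    _ = _ := by rw [Finset.sum_const, smul_eq_mul, sq]

theorem fiber_bound (p : ℕ) (hp : p.Prime) (M : Finset (ZMod p)) (hM : ∀ m ∈ M, m ≠ 0)
    (D B : ℕ) (hB : ∀ n : ℕ, n ≠ 0 → n ≤ D ^ 2 → n.divisors.card ≤ B) (m1 m3 : ZMod p)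
    (h1 : m1 ∈ M) (h3 : m3 ∈ M) :
    (M.filter (fun m2 => resHt p (m1 * m2⁻¹) ≤ D ∧ resHt p (m3 * m2⁻¹) ≤ D)).card ≤
      4 * B ^ 2 * (latSet p (m1 * m3⁻¹) (D ^ 2)).card := by
  classical
  have := Fact.mk hp
  have hex : ∀ l : ZMod p, ∃ w : ℤ × ℤ, l ≠ 0 → (w.1 : ZMod p) ≠ 0 ∧ (w.2 : ZMod p) ≠ 0 ∧
    |w.1| ≤ resHt p l ∧ |w.2| ≤ resHt p l ∧ (w.1 : ZMod p) = l * w.2 := by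
    intro l
    by_cases hl : l = 0
    · exact ⟨0, fun h => absurd hl h⟩
    · obtain ⟨u, v, h⟩ := resHt_spec_ne p hp l hl
      exact ⟨(u, v), fun _ => h⟩
  choose W hW using hex
  have hm1 := hM m1 h1
  have hm3 := hM m3 h3
  set s := M.filter (fun m2 => resHt p (m1 * m2⁻¹) ≤ D ∧ resHt p (m3 * m2⁻¹) ≤ D) with hs
  have hprop : ∀ m2 ∈ s, m2 ≠ 0 ∧ (((W (m1 * m2⁻¹)).1 : ZMod p) ≠ 0 ∧
      ((W (m1 * m2⁻¹)).2 : ZMod p) ≠ 0 ∧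
      |(W (m1 * m2⁻¹)).1| ≤ D ∧ |(W (m1 * m2⁻¹)).2| ≤ D ∧
      ((W (m1 * m2⁻¹)).1 : ZMod p) = (m1 * m2⁻¹) * (W (m1 * m2⁻¹)).2) ∧
      (((W (m3 * m2⁻¹)).1 : ZMod p) ≠ 0 ∧ ((W (m3 * m2⁻¹)).2 : ZMod p) ≠ 0 ∧
      |(W (m3 * m2⁻¹)).1| ≤ D ∧ |(W (m3 * m2⁻¹)).2| ≤ D ∧
      ((W (m3 * m2⁻¹)).1 : ZMod p) = (m3 * m2⁻¹) * (W (m3 * m2⁻¹)).2) := by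
    intro m2 hm2
    rw [hs, Finset.mem_filter] at hm2
    have hm20 := hM m2 hm2.1
    have a := hW (m1 * m2⁻¹) (mul_ne_zero hm1 (inv_ne_zero hm20))
    have b := hW (m3 * m2⁻¹) (mul_ne_zero hm3 (inv_ne_zero hm20))
    have c1 : (resHt p (m1 * m2⁻¹) : ℤ) ≤ D := by exact_mod_cast hm2.2.1
    have c2 : (resHt p (m3 * m2⁻¹) : ℤ) ≤ D := by exact_mod_cast hm2.2.2
    exact ⟨hm20, ⟨a.1, a.2.1, a.2.2.1.trans c1, a.2.2.2.1.trans c1, a.2.2.2.2⟩,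
      ⟨b.1, b.2.1, b.2.2.1.trans c2, b.2.2.2.1.trans c2, b.2.2.2.2⟩⟩
  apply Finset.card_le_mul_card_image_of_maps_to
    (f := fun m2 => ((W (m1 * m2⁻¹)).1 * (W (m3 * m2⁻¹)).2, (W (m1 * m2⁻¹)).2 * (W (m3 * m2⁻¹)).1))
  · intro m2 hm2
    obtain ⟨h20, ⟨a1, a2, a3, a4, a5⟩, ⟨b1, b2, b3, b4, b5⟩⟩ := hprop m2 hm2
    rw [mem_latSet]
    refine ⟨⟨?_, ?_⟩, Or.inl ?_, ?_⟩
    · simp only [abs_mul]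
      push_cast
      rw [sq]
      gcongr
    · simp only [abs_mul]
      push_cast
      rw [sq]
      gcongr
    · intro h0
      simp only at h0
      have : (((W (m1 * m2⁻¹)).1 * (W (m3 * m2⁻¹)).2 : ℤ) : ZMod p) = 0 := by rw [h0]; simp
      push_cast at this
      exact mul_ne_zero a1 b2 this
    · push_cast
      rw [a5, b5]
      field_simp
  · rintro ⟨x, y⟩ hxy
    rw [mem_latSet] at hxy
    obtain ⟨⟨hx, hy⟩, -, -⟩ := hxy
    simp only at hx hy
    have hcard : ({m2 ∈ s | ((W (m1 * m2⁻¹)).1 * (W (m3 * m2⁻¹)).2,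
        (W (m1 * m2⁻¹)).2 * (W (m3 * m2⁻¹)).1) = (x, y)} : Finset (ZMod p)).card ≤
        (((Finset.univ : Finset (Bool × Bool)) ×ˢ
          (x.natAbs.divisors ×ˢ y.natAbs.divisors))).card := by
      apply Finset.card_le_card_of_injOn (fun m2 : ZMod p =>
        ((decide (0 ≤ (W (m1 * m2⁻¹)).1), decide (0 ≤ (W (m1 * m2⁻¹)).2)),
          ((W (m1 * m2⁻¹)).1.natAbs, (W (m1 * m2⁻¹)).2.natAbs)))
      · intro m2 hm2
        rw [Finset.mem_coe, Finset.mem_filter] at hm2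
        obtain ⟨hm2s, he⟩ := hm2
        obtain ⟨h20, ⟨a1, a2, a3, a4, a5⟩, ⟨b1, b2, b3, b4, b5⟩⟩ := hprop m2 hm2s
        have nz : ∀ w : ℤ, (w : ZMod p) ≠ 0 → w ≠ 0 := by
          rintro w hw rfl
          simp at hw
        simp only [Prod.mk.injEq] at he
        rw [Finset.mem_coe, Finset.mem_product, Finset.mem_product, Nat.mem_divisors,
          Nat.mem_divisors]
        refine ⟨Finset.mem_univ _, ⟨?_, ?_⟩, ?_, ?_⟩
        · exact Int.natAbs_dvd_natAbs.mpr ⟨_, he.1.symm⟩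
        · rw [← he.1]
          exact Int.natAbs_ne_zero.mpr (mul_ne_zero (nz _ a1) (nz _ b2))
        · exact Int.natAbs_dvd_natAbs.mpr ⟨_, he.2.symm⟩
        · rw [← he.2]
          exact Int.natAbs_ne_zero.mpr (mul_ne_zero (nz _ a2) (nz _ b1))
      · intro m2 hm2 n2 hn2 he
        rw [Finset.mem_coe, Finset.mem_filter] at hm2 hn2
        obtain ⟨h20, ⟨a1, a2, a3, a4, a5⟩, -⟩ := hprop m2 hm2.1
        obtain ⟨g20, ⟨b1, b2, b3, b4, b5⟩, -⟩ := hprop n2 hn2.1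
        simp only [Prod.mk.injEq, decide_eq_decide] at he
        obtain ⟨⟨e1, e2⟩, e3, e4⟩ := he
        have f1 : (W (m1 * m2⁻¹)).1 = (W (m1 * n2⁻¹)).1 := by omega
        have f2 : (W (m1 * m2⁻¹)).2 = (W (m1 * n2⁻¹)).2 := by omega
        rw [f1, f2] at a5
        rw [a5] at b5
        have := mul_right_cancel₀ b2 b5
        have := mul_left_cancel₀ hm1 this
        exact inv_injective this
    refine hcard.trans ?_
    rw [Finset.card_product, Finset.card_product]
    have hdv : ∀ z : ℤ, |z| ≤ ((D ^ 2 : ℕ) : ℤ) → z.natAbs.divisors.card ≤ B := by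
      intro z hz
      by_cases h0 : z = 0
      · simp [h0]
      · exact hB _ (Int.natAbs_ne_zero.mpr h0) (by
          rw [Int.abs_eq_natAbs] at hz
          exact_mod_cast hz)
    have q1 := hdv x hx
    have q2 := hdv y hy
    calc _ ≤ 4 * (B * B) := Nat.mul_le_mul (by simp) (Nat.mul_le_mul q1 q2)
      _ = _ := by ring

theorem pairCount_sq (p : ℕ) (hp : p.Prime) (M : Finset (ZMod p)) (hM : ∀ m ∈ M, m ≠ 0)
    (D B : ℕ) (hB : ∀ n : ℕ, n ≠ 0 → n ≤ D ^ 2 → n.divisors.card ≤ B) :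
    (pairCount p M D : ℝ) ^ 2 ≤ M.card * (4 * (B : ℝ) ^ 2 *
      (16 * (D : ℝ) ^ 4 / p * (M.card : ℝ) ^ 2 + 4 * (D : ℝ) ^ 2 * htSum p M)) := by
  classical
  have h1 : (pairCount p M D) ^ 2 ≤ M.card * ∑ m2 ∈ M,
      (M.filter (fun m1 => resHt p (m1 * m2⁻¹) ≤ D)).card ^ 2 := by
    unfold pairCount
    exact sq_sum_le_card_mul_sum_sq
  have h2 : ∑ m2 ∈ M, (M.filter (fun m1 => resHt p (m1 * m2⁻¹) ≤ D)).card ^ 2 =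
      ∑ m1 ∈ M, ∑ m3 ∈ M,
        (M.filter (fun m2 => resHt p (m1 * m2⁻¹) ≤ D ∧ resHt p (m3 * m2⁻¹) ≤ D)).card := by
    simp only [Finset.card_filter, sq, Finset.sum_mul_sum]
    rw [Finset.sum_comm]
    apply Finset.sum_congr rfl
    intro m1 _
    rw [Finset.sum_comm]
    apply Finset.sum_congr rfl
    intro m3 _
    apply Finset.sum_congr rfl
    intro m2 _
    by_cases a : resHt p (m1 * m2⁻¹) ≤ D <;> by_cases b : resHt p (m3 * m2⁻¹) ≤ D <;> simp [a, b]
  rw [h2] at h1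
  have h3 : ((∑ m1 ∈ M, ∑ m3 ∈ M,
        (M.filter (fun m2 => resHt p (m1 * m2⁻¹) ≤ D ∧ resHt p (m3 * m2⁻¹) ≤ D)).card : ℕ) : ℝ) ≤
      ∑ m1 ∈ M, ∑ m3 ∈ M, 4 * (B : ℝ) ^ 2 *
        (16 * (D : ℝ) ^ 4 / p + 4 * (D : ℝ) ^ 2 * (1 / resHt p (m1 * m3⁻¹))) := by
    push_cast
    apply Finset.sum_le_sum
    intro m1 hm1
    apply Finset.sum_le_sum
    intro m3 hm3
    have q1 := fiber_bound p hp M hM D B hB m1 m3 hm1 hm3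
    have q2 := latSet_card p hp (m1 * m3⁻¹) (D ^ 2)
    calc _ ≤ ((4 * B ^ 2 * (latSet p (m1 * m3⁻¹) (D ^ 2)).card : ℕ) : ℝ) := by exact_mod_cast q1
      _ = 4 * (B : ℝ) ^ 2 * (latSet p (m1 * m3⁻¹) (D ^ 2)).card := by push_cast; ring
      _ ≤ _ := by
        gcongr
        refine q2.trans (le_of_eq ?_)
        push_cast
        ring
  have h4 : ∑ m1 ∈ M, ∑ m3 ∈ M, 4 * (B : ℝ) ^ 2 *
        (16 * (D : ℝ) ^ 4 / p + 4 * (D : ℝ) ^ 2 * (1 / resHt p (m1 * m3⁻¹))) =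
      4 * (B : ℝ) ^ 2 *
      (16 * (D : ℝ) ^ 4 / p * (M.card : ℝ) ^ 2 + 4 * (D : ℝ) ^ 2 * htSum p M) := by
    unfold htSum
    simp only [← Finset.mul_sum, Finset.sum_add_distrib, Finset.sum_const, nsmul_eq_mul]
    ring
  rw [h4] at h3
  calc (pairCount p M D : ℝ) ^ 2 ≤ M.card * ((∑ m1 ∈ M, ∑ m3 ∈ M,
        (M.filter (fun m2 => resHt p (m1 * m2⁻¹) ≤ D ∧ resHt p (m3 * m2⁻¹) ≤ D)).card : ℕ) : ℝ) := by
        exact_mod_cast h1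
    _ ≤ _ := by gcongr

theorem htSum_le (p : ℕ) (hp : p.Prime) (M : Finset (ZMod p)) (F : ℝ)
    (hF : ∀ D : ℕ, 1 ≤ D → D ≤ 2 * p → (pairCount p M D : ℝ) / D ≤ F) :
    htSum p M ≤ 2 * (Nat.log 2 p + 1 : ℕ) * F := by
  classical
  have h1 : ∀ l : ZMod p, (1 : ℝ) / resHt p l ≤ ∑ j ∈ Finset.range (Nat.log 2 p + 1),
      (if resHt p l ≤ 2 ^ (j + 1) then (1 : ℝ) else 0) * (2 / ((2 ^ (j + 1) : ℕ) : ℝ)) := by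
    intro l
    have hpos := resHt_pos p hp l
    have hlt := resHt_lt p hp l
    set j := Nat.log 2 (resHt p l) with hj
    have hjm : j ∈ Finset.range (Nat.log 2 p + 1) := by
      rw [Finset.mem_range]
      exact Nat.lt_succ_of_le (Nat.log_mono_right hlt.le)
    have ha : resHt p l ≤ 2 ^ (j + 1) := (Nat.lt_pow_succ_log_self (by norm_num) _).le
    have hb : 2 ^ j ≤ resHt p l := Nat.pow_log_le_self 2 hpos.ne'
    have hb' : (2 : ℝ) ^ j ≤ resHt p l := by exact_mod_cast hb
    refine le_trans ?_ (Finset.single_le_sum (f := fun j =>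
      (if resHt p l ≤ 2 ^ (j + 1) then (1 : ℝ) else 0) * (2 / ((2 ^ (j + 1) : ℕ) : ℝ))) ?_ hjm)
    · simp only [ha, if_true, one_mul]
      have : (2 : ℝ) / ((2 ^ (j + 1) : ℕ) : ℝ) = 1 / 2 ^ j := by
        push_cast
        rw [pow_succ]
        field_simp
      rw [this]
      gcongr
    · intro i _
      positivity
  unfold htSum
  calc _ ≤ ∑ m1 ∈ M, ∑ m2 ∈ M, ∑ j ∈ Finset.range (Nat.log 2 p + 1),
      (if resHt p (m1 * m2⁻¹) ≤ 2 ^ (j + 1) then (1 : ℝ) else 0) *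
        (2 / ((2 ^ (j + 1) : ℕ) : ℝ)) :=
        Finset.sum_le_sum fun _ _ => Finset.sum_le_sum fun _ _ => h1 _
    _ = ∑ j ∈ Finset.range (Nat.log 2 p + 1),
        (pairCount p M (2 ^ (j + 1)) : ℝ) * (2 / ((2 ^ (j + 1) : ℕ) : ℝ)) := by
        rw [Finset.sum_comm]
        simp_rw [Finset.sum_comm (s := M) (t := Finset.range _)]
        apply Finset.sum_congr rfl
        intro j _
        simp only [← Finset.sum_mul]
        congr 1
        unfold pairCount
        push_cast
        apply Finset.sum_congr rfl
        intro m2 _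
        rw [Finset.card_filter]
        push_cast
        rfl
    _ ≤ ∑ j ∈ Finset.range (Nat.log 2 p + 1), 2 * F := by
        apply Finset.sum_le_sum
        intro j hj
        rw [Finset.mem_range] at hj
        have : 2 ^ (j + 1) ≤ 2 * p := by
          rw [pow_succ, mul_comm]
          apply Nat.mul_le_mul_left
          exact Nat.pow_le_of_le_log hp.ne_zero (by omega)
        have := hF (2 ^ (j + 1)) Nat.one_le_two_pow this
        calc _ = 2 * ((pairCount p M (2 ^ (j + 1)) : ℝ) / ((2 ^ (j + 1) : ℕ) : ℝ)) := by ring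
          _ ≤ _ := by gcongr
    _ = _ := by
        rw [Finset.sum_const, Finset.card_range, nsmul_eq_mul]
        ring

theorem energy_le (p : ℕ) (hp : p.Prime) (M : Finset (ZMod p)) (hM : ∀ m ∈ M, m ≠ 0) (H : ℕ) :
    (((((Finset.Icc 1 H) ×ˢ (Finset.Icc 1 H)) ×ˢ (M ×ˢ M)).filter
            (fun q => (q.1.1 : ZMod p) * q.2.1 = (q.1.2 : ZMod p) * q.2.2)).card : ℝ) ≤
      16 * (H : ℝ) ^ 2 * (M.card : ℝ) ^ 2 / p + 4 * H * htSum p M := by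
  classical
  have := Fact.mk hp
  have h1 : ((((Finset.Icc 1 H) ×ˢ (Finset.Icc 1 H)) ×ˢ (M ×ˢ M)).filter
            (fun q => (q.1.1 : ZMod p) * q.2.1 = (q.1.2 : ZMod p) * q.2.2)).card ≤
      ((M ×ˢ M).sigma (fun m => latSet p (m.1 * m.2⁻¹) H)).card := by
    apply Finset.card_le_card_of_injOn
      (fun q : (ℕ × ℕ) × (ZMod p × ZMod p) =>
        (⟨(q.2.2, q.2.1), ((q.1.1 : ℤ), (q.1.2 : ℤ))⟩ : (_ : ZMod p × ZMod p) × (ℤ × ℤ)))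
    · rintro ⟨⟨a, b⟩, ⟨m, n⟩⟩ hq
      simp only [Finset.coe_filter, Finset.mem_product, Finset.mem_Icc, Set.mem_ofPred_eq] at hq
      obtain ⟨⟨⟨⟨a1, a2⟩, b1, b2⟩, hm, hn⟩, he⟩ := hq
      simp only [Finset.mem_coe, Finset.mem_sigma, Finset.mem_product, mem_latSet]
      have hm0 := hM m hm
      refine ⟨⟨hn, hm⟩, ⟨?_, ?_⟩, Or.inl ?_, ?_⟩
      · simpa using a2
      · simpa using b2
      · simp only [ne_eq, Nat.cast_eq_zero]
        omega
      · push_cast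
        field_simp
        linear_combination he
    · rintro ⟨⟨a, b⟩, ⟨m, n⟩⟩ _ ⟨⟨a', b'⟩, ⟨m', n'⟩⟩ _ he
      simp at he
      obtain ⟨⟨rfl, rfl⟩, rfl, rfl⟩ := he
      rfl
  rw [Finset.card_sigma] at h1
  calc _ ≤ ((∑ m ∈ M ×ˢ M, (latSet p (m.1 * m.2⁻¹) H).card : ℕ) : ℝ) := by exact_mod_cast h1
    _ ≤ ∑ m ∈ M ×ˢ M, (16 * (H : ℝ) ^ 2 / p + 4 * H * (1 / resHt p (m.1 * m.2⁻¹))) := by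
        push_cast
        apply Finset.sum_le_sum
        intro m _
        refine (latSet_card p hp _ H).trans (le_of_eq ?_)
        ring
    _ = _ := by
        unfold htSum
        rw [Finset.sum_add_distrib, ← Finset.mul_sum, Finset.sum_product
          (f := fun m : ZMod p × ZMod p => (1 : ℝ) / resHt p (m.1 * m.2⁻¹))]
        simp only [Finset.sum_const, nsmul_eq_mul, Finset.card_product]
        push_cast
        ring

theorem scale_real (p D F b L m t S : ℝ) (hp0 : 0 < p) (hD0 : 0 < D) (hF0 : 0 ≤ F) (hB1' : 1 ≤ b)
    (hL1 : 1 ≤ L) (hm0 : 0 ≤ m) (ht : 0 ≤ t) (ht4 : t ^ 4 = m ^ 3 / p) (hS : S ≤ 2 * L * F)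
    (hAM : F * D ≤ m ^ 2)
    (hsq : (F * D) ^ 2 ≤ m * (4 * b ^ 2 * (16 * D ^ 4 / p * m ^ 2 + 4 * D ^ 2 * S))) :
    F ≤ 64 * b ^ 2 * L * (m * (1 + t)) := by
  have h2 : F ^ 2 ≤ 64 * b ^ 2 * (m ^ 3 / p) * D ^ 2 + 32 * b ^ 2 * L * m * F := by
    have : (F * D) ^ 2 ≤ (64 * b ^ 2 * (m ^ 3 / p) * D ^ 2 + 32 * b ^ 2 * L * m * F) * D ^ 2 := by
      calc (F * D) ^ 2 ≤ _ := hsq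
        _ ≤ m * (4 * b ^ 2 * (16 * D ^ 4 / p * m ^ 2 + 4 * D ^ 2 * (2 * L * F))) := by
          gcongr
        _ = _ := by field_simp; ring
    rw [mul_pow] at this
    exact le_of_mul_le_mul_right this (by positivity)
  rcases le_total (64 * b ^ 2 * (m ^ 3 / p) * D ^ 2) (32 * b ^ 2 * L * m * F) with h | h
  · have h3 : F * F ≤ (64 * b ^ 2 * L * m) * F := by nlinarith
    have h4 : F ≤ 64 * b ^ 2 * L * m := by
      rcases hF0.eq_or_lt with h0 | h0
      · rw [← h0]; positivity
      · exact le_of_mul_le_mul_right h3 h0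
    calc F ≤ 64 * b ^ 2 * L * m := h4
      _ ≤ _ := by
        have : 0 ≤ 64 * b ^ 2 * L * (m * t) := by positivity
        linarith
  · have h3 : F ^ 2 ≤ 128 * b ^ 2 * t ^ 4 * D ^ 2 := by rw [ht4]; linarith
    have h4 : F ^ 4 ≤ (4 * b * m * t) ^ 4 := by
      calc F ^ 4 = F ^ 2 * F ^ 2 := by ring
        _ ≤ (128 * b ^ 2 * t ^ 4 * D ^ 2) * F ^ 2 := by gcongr
        _ = 128 * b ^ 2 * t ^ 4 * (F * D) ^ 2 := by ring
        _ ≤ 128 * b ^ 2 * t ^ 4 * (m ^ 2) ^ 2 := by gcongr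
        _ ≤ 256 * (b ^ 2 * b ^ 2) * t ^ 4 * (m ^ 2) ^ 2 := by
          gcongr
          · norm_num
          · nlinarith [one_le_pow₀ hB1' (n := 2)]
        _ = _ := by ring
    have h5 : F ≤ 4 * b * m * t :=
      (pow_le_pow_iff_left₀ hF0 (by positivity) (by norm_num)).mp h4
    calc F ≤ 4 * b * m * t := h5
      _ ≤ 64 * b ^ 2 * L * (m * t) := by
        have : 4 * b ≤ 64 * b ^ 2 * L := by
          have : b ≤ b ^ 2 := by nlinarith
          have : b ^ 2 ≤ b ^ 2 * L := by nlinarith [sq_nonneg b]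
          nlinarith
        calc 4 * b * m * t = 4 * b * (m * t) := by ring
          _ ≤ _ := by gcongr
      _ ≤ _ := by
        have : 0 ≤ 64 * b ^ 2 * L * m := by positivity
        linarith

/-- choice of the extremal scale and the bound of the height sum -/
theorem htSum_final (p : ℕ) (hp : p.Prime) (M : Finset (ZMod p)) (hM : ∀ m ∈ M, m ≠ 0)
    (B : ℕ) (hB1 : 1 ≤ B)
    (hB : ∀ n : ℕ, n ≠ 0 → n ≤ 4 * p ^ 2 → n.divisors.card ≤ B) (t : ℝ) (ht : 0 ≤ t)
    (ht4 : t ^ 4 = (M.card : ℝ) ^ 3 / p) :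
    htSum p M ≤ 128 * (B : ℝ) ^ 2 * ((Nat.log 2 p + 1 : ℕ) : ℝ) ^ 2 * (M.card * (1 + t)) := by
  obtain ⟨D, hD, hmax⟩ := Finset.exists_max_image (Finset.Icc 1 (2 * p))
    (fun D => (pairCount p M D : ℝ) / D) ⟨1, by
      rw [Finset.mem_Icc]; have := hp.pos; omega⟩
  rw [Finset.mem_Icc] at hD
  set A : ℝ := ((pairCount p M D : ℕ) : ℝ) with hA
  set F : ℝ := A / D with hF
  have hD0 : (0 : ℝ) < D := by exact_mod_cast hD.1
  have hp0 : (0 : ℝ) < p := by exact_mod_cast hp.pos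
  have hFD : A = F * D := by rw [hF]; field_simp
  have hF0 : 0 ≤ F := div_nonneg (Nat.cast_nonneg _) hD0.le
  set L : ℝ := ((Nat.log 2 p + 1 : ℕ) : ℝ) with hL
  have hL1 : 1 ≤ L := by rw [hL]; push_cast; linarith [(Nat.cast_nonneg (Nat.log 2 p) : (0 : ℝ) ≤ _)]
  have hS : htSum p M ≤ 2 * L * F := by
    apply htSum_le p hp M F
    intro D' h1 h2
    exact hmax D' (Finset.mem_Icc.mpr ⟨h1, h2⟩)
  have hDB : ∀ n : ℕ, n ≠ 0 → n ≤ D ^ 2 → n.divisors.card ≤ B := by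
    intro n hn hn2
    apply hB n hn
    calc n ≤ D ^ 2 := hn2
      _ ≤ (2 * p) ^ 2 := Nat.pow_le_pow_left hD.2 2
      _ = _ := by ring
  have hsq := pairCount_sq p hp M hM D B hDB
  rw [← hA, hFD] at hsq
  have hAM : F * D ≤ (M.card : ℝ) ^ 2 := by
    rw [← hFD, hA]; exact_mod_cast pairCount_le p M D
  set m : ℝ := (M.card : ℝ) with hm
  have hm0 : 0 ≤ m := Nat.cast_nonneg _
  have hB1' : (1 : ℝ) ≤ B := by exact_mod_cast hB1
  set b : ℝ := (B : ℝ) with hb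
  have hFfin : F ≤ 64 * b ^ 2 * L * (m * (1 + t)) :=
    scale_real p D F b L m t (htSum p M) hp0 hD0 hF0 hB1' hL1 hm0 ht ht4 hS hAM hsq
  calc htSum p M ≤ 2 * L * F := hS
    _ ≤ 2 * L * (64 * b ^ 2 * L * (m * (1 + t))) :=
        mul_le_mul_of_nonneg_left hFfin (by linarith)
    _ = _ := by ring

theorem log_bound (δ : ℝ) (hδ : 0 < δ) (p : ℕ) (hp : p.Prime) :
    ((Nat.log 2 p + 1 : ℕ) : ℝ) ≤ (1 / (δ * Real.log 2) + 1) * (p : ℝ) ^ δ := by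
  have hp1 : (1 : ℝ) ≤ p := by exact_mod_cast hp.one_le
  have hl2 : 0 < Real.log 2 := Real.log_pos (by norm_num)
  have h1 : ((2 : ℝ)) ^ (Nat.log 2 p) ≤ p := by exact_mod_cast Nat.pow_log_le_self 2 hp.ne_zero
  have h2 : (Nat.log 2 p : ℝ) * Real.log 2 ≤ Real.log p := by
    rw [← Real.log_pow]
    exact Real.log_le_log (by positivity) h1
  have h3 : Real.log p ≤ (p : ℝ) ^ δ / δ := Real.log_le_rpow_div (by positivity) hδ
  have h4 : (1 : ℝ) ≤ (p : ℝ) ^ δ := Real.one_le_rpow hp1 hδ.le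
  have h5 : (Nat.log 2 p : ℝ) ≤ (p : ℝ) ^ δ / δ / Real.log 2 := by
    rw [le_div_iff₀ hl2]; linarith
  push_cast
  calc (Nat.log 2 p : ℝ) + 1 ≤ (p : ℝ) ^ δ / δ / Real.log 2 + (p : ℝ) ^ δ := by linarith
    _ = _ := by field_simp

theorem master (η : ℝ) (hη : 0 < η) : ∃ C : ℝ, 1 ≤ C ∧ ∀ (p : ℕ), p.Prime → ∀ (H : ℕ),
    ∀ (M : Finset (ZMod p)), (∀ m ∈ M, m ≠ 0) → ∀ t : ℝ, 0 ≤ t → t ^ 4 = (M.card : ℝ) ^ 3 / p →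
    (((((Finset.Icc 1 H) ×ˢ (Finset.Icc 1 H)) ×ˢ (M ×ˢ M)).filter
            (fun q => (q.1.1 : ZMod p) * q.2.1 = (q.1.2 : ZMod p) * q.2.2)).card : ℝ) ≤
      C * ((H : ℝ) ^ 2 * (M.card : ℝ) ^ 2 / p + H * M.card * (p : ℝ) ^ η * (1 + t)) := by
  set δ : ℝ := η / 6 with hδ
  have hδ0 : 0 < δ := by positivity
  obtain ⟨C1, hC1, hdiv⟩ := divisor_bound δ hδ0
  have hl2 : 0 < Real.log 2 := Real.log_pos (by norm_num)
  set C2 : ℝ := 1 / (δ * Real.log 2) + 1 with hC2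
  have hC2' : 1 ≤ C2 := by
    have : 0 < 1 / (δ * Real.log 2) := by positivity
    linarith
  set C3 : ℝ := C1 * 4 ^ δ with hC3
  have hC3' : 1 ≤ C3 := by
    have : (1 : ℝ) ≤ 4 ^ δ := Real.one_le_rpow (by norm_num) hδ0.le
    nlinarith
  refine ⟨16 + 512 * (C3 ^ 2 * C2 ^ 2), by nlinarith [sq_nonneg (C3 * C2)], ?_⟩
  intro p hp H M hM t ht ht4
  have hp1 : (1 : ℝ) ≤ p := by exact_mod_cast hp.one_le
  have hp0 : (0 : ℝ) < p := by linarith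
  have hBr1 : (1 : ℝ) ≤ C3 * (p : ℝ) ^ (2 * δ) := by
    have : (1 : ℝ) ≤ (p : ℝ) ^ (2 * δ) := Real.one_le_rpow hp1 (by positivity)
    nlinarith
  have hfl := htSum_final p hp M hM ⌊C3 * (p : ℝ) ^ (2 * δ)⌋₊
    (by rw [Nat.one_le_floor_iff]; exact hBr1)
    (by
      intro n hn hn4
      apply Nat.le_floor
      refine (hdiv n hn).trans ?_
      have h4 : (n : ℝ) ≤ 4 * (p : ℝ) ^ 2 := by exact_mod_cast hn4
      have h5 : (4 * (p : ℝ) ^ 2) ^ δ = 4 ^ δ * (p : ℝ) ^ (2 * δ) := by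
        rw [Real.mul_rpow (by norm_num) (by positivity), Real.rpow_mul hp0.le]
        norm_num
      rw [hC3, mul_assoc, ← h5]
      gcongr) t ht ht4
  have hb : ((⌊C3 * (p : ℝ) ^ (2 * δ)⌋₊ : ℕ) : ℝ) ≤ C3 * (p : ℝ) ^ (2 * δ) :=
    Nat.floor_le (by linarith)
  have hl := log_bound δ hδ0 p hp
  rw [← hC2] at hl
  have hE := energy_le p hp M hM H
  have hpow : ((p : ℝ) ^ (2 * δ)) ^ 2 * ((p : ℝ) ^ δ) ^ 2 = (p : ℝ) ^ η := by
    rw [← Real.rpow_natCast, ← Real.rpow_natCast, ← Real.rpow_mul hp0.le, ← Real.rpow_mul hp0.le,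
      ← Real.rpow_add hp0]
    congr 1
    rw [hδ]; push_cast; ring
  have hS : htSum p M ≤ 128 * (C3 ^ 2 * C2 ^ 2) * (p : ℝ) ^ η * (M.card * (1 + t)) := by
    calc htSum p M ≤ _ := hfl
      _ ≤ 128 * (C3 * (p : ℝ) ^ (2 * δ)) ^ 2 * (C2 * (p : ℝ) ^ δ) ^ 2 * (M.card * (1 + t)) := by
        gcongr
      _ = 128 * (C3 ^ 2 * C2 ^ 2) * (((p : ℝ) ^ (2 * δ)) ^ 2 * ((p : ℝ) ^ δ) ^ 2) *
          (M.card * (1 + t)) := by ring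
      _ = _ := by rw [hpow]
  set K : ℝ := C3 ^ 2 * C2 ^ 2 with hK
  have hK0 : 0 ≤ K := by positivity
  calc _ ≤ _ := hE
    _ ≤ 16 * (H : ℝ) ^ 2 * (M.card : ℝ) ^ 2 / p + 4 * H * (128 * K * (p : ℝ) ^ η * (M.card * (1 + t))) := by
      gcongr
    _ = 16 * ((H : ℝ) ^ 2 * (M.card : ℝ) ^ 2 / p) + 512 * K * (H * M.card * (p : ℝ) ^ η * (1 + t)) := by
      ring
    _ ≤ _ := by
      have a1 : 0 ≤ (H : ℝ) ^ 2 * (M.card : ℝ) ^ 2 / p := by positivity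
      have a2 : 0 ≤ H * M.card * (p : ℝ) ^ η * (1 + t) := by positivity
      nlinarith [mul_nonneg hK0 a1]

theorem final_real (p h m C ε J : ℝ) (hp1 : 1 ≤ p) (hh0 : 0 ≤ h) (hm0 : 0 ≤ m) (hC : 1 ≤ C)
    (hε : 0 < ε)
    (hmain : ∀ t : ℝ, 0 ≤ t → t ^ 4 = m ^ 3 / p →
      J ≤ C * (h ^ 2 * m ^ 2 / p + h * m * p ^ (ε / 4) * (1 + t))) :
    (p ^ ((2:ℝ)/3) ≤ h → J ≤ 8 * C * (h ^ 2 * m ^ 2 / p + h * m * p ^ ε)) ∧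
    (h < p ^ ((2:ℝ)/3) → p ^ ((1:ℝ)/3) ≤ m →
      J ≤ 8 * C * (h ^ 2 * m ^ 2 / p + h * m ^ ((7:ℝ)/4) * p ^ (-(1:ℝ)/4 + ε) + m ^ 2)) ∧
    (h < p ^ ((2:ℝ)/3) → m < p ^ ((1:ℝ)/3) → J ≤ 8 * C * (h * m * p ^ ε + m ^ 2)) := by
  have hp0 : (0 : ℝ) < p := by linarith
  set r : ℝ := p ^ ((1 : ℝ) / 3) with hr
  have hr0 : 0 < r := by positivity
  have hr3 : r ^ 3 = p := by
    rw [hr, ← Real.rpow_natCast, ← Real.rpow_mul hp0.le]; norm_num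
  have hr2 : p ^ ((2 : ℝ) / 3) = r ^ 2 := by
    rw [hr, ← Real.rpow_natCast, ← Real.rpow_mul hp0.le]; norm_num
  set y : ℝ := m / r with hy
  have hy0 : 0 ≤ y := by positivity
  set t : ℝ := y ^ ((3 : ℝ) / 4) with ht
  have ht0 : 0 ≤ t := by positivity
  have ht4 : t ^ 4 = m ^ 3 / p := by
    rw [ht, ← Real.rpow_natCast, ← Real.rpow_mul hy0, ← hr3, ← div_pow, ← hy]
    norm_num
  have hJ := hmain t ht0 ht4
  set P : ℝ := p ^ (ε / 4) with hP
  have hP1 : 1 ≤ P := Real.one_le_rpow hp1 (by positivity)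
  have hP4 : P ^ 4 = p ^ ε := by
    rw [hP, ← Real.rpow_natCast, ← Real.rpow_mul hp0.le]
    congr 1; push_cast; ring
  have hPle : P ≤ P ^ 4 := by
    calc P = P ^ 1 := (pow_one P).symm
      _ ≤ P ^ 4 := pow_le_pow_right₀ hP1 (by norm_num)
  have hmr : m = y * r := by rw [hy]; field_simp
  have hA0 : 0 ≤ h ^ 2 * m ^ 2 / p := by positivity
  have hC0 : 0 ≤ C := by linarith
  rw [hr2, ← hP4]
  have small : m < r → t ≤ 1 := by
    intro hlt
    apply Real.rpow_le_one hy0 _ (by norm_num)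
    rw [hy, div_le_one hr0]; exact hlt.le
  have large : r ≤ m → 1 ≤ t := by
    intro hle
    apply Real.one_le_rpow _ (by norm_num)
    rw [hy, one_le_div hr0]; exact hle
  have hsmall : m < r → J ≤ C * (h ^ 2 * m ^ 2 / p + 2 * (h * m * P ^ 4)) := by
    intro hlt
    have hq : h * m * P * (1 + t) ≤ 2 * (h * m * P ^ 4) := by
      calc h * m * P * (1 + t) ≤ h * m * P ^ 4 * (1 + 1) := by
            gcongr
            exact small hlt
        _ = _ := by ring
    exact hJ.trans (mul_le_mul_of_nonneg_left (by linarith) hC0)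
  refine ⟨fun h1 => ?_, fun h1 h2 => ?_, fun h1 h2 => ?_⟩
  · rcases lt_or_ge m r with hlt | hge
    · refine (hsmall hlt).trans ?_
      have : 0 ≤ h * m * P ^ 4 := by positivity
      nlinarith [mul_nonneg hC0 hA0, mul_nonneg hC0 this]
    · have ht1 := large hge
      have hyP : P * t ≤ P ^ 4 + y := by
        set z : ℝ := y ^ ((1 : ℝ) / 4) with hz
        have hz0 : 0 ≤ z := by positivity
        have hz4 : z ^ 4 = y := by
          rw [hz, ← Real.rpow_natCast, ← Real.rpow_mul hy0]; norm_num
        have hz3 : z ^ 3 = t := by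
          rw [hz, ht, ← Real.rpow_natCast, ← Real.rpow_mul hy0]; norm_num
        rw [← hz3, ← hz4]
        have hP0 : 0 ≤ P := by linarith
        rcases le_total z P with hzP | hzP
        · have : P * z ^ 3 ≤ P * P ^ 3 := by gcongr
          have : 0 ≤ z ^ 4 := by positivity
          nlinarith
        · have : P * z ^ 3 ≤ z * z ^ 3 := by gcongr
          have : 0 ≤ P ^ 4 := by positivity
          nlinarith
      have hyH : h * m * y ≤ h ^ 2 * m ^ 2 / p := by
        have hyr : y * p ≤ h * m := by
          calc y * p = r ^ 2 * m := by rw [hmr, ← hr3]; ring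
            _ ≤ h * m := by gcongr
        rw [le_div_iff₀ hp0]
        calc h * m * y * p = h * m * (y * p) := by ring
          _ ≤ h * m * (h * m) := by gcongr
          _ = _ := by ring
      have hfin : h * m * P * (1 + t) ≤ 2 * (h * m * P ^ 4) + 2 * (h ^ 2 * m ^ 2 / p) := by
        calc h * m * P * (1 + t) ≤ h * m * P * (t + t) := by gcongr
          _ = 2 * (h * m * (P * t)) := by ring
          _ ≤ 2 * (h * m * (P ^ 4 + y)) := by gcongr
          _ = 2 * (h * m * P ^ 4) + 2 * (h * m * y) := by ring
          _ ≤ _ := by gcongr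
      have hB0 : 0 ≤ h * m * P ^ 4 := by positivity
      calc J ≤ _ := hJ
        _ ≤ C * (h ^ 2 * m ^ 2 / p + (2 * (h * m * P ^ 4) + 2 * (h ^ 2 * m ^ 2 / p))) := by gcongr
        _ ≤ _ := by nlinarith [mul_nonneg hC0 hA0, mul_nonneg hC0 hB0]
  · have ht1 := large h2
    have hmpos : 0 < m := lt_of_lt_of_le hr0 h2
    have hX : h * m ^ ((7 : ℝ) / 4) * p ^ (-(1 : ℝ) / 4 + ε) = h * m * P ^ 4 * t := by
      have e1 : t = m ^ ((3 : ℝ) / 4) * p ^ (-(1 : ℝ) / 4) := by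
        rw [ht, hy, Real.div_rpow hm0 hr0.le, hr, ← Real.rpow_mul hp0.le, div_eq_mul_inv,
          ← Real.rpow_neg hp0.le]
        norm_num
      have e2 : m ^ ((7 : ℝ) / 4) = m * m ^ ((3 : ℝ) / 4) := by
        rw [show (7 : ℝ) / 4 = 1 + 3 / 4 by norm_num, Real.rpow_add hmpos, Real.rpow_one]
      rw [e1, e2, Real.rpow_add hp0, hP4]
      ring
    rw [hX]
    have hfin : h * m * P * (1 + t) ≤ 2 * (h * m * P ^ 4 * t) := by
      calc h * m * P * (1 + t) ≤ h * m * P ^ 4 * (t + t) := by gcongr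
        _ = _ := by ring
    have hB0 : 0 ≤ h * m * P ^ 4 * t := by positivity
    have hD0 : 0 ≤ m ^ 2 := by positivity
    calc J ≤ _ := hJ
      _ ≤ C * (h ^ 2 * m ^ 2 / p + 2 * (h * m * P ^ 4 * t)) := by gcongr
      _ ≤ _ := by nlinarith [mul_nonneg hC0 hA0, mul_nonneg hC0 hB0, mul_nonneg hC0 hD0]
  · have hmainle : h ^ 2 * m ^ 2 / p ≤ h * m * P ^ 4 := by
      have hhm : h * m ≤ p := by
        calc h * m ≤ r ^ 2 * r := by gcongr
          _ = p := by rw [← hr3]; ring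
      rw [div_le_iff₀ hp0]
      calc h ^ 2 * m ^ 2 = h * m * 1 * (h * m) := by ring
        _ ≤ h * m * P ^ 4 * p := by
          gcongr
          exact one_le_pow₀ hP1
    have hB0 : 0 ≤ h * m * P ^ 4 := by positivity
    have hD0 : 0 ≤ m ^ 2 := by positivity
    calc J ≤ _ := hsmall h2
      _ ≤ C * (h * m * P ^ 4 + 2 * (h * m * P ^ 4)) := by gcongr
      _ ≤ _ := by
        have e1 := mul_nonneg hC0 hB0
        have e2 := mul_nonneg hC0 hD0
        generalize h * m * P ^ 4 = w at e1 ⊢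
        generalize m ^ 2 = x at e2 ⊢
        linarith


/-- Lemma 2.1 (Banks–Shparlinski): bound for the number of solutions of
h₁m₁ ≡ h₂m₂ (mod p) with h₁, h₂ ∈ {1,…,H} and m₁, m₂ ∈ 𝓜. -/
theorem stmt_4 :
    ∀ ε : ℝ, 0 < ε → ∃ C : ℝ, 0 < C ∧
      ∀ (p : ℕ), p.Prime → ∀ (H : ℕ), 1 ≤ H → H ≤ p →
      ∀ (M : Finset (ZMod p)), (∀ m ∈ M, m ≠ 0) →
      (((p : ℝ) ^ ((2:ℝ)/3) ≤ (H : ℝ) →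
        (((((Finset.Icc 1 H) ×ˢ (Finset.Icc 1 H)) ×ˢ (M ×ˢ M)).filter
            (fun q => (q.1.1 : ZMod p) * q.2.1 = (q.1.2 : ZMod p) * q.2.2)).card : ℝ) ≤
          C * ((H : ℝ) ^ 2 * (M.card : ℝ) ^ 2 / (p : ℝ)
            + (H : ℝ) * (M.card : ℝ) * (p : ℝ) ^ ε)) ∧
       ((H : ℝ) < (p : ℝ) ^ ((2:ℝ)/3) → (p : ℝ) ^ ((1:ℝ)/3) ≤ (M.card : ℝ) →
        (((((Finset.Icc 1 H) ×ˢ (Finset.Icc 1 H)) ×ˢ (M ×ˢ M)).filter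
            (fun q => (q.1.1 : ZMod p) * q.2.1 = (q.1.2 : ZMod p) * q.2.2)).card : ℝ) ≤
          C * ((H : ℝ) ^ 2 * (M.card : ℝ) ^ 2 / (p : ℝ)
            + (H : ℝ) * (M.card : ℝ) ^ ((7:ℝ)/4) * (p : ℝ) ^ (-(1:ℝ)/4 + ε)
            + (M.card : ℝ) ^ 2)) ∧
       ((H : ℝ) < (p : ℝ) ^ ((2:ℝ)/3) → (M.card : ℝ) < (p : ℝ) ^ ((1:ℝ)/3) →
        (((((Finset.Icc 1 H) ×ˢ (Finset.Icc 1 H)) ×ˢ (M ×ˢ M)).filter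
            (fun q => (q.1.1 : ZMod p) * q.2.1 = (q.1.2 : ZMod p) * q.2.2)).card : ℝ) ≤
          C * ((H : ℝ) * (M.card : ℝ) * (p : ℝ) ^ ε + (M.card : ℝ) ^ 2))) := by
  intro ε hε
  obtain ⟨C, hC, hmain⟩ := master (ε / 4) (by positivity)
  refine ⟨8 * C, by positivity, ?_⟩
  intro p hp H hH1 hHp M hM
  exact final_real p H M.card C ε _ (by exact_mod_cast hp.one_le) (Nat.cast_nonneg _)
    (Nat.cast_nonneg _) hC hε (hmain p hp H M hM)
end
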